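/- Let H be a connected graph with at least one edge, let λ ∈ (0,1/2) and ε > 0. Then there exists a constant C = C(H,λ,ε) such that for every n ≥ v(H) and every p ∈ (λ, 1−λ) the following holds. Sample G ~ G(n,p), let X_H be the subgraph count of H in G, let μ_H and σ_H be the mean and standard deviation of X_H, and set Z_H = (X_H − μ_H)/σ_H. Then sup_{z ∈ (ℤ−μ_H)/σ_H} |σ_H·ℙ[Z_H = z] − 𝒩(z)| ≤ C·n^{ε−1/2}, and Σ_{z ∈ (ℤ−μ_H)/σ_H} |ℙ[Z_H = z] − 𝒩(z)/σ_H| ≤ C·n^{ε−1/2}. -/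

import Mathlib

open MeasureTheory ProbabilityTheory
open scoped ENNReal NNReal

noncomputable section

/-- The standard normal density. -/
def stdNormal (z : ℝ) : ℝ := (Real.sqrt (2 * Real.pi))⁻¹ * Real.exp (-(z ^ 2) / 2)

/-- The uniform probability measure on a subset of a finite type. -/
def finUniform {γ : Type*} [Fintype γ] [MeasurableSpace γ] (s : Set γ) : Measure γ :=
  (Nat.card s : ℝ≥0∞)⁻¹ • ∑ a : γ, s.indicator (fun _ => (1 : ℝ≥0∞)) a • Measure.dirac a

/-- The product Bernoulli(p) measure on `ι → Bool`. -/
def bernoulliPi (ι : Type*) [Fintype ι] [DecidableEq ι] (p : ℝ) : Measure (ι → Bool) :=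
  ∑ x : ι → Bool, (∏ i : ι, ENNReal.ofReal (if x i then p else 1 - p)) • Measure.dirac x

/-- The Erdős–Rényi G(n,p) measure, as a measure on edge-indicator functions. -/
def gnp (n : ℕ) (p : ℝ) : Measure (Sym2 (Fin n) → Bool) := bernoulliPi _ p

/-- The G(n,m) measure: uniform over edge-indicator functions with exactly `m` edges
(diagonal coordinates forced to `false`). -/
def gnm (n m : ℕ) : Measure (Sym2 (Fin n) → Bool) :=
  finUniform {x | (∀ e : Sym2 (Fin n), e.IsDiag → x e = false) ∧
    (Finset.univ.filter fun e : Sym2 (Fin n) => x e = true).card = m}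

/-- The simple graph associated to an edge-indicator function. -/
def graphOfFn {n : ℕ} (x : Sym2 (Fin n) → Bool) : SimpleGraph (Fin n) :=
  SimpleGraph.fromRel fun i j => x s(i, j)

/-- The number of subgraphs of `G` isomorphic to `H`: the number of edge subsets of `G`
which are the image of the edge set of `H` under an injection of the vertices. -/
def subgraphCount {β : Type*} [Fintype β] (H : SimpleGraph β) {n : ℕ}
    (G : SimpleGraph (Fin n)) : ℕ :=
  Nat.card {E : Finset (Sym2 (Fin n)) // ↑E ⊆ G.edgeSet ∧
    ∃ f : β ↪ Fin n, (↑E : Set (Sym2 (Fin n))) = Sym2.map f '' H.edgeSet}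

/-- The number of induced copies of `H` in `G`: the number of vertex subsets `U` of the
correct size such that `G[U]` is isomorphic to `H`. -/
def inducedCount {β : Type*} [Fintype β] (H : SimpleGraph β) {n : ℕ}
    (G : SimpleGraph (Fin n)) : ℕ :=
  Nat.card {U : Finset (Fin n) // U.card = Fintype.card β ∧
    Nonempty (H ≃g (G.induce (↑U : Set (Fin n))))}

end

set_option linter.unusedSectionVars false
set_option linter.unusedVariables false
set_option linter.style.setOption false

set_option linter.unusedSectionVars false
set_option linter.unusedVariables false
set_option linter.unusedDecidableInType false
set_option linter.unusedFintypeInType false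

namespace SCL
open Finset

section Base
variable {J : Type*} [Fintype J] [DecidableEq J]

def wt (p : ℝ) (b : Bool) : ℝ := if b then p else 1 - p
def W (p : ℝ) (x : J → Bool) : ℝ := ∏ i, wt p (x i)
def Ex {E : Type*} [AddCommMonoid E] [Module ℝ E] (p : ℝ) (f : (J → Bool) → E) : E :=
  ∑ x, W p x • f x

lemma wt_nonneg {p : ℝ} (h0 : 0 ≤ p) (h1 : p ≤ 1) (b : Bool) : 0 ≤ wt p b := by
  unfold wt; split_ifs <;> linarith

lemma W_nonneg {p : ℝ} (h0 : 0 ≤ p) (h1 : p ≤ 1) (x : J → Bool) : 0 ≤ W p x :=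
  Finset.prod_nonneg fun _ _ => wt_nonneg h0 h1 _

lemma Ex_prod {A : Type*} [CommRing A] [Algebra ℝ A] (p : ℝ) (h : J → Bool → A) :
    Ex p (fun x : J → Bool => ∏ i, h i (x i)) = ∏ i, (p • h i true + (1 - p) • h i false) := by
  unfold Ex W
  have : ∀ i, (p • h i true + (1 - p) • h i false) = ∑ b : Bool, wt p b • h i b := by
    intro i; simp [wt]
  simp_rw [this]
  rw [Finset.prod_univ_sum]
  simp only [Fintype.piFinset_univ]
  refine Finset.sum_congr rfl fun x _ => ?_
  simp_rw [Algebra.smul_def]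
  rw [Finset.prod_mul_distrib, map_prod]

lemma W_sum (p : ℝ) : ∑ x : J → Bool, W p x = 1 := by
  have := Ex_prod (J := J) (A := ℝ) p (fun _ _ => 1)
  simpa [Ex] using this

section lin
variable {E : Type*} [AddCommGroup E] [Module ℝ E]
lemma Ex_add (p : ℝ) (f g : (J → Bool) → E) : Ex p (fun x => f x + g x) = Ex p f + Ex p g := by
  simp [Ex, Finset.sum_add_distrib]
lemma Ex_sub (p : ℝ) (f g : (J → Bool) → E) : Ex p (fun x => f x - g x) = Ex p f - Ex p g := by
  simp [Ex, smul_sub]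
lemma Ex_smul (p c : ℝ) (f : (J → Bool) → E) : Ex p (fun x => c • f x) = c • Ex p f := by
  simp [Ex, Finset.smul_sum, smul_smul, mul_comm]
lemma Ex_sum {ι : Type*} (p : ℝ) (s : Finset ι) (f : ι → (J → Bool) → E) :
    Ex p (fun x => ∑ i ∈ s, f i x) = ∑ i ∈ s, Ex p (f i) := by
  simp only [Ex, Finset.smul_sum]
  rw [Finset.sum_comm]
lemma Ex_const (p : ℝ) (c : E) : Ex p (fun _ : J → Bool => c) = c := by
  simp [Ex, ← Finset.sum_smul, W_sum]
end lin

lemma Ex_mul_left {A : Type*} [CommRing A] [Algebra ℝ A] (p : ℝ) (c : A) (f : (J → Bool) → A) :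
    Ex p (fun x => c * f x) = c * Ex p f := by
  simp [Ex, Finset.mul_sum]

lemma Ex_mono {p : ℝ} (h0 : 0 ≤ p) (h1 : p ≤ 1) {f g : (J → Bool) → ℝ} (h : ∀ x, f x ≤ g x) :
    Ex p f ≤ Ex p g := by
  unfold Ex
  exact Finset.sum_le_sum fun x _ => by
    simpa using mul_le_mul_of_nonneg_left (h x) (W_nonneg h0 h1 x)

lemma Ex_nonneg {p : ℝ} (h0 : 0 ≤ p) (h1 : p ≤ 1) {f : (J → Bool) → ℝ} (h : ∀ x, 0 ≤ f x) :
    0 ≤ Ex p f := by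
  have := Ex_mono h0 h1 h
  rwa [Ex_const] at this

lemma norm_Ex_le {E : Type*} [NormedAddCommGroup E] [NormedSpace ℝ E] {p : ℝ} (h0 : 0 ≤ p)
    (h1 : p ≤ 1) (f : (J → Bool) → E) : ‖Ex p f‖ ≤ Ex p (fun x => ‖f x‖) := by
  unfold Ex
  refine (norm_sum_le _ _).trans (le_of_eq ?_)
  refine Finset.sum_congr rfl fun x _ => ?_
  rw [norm_smul, Real.norm_of_nonneg (W_nonneg h0 h1 x)]; rfl

lemma norm_Ex_le_of {E : Type*} [NormedAddCommGroup E] [NormedSpace ℝ E] {p : ℝ} (h0 : 0 ≤ p)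
    (h1 : p ≤ 1) (f : (J → Bool) → E) {c : ℝ} (h : ∀ x, ‖f x‖ ≤ c) : ‖Ex p f‖ ≤ c := by
  refine (norm_Ex_le h0 h1 f).trans ?_
  have := Ex_mono h0 h1 h
  rwa [Ex_const] at this

lemma Ex_ofReal (p : ℝ) (f : (J → Bool) → ℝ) :
    Ex p (fun x => (f x : ℂ)) = ((Ex p f : ℝ) : ℂ) := by
  simp [Ex]

lemma Ex_conj (p : ℝ) (f : (J → Bool) → ℂ) :
    Ex p (fun x => (starRingEnd ℂ) (f x)) = (starRingEnd ℂ) (Ex p f) := by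
  simp [Ex]

lemma Ex_CS {p : ℝ} (h0 : 0 ≤ p) (h1 : p ≤ 1) (f g : (J → Bool) → ℝ) :
    (Ex p (fun x => f x * g x)) ^ 2 ≤ Ex p (fun x => f x ^ 2) * Ex p (fun x => g x ^ 2) := by
  unfold Ex
  have := Finset.sum_mul_sq_le_sq_mul_sq Finset.univ (fun x : J → Bool => √(W p x) * f x)
    (fun x => √(W p x) * g x)
  have hs : ∀ x : J → Bool, √(W p x) * √(W p x) = W p x := fun x =>
    Real.mul_self_sqrt (W_nonneg h0 h1 x)
  have e1 : ∀ x : J → Bool, √(W p x) * f x * (√(W p x) * g x) = W p x * (f x * g x) := fun x => by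
    rw [← hs x]; simp only [hs]; linear_combination (f x * g x) * hs x
  have e2 : ∀ (f : (J → Bool) → ℝ) x, (√(W p x) * f x) ^ 2 = W p x * f x ^ 2 := fun f x => by
    linear_combination (f x ^ 2) * hs x
  simp only [e1, e2] at this
  simpa using this

/-- Jensen for the squared norm. -/
lemma norm_Ex_sq_le {p : ℝ} (h0 : 0 ≤ p) (h1 : p ≤ 1) (f : (J → Bool) → ℂ) :
    ‖Ex p f‖ ^ 2 ≤ Ex p (fun x => ‖f x‖ ^ 2) := by
  have h := Ex_CS h0 h1 (fun x => ‖f x‖) (fun _ => 1)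
  simp only [mul_one, one_pow, Ex_const] at h
  refine le_trans ?_ h
  gcongr
  exact norm_Ex_le h0 h1 f

/-! resampling -/
lemma W_pw (p : ℝ) (S : Finset J) (x y : J → Bool) :
    W p (S.piecewise x y) * W p (S.piecewise y x) = W p x * W p y := by
  unfold W
  rw [← Finset.prod_mul_distrib, ← Finset.prod_mul_distrib]
  refine Finset.prod_congr rfl fun i _ => ?_
  by_cases h : i ∈ S <;> simp [h, mul_comm]

def swapE (S : Finset J) : ((J → Bool) × (J → Bool)) ≃ ((J → Bool) × (J → Bool)) where
  toFun q := (S.piecewise q.1 q.2, S.piecewise q.2 q.1)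
  invFun q := (S.piecewise q.1 q.2, S.piecewise q.2 q.1)
  left_inv q := by
    ext i <;> by_cases h : i ∈ S <;> simp [h]
  right_inv q := by
    ext i <;> by_cases h : i ∈ S <;> simp [h]

lemma Ex_swap {A : Type*} [CommRing A] [Algebra ℝ A] (p : ℝ) (S : Finset J)
    (F : (J → Bool) → (J → Bool) → A) :
    Ex p (fun x => Ex p (fun y => F x y)) =
    Ex p (fun x => Ex p (fun y => F (S.piecewise x y) (S.piecewise y x))) := by
  unfold Ex
  simp only [Finset.smul_sum, smul_smul]
  rw [← Fintype.sum_prod_type' (f := fun x y => (W p x * W p y) • F x y),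
    ← Fintype.sum_prod_type' (f := fun x y => (W p x * W p y) • F (S.piecewise x y) (S.piecewise y x)),
    ← Equiv.sum_comp (swapE S)]
  refine Finset.sum_congr rfl fun q _ => ?_
  simp only [swapE, Equiv.coe_fn_mk]
  rw [W_pw]

lemma Ex_mul_indep {A : Type*} [CommRing A] [Algebra ℝ A] (p : ℝ) (S : Finset J)
    {f g : (J → Bool) → A} (hf : DependsOn f (S : Set J)) (hg : DependsOn g ((S : Set J)ᶜ)) :
    Ex p (fun x => f x * g x) = Ex p f * Ex p g := by
  have h := Ex_swap p S (fun x y => f x * g x)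
  simp only [Ex_const] at h
  rw [h]
  have e : ∀ x y, f (S.piecewise x y) * g (S.piecewise x y) = f x * g y := by
    intro x y
    congr 1
    · apply hf; intro i hi; simp at hi; simp [hi]
    · apply hg; intro i hi; simp at hi; simp [hi]
  simp only [e, Ex_mul_left]
  simp_rw [mul_comm _ (Ex p g)]
  rw [Ex_mul_left]

lemma Ex_comp_equiv {A : Type*} [CommRing A] [Algebra ℝ A] (p : ℝ) (σ : J ≃ J)
    (f : (J → Bool) → A) : Ex p (fun x => f (x ∘ σ)) = Ex p f := by
  unfold Ex
  rw [← Equiv.sum_comp (Equiv.arrowCongr σ.symm (Equiv.refl Bool)) (fun x => W p x • f x)]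
  refine Finset.sum_congr rfl fun x _ => ?_
  have : (Equiv.arrowCongr σ.symm (Equiv.refl Bool)) x = x ∘ σ := by ext i; simp
  rw [this]
  congr 1
  unfold W
  exact (Equiv.prod_comp σ (fun i => wt p (x i))).symm

/-! monomials -/
def xi (p : ℝ) (b : Bool) : ℝ := (if b then 1 else 0) - p
def mono (p : ℝ) (S : Finset J) (x : J → Bool) : ℝ := ∏ i ∈ S, xi p (x i)

lemma Ex_mono_mul (p : ℝ) (S T : Finset J) :
    Ex p (fun x => mono p S x * mono p T x) = if S = T then (p * (1 - p)) ^ S.card else 0 := by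
  have e : ∀ x : J → Bool, mono p S x * mono p T x =
      ∏ i, ((if i ∈ S then xi p (x i) else 1) * (if i ∈ T then xi p (x i) else 1)) := by
    intro x
    rw [Finset.prod_mul_distrib]
    simp [mono, Finset.prod_ite_mem]
  simp only [e]
  rw [Ex_prod p (fun i b => (if i ∈ S then xi p b else 1) * (if i ∈ T then xi p b else 1))]
  split_ifs with h
  · subst h
    rw [← Finset.prod_const, ← Finset.prod_subset (Finset.subset_univ S)]
    · refine Finset.prod_congr rfl fun i hi => ?_
      simp [hi, xi]; ring
    · intro i _ hi; simp [hi]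
  · have : ∃ i, ¬ (i ∈ S ↔ i ∈ T) := by
      by_contra hc; push Not at hc; exact h (Finset.ext hc)
    obtain ⟨i, hi⟩ := this
    apply Finset.prod_eq_zero (Finset.mem_univ i)
    by_cases h1 : i ∈ S <;> by_cases h2 : i ∈ T <;> simp_all [xi] <;> ring

lemma Ex_parseval {ι : Type*} [DecidableEq ι] (p : ℝ) (s : Finset ι) (a : ι → ℝ) (T : ι → Finset J)
    (hT : Set.InjOn T s) :
    Ex p (fun x => (∑ i ∈ s, a i * mono p (T i) x) ^ 2) =
      ∑ i ∈ s, a i ^ 2 * (p * (1 - p)) ^ (T i).card := by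
  have e : ∀ x : J → Bool, (∑ i ∈ s, a i * mono p (T i) x) ^ 2 =
      ∑ i ∈ s, ∑ j ∈ s, (a i * a j) * (mono p (T i) x * mono p (T j) x) := by
    intro x
    rw [sq, Finset.sum_mul_sum]
    refine Finset.sum_congr rfl fun i _ => Finset.sum_congr rfl fun j _ => by ring
  simp only [e]
  rw [Ex_sum]
  refine Finset.sum_congr rfl fun i hi => ?_
  rw [Ex_sum]
  simp only [Ex_mul_left, Ex_mono_mul]
  rw [Finset.sum_eq_single i]
  · rw [if_pos rfl]; ring
  · intro j hj hji
    rw [if_neg]; simp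
    intro h; exact hji (hT hj hi h.symm)
  · intro h; exact absurd hi h

lemma Ex_mono_zero (p : ℝ) (S : Finset J) (hS : S.Nonempty) : Ex p (fun x => mono p S x) = 0 := by
  have := Ex_mono_mul p S ∅
  simpa [mono, hS.ne_empty] using this

lemma mono_dep (p : ℝ) (S : Finset J) : DependsOn (mono p S) (S : Set J) := by
  intro x y h
  exact Finset.prod_congr rfl fun i hi => by rw [h i hi]

lemma abs_xi_le {p : ℝ} (h0 : 0 ≤ p) (h1 : p ≤ 1) (b : Bool) : |xi p b| ≤ 1 := by
  unfold xi; rw [abs_le]; split_ifs <;> constructor <;> linarith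

lemma abs_mono_le {p : ℝ} (h0 : 0 ≤ p) (h1 : p ≤ 1) (S : Finset J) (x : J → Bool) :
    |mono p S x| ≤ 1 := by
  unfold mono; rw [Finset.abs_prod]
  exact Finset.prod_le_one (fun _ _ => abs_nonneg _) fun _ _ => abs_xi_le h0 h1 _

end Base
end SCL

namespace SCL
open Finset

section Bon
variable {J : Type*} [Fintype J] [DecidableEq J]

/-- `f` is a sum of functions of at most `d` coordinates with total sup norm at most `A`. -/
inductive Rep (d : ℕ) : ℝ → ((J → Bool) → ℝ) → Prop
  | base (A : ℝ) (f : (J → Bool) → ℝ) (S : Finset J) (hS : S.card ≤ d)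
      (hd : DependsOn f (S : Set J)) (hA : ∀ x, |f x| ≤ A) : Rep d A f
  | add (A B : ℝ) (f g : (J → Bool) → ℝ) (hf : Rep d A f) (hg : Rep d B g) :
      Rep d (A + B) (fun x => f x + g x)

lemma Rep.nonneg {d : ℕ} {A : ℝ} {f : (J → Bool) → ℝ} (h : Rep d A f) : 0 ≤ A := by
  induction h with
  | base A f S hS hd hA => exact (abs_nonneg _).trans (hA fun _ => true)
  | add A B f g hf hg ihf ihg => linarith

lemma Rep.abs_le {d : ℕ} {A : ℝ} {f : (J → Bool) → ℝ} (h : Rep d A f) (x) : |f x| ≤ A := by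
  induction h with
  | base A f S hS hd hA => exact hA x
  | add A B f g hf hg ihf ihg => exact (abs_add_le _ _).trans (by linarith)

lemma Rep.zero (d : ℕ) : Rep d 0 (fun _ : J → Bool => (0 : ℝ)) :=
  Rep.base 0 _ ∅ (by simp) (fun _ _ _ => rfl) (by simp)

lemma Rep.one : Rep 0 1 (fun _ : J → Bool => (1 : ℝ)) :=
  Rep.base 1 _ ∅ (by simp) (fun _ _ _ => rfl) (by simp)

lemma Rep.sum {ι : Type*} {d : ℕ} (s : Finset ι) (A : ι → ℝ) (f : ι → (J → Bool) → ℝ)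
    (h : ∀ i ∈ s, Rep d (A i) (f i)) : Rep d (∑ i ∈ s, A i) (fun x => ∑ i ∈ s, f i x) := by
  classical
  induction s using Finset.induction_on with
  | empty => simpa using Rep.zero d
  | insert a s ha ih =>
    simp only [Finset.sum_insert ha]
    exact Rep.add _ _ _ _ (h a (by simp)) (ih fun i hi => h i (by simp [hi]))

lemma Rep.mul {d e : ℕ} {A B : ℝ} {f g : (J → Bool) → ℝ} (hf : Rep d A f) (hg : Rep e B g) :
    Rep (d + e) (A * B) (fun x => f x * g x) := by
  induction hf with
  | base A f S hS hd hA =>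
    have hA0 : 0 ≤ A := (abs_nonneg _).trans (hA fun _ => true)
    induction hg with
    | base B g T hT hdg hB =>
      refine Rep.base _ _ (S ∪ T) ((Finset.card_union_le _ _).trans (by omega)) ?_ ?_
      · intro x y h
        have h1 : f x = f y := hd fun i hi => h i (by simp at hi ⊢; exact Or.inl hi)
        have h2 : g x = g y := hdg fun i hi => h i (by simp at hi ⊢; exact Or.inr hi)
        simp only [h1, h2]
      · intro x
        rw [abs_mul]
        exact mul_le_mul (hA x) (hB x) (abs_nonneg _) hA0
    | add B C g k hg hk ihg ihk =>
      have := Rep.add _ _ _ _ ihg ihk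
      simpa only [mul_add] using this
  | add A C f k hf hk ihf ihk =>
    have := Rep.add _ _ _ _ ihf ihk
    simpa only [add_mul] using this

lemma Rep.pow {d : ℕ} {A : ℝ} {f : (J → Bool) → ℝ} (hf : Rep d A f) (k : ℕ) :
    Rep (k * d) (A ^ k) (fun x => f x ^ k) := by
  induction k with
  | zero => simpa using (Rep.one (J := J))
  | succ k ih =>
    simp only [pow_succ, Nat.succ_mul]
    exact ih.mul hf

lemma Rep.update {d : ℕ} {A : ℝ} {f : (J → Bool) → ℝ} (hf : Rep d A f) (i : J) (b : Bool) :
    Rep d A (fun x => f (Function.update x i b)) := by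
  induction hf with
  | base A f S hS hd hA =>
    refine Rep.base _ _ S hS ?_ (fun x => hA _)
    intro x y h
    apply hd
    intro j hj
    by_cases hji : j = i
    · subst hji; simp
    · simp [hji, h j hj]
  | add A B f g hf hg ihf ihg => exact Rep.add _ _ _ _ ihf ihg

lemma Rep.smul {d : ℕ} {A : ℝ} {f : (J → Bool) → ℝ} (hf : Rep d A f) (c : ℝ) :
    Rep d (|c| * A) (fun x => c * f x) := by
  have h1 : Rep 0 |c| (fun _ : J → Bool => c) :=
    Rep.base _ _ ∅ (by simp) (fun _ _ _ => rfl) (fun _ => le_rfl)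
  simpa using h1.mul hf

lemma Rep.deriv {d : ℕ} {A : ℝ} {f : (J → Bool) → ℝ} (hf : Rep d A f) (i : J) :
    Rep (d - 1) (2 * A) (fun x => f (Function.update x i true) - f (Function.update x i false)) := by
  induction hf with
  | base A f S hS hd hA =>
    by_cases hi : i ∈ S
    · refine Rep.base _ _ (S.erase i) (by rw [Finset.card_erase_of_mem hi]; omega) ?_ ?_
      · intro x y h
        have : ∀ b, f (Function.update x i b) = f (Function.update y i b) := by
          intro b
          apply hd
          intro j hj
          by_cases hji : j = i
          · subst hji; simp
          · simp only [ne_eq, hji, not_false_eq_true, Function.update_of_ne]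
            exact h j (by simp [hji]; exact hj)
        simp only [this]
      · intro x
        have h1 := hA (Function.update x i true)
        have h2 := hA (Function.update x i false)
        rw [_root_.abs_le] at *
        constructor <;> linarith
    · have e : ∀ x b, f (Function.update x i b) = f x := by
        intro x b
        apply hd
        intro j hj
        have : j ≠ i := fun h => hi (h ▸ hj)
        simp [this]
      simp only [e, sub_self]
      have hA0 : 0 ≤ A := (abs_nonneg _).trans (hA fun _ => true)
      exact Rep.base _ _ ∅ (by simp) (fun _ _ _ => rfl) (by simpa using hA0)
  | add A B f g hf hg ihf ihg =>
    have := Rep.add _ _ _ _ ihf ihg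
    convert this using 1
    · ring
    · funext x; ring

lemma Rep.const {A : ℝ} {f : (J → Bool) → ℝ} {d : ℕ} (hf : Rep d A f) (hd : d = 0) (x y) :
    f x = f y := by
  induction hf with
  | base A f S hS hdp hA =>
    subst hd
    have : S = ∅ := by simpa using hS
    subst this
    exact hdp (by simp)
  | add A B f g hf hg ihf ihg => simp only [ihf, ihg]

lemma Ex_xi_sq_mul (p : ℝ) (i : J) (g : (J → Bool) → ℝ) (hg : DependsOn g ({i}ᶜ : Set J)) :
    Ex p (fun x => xi p (x i) ^ 2 * g x) = p * (1 - p) * Ex p g := by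
  have h1 : DependsOn (fun x : J → Bool => xi p (x i) ^ 2) (({i} : Finset J) : Set J) := by
    intro x y h; simp [h i (by simp)]
  rw [Ex_mul_indep p {i} h1 (by simpa using hg)]
  congr 1
  have := Ex_mono_mul p ({i} : Finset J) {i}
  simpa [mono, sq] using this

lemma Ex_xi_mul (p : ℝ) (i : J) (g : (J → Bool) → ℝ) (hg : DependsOn g ({i}ᶜ : Set J)) :
    Ex p (fun x => xi p (x i) * g x) = 0 := by
  have h1 : DependsOn (fun x : J → Bool => xi p (x i)) (({i} : Finset J) : Set J) := by
    intro x y h; simp [h i (by simp)]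
  rw [Ex_mul_indep p {i} h1 (by simpa using hg)]
  have := Ex_mono_zero p ({i} : Finset J) (by simp)
  simp [mono] at this
  simp [this]

set_option maxHeartbeats 1000000 in
theorem bonami {lam p : ℝ} (hl : 0 < lam) (hl2 : lam < 1 / 2) (hp : lam ≤ p) (hp1 : p ≤ 1 - lam)
    (A : Finset J) : ∀ (d : ℕ) (c : ℝ) (f : (J → Bool) → ℝ), Rep d c f → DependsOn f (A : Set J) →
    Ex p (fun x => f x ^ 4) ≤ ((4 / lam) ^ 2) ^ d * (Ex p (fun x => f x ^ 2)) ^ 2 := by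
  have h0 : 0 ≤ p := by linarith
  have h1 : p ≤ 1 := by linarith
  set k := 4 / lam with hk
  have hk8 : 8 ≤ k := by rw [hk, le_div_iff₀ hl]; linarith
  set v := p * (1 - p) with hv
  have hvlam : lam ^ 2 ≤ v := by rw [hv, sq]; gcongr; linarith
  have hv0 : 0 ≤ v := le_trans (sq_nonneg _) hvlam
  have hvk : 3 ≤ v * k ^ 2 := by
    have : lam ^ 2 * k ^ 2 = 16 := by rw [hk]; field_simp; norm_num
    nlinarith [sq_nonneg k]
  have hconst : ∀ (d : ℕ) (f : (J → Bool) → ℝ), (∀ x y, f x = f y) →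
      Ex p (fun x => f x ^ 4) ≤ (k ^ 2) ^ d * (Ex p (fun x => f x ^ 2)) ^ 2 := by
    intro d f hf
    have e : f = fun _ => f (fun _ => true) := by funext x; exact hf _ _
    rw [e]
    simp only [Ex_const]
    have : 1 ≤ (k ^ 2) ^ d := one_le_pow₀ (by nlinarith)
    nlinarith [sq_nonneg (f (fun _ => true) ^ 2)]
  induction A using Finset.induction_on with
  | empty =>
    intro d c f hr hd
    exact hconst d f fun x y => hd (by simp)
  | insert i A hi ih =>
    intro d c f hr hd
    rcases Nat.eq_zero_or_pos d with hd0 | hdpos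
    · exact hconst d f fun x y => hr.const hd0 x y
    obtain ⟨d, rfl⟩ : ∃ e, d = e + 1 := ⟨d - 1, by omega⟩
    set G : (J → Bool) → ℝ := fun x => p * f (Function.update x i true) +
      (1 - p) * f (Function.update x i false) with hG
    set H : (J → Bool) → ℝ := fun x => f (Function.update x i true) - f (Function.update x i false)
      with hH
    have hfGH : ∀ x, f x = G x + xi p (x i) * H x := by
      intro x
      have : f x = f (Function.update x i (x i)) := by simp
      rw [this]
      cases hx : x i <;> simp [hG, hH, xi] <;> ring
    have hdu : ∀ b, DependsOn (fun x => f (Function.update x i b)) (A : Set J) := by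
      intro b x y h
      apply hd
      intro j hj
      by_cases hji : j = i
      · subst hji; simp
      · have : j ∈ A := by simpa [hji] using hj
        simp [hji, h j this]
    have hGA : DependsOn G (A : Set J) := by
      intro x y h
      have a := hdu true h; have b := hdu false h
      simp only at a b
      simp only [hG, a, b]
    have hHA : DependsOn H (A : Set J) := by
      intro x y h
      have a := hdu true h; have b := hdu false h
      simp only at a b
      simp only [hH, a, b]
    have hsub : (A : Set J) ⊆ ({i}ᶜ : Set J) := by
      intro j hj; simp; rintro rfl; exact hi hj
    have hGi : DependsOn G ({i}ᶜ : Set J) := fun x y h => hGA fun j hj => h j (hsub hj)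
    have hHi : DependsOn H ({i}ᶜ : Set J) := fun x y h => hHA fun j hj => h j (hsub hj)
    have RG := ((hr.update i true).smul p).add _ _ _ _ ((hr.update i false).smul (1 - p))
    have RH := hr.deriv i
    have bG := ih _ _ G RG hGA
    have bH := ih _ _ H RH hHA
    simp only [Nat.add_sub_cancel] at bH
    set a := Ex p (fun x => G x ^ 2) with ha
    set b := Ex p (fun x => H x ^ 2) with hb
    have ha0 : 0 ≤ a := Ex_nonneg h0 h1 fun x => sq_nonneg _
    have hb0 : 0 ≤ b := Ex_nonneg h0 h1 fun x => sq_nonneg _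
    have hf2 : Ex p (fun x => f x ^ 2) = a + v * b := by
      have e : ∀ x, f x ^ 2 = (G x ^ 2 + xi p (x i) * (2 * G x * H x)) + xi p (x i) ^ 2 * H x ^ 2 := by
        intro x; rw [hfGH x]; ring
      simp only [e]
      rw [Ex_add, Ex_add, Ex_xi_mul, Ex_xi_sq_mul, add_zero]
      · intro x y h; simp only [hHi h]
      · intro x y h; simp only [hGi h, hHi h]
    have hf4 : Ex p (fun x => f x ^ 4) ≤ Ex p (fun x => G x ^ 4) +
        v * (8 * Ex p (fun x => G x ^ 2 * H x ^ 2) + 3 * Ex p (fun x => H x ^ 4)) := by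
      have e : ∀ x, f x ^ 4 ≤ (G x ^ 4 + xi p (x i) * (4 * G x ^ 3 * H x)) +
          xi p (x i) ^ 2 * (8 * (G x ^ 2 * H x ^ 2) + 3 * H x ^ 4) := by
        intro x; rw [hfGH x]
        have hx := abs_le.mp (abs_xi_le h0 h1 (x i))
        set t := xi p (x i)
        have t1 : t ^ 2 ≤ 1 := by nlinarith
        have t2 : 4 * t ^ 3 * G x * H x ^ 3 ≤ 2 * t ^ 2 * (G x ^ 2 * H x ^ 2 + H x ^ 4) := by
          have : 0 ≤ t ^ 2 * H x ^ 2 * (G x ^ 2 + H x ^ 2 - 2 * t * G x * H x) := by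
            apply mul_nonneg (by positivity)
            nlinarith [sq_nonneg (G x - t * H x), sq_nonneg (H x)]
          nlinarith
        have t3 : t ^ 4 * H x ^ 4 ≤ t ^ 2 * H x ^ 4 := by
          have : 0 ≤ H x ^ 4 * t ^ 2 * (1 - t ^ 2) := by
            apply mul_nonneg (by positivity); linarith
          nlinarith
        nlinarith
      refine (Ex_mono h0 h1 e).trans (le_of_eq ?_)
      rw [Ex_add, Ex_add, Ex_xi_mul, Ex_xi_sq_mul, add_zero, Ex_add, Ex_mul_left, Ex_mul_left]
      · intro x y h; simp only [hGi h, hHi h]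
      · intro x y h; simp only [hGi h, hHi h]
    have hcs : Ex p (fun x => G x ^ 2 * H x ^ 2) ≤ (k ^ 2) ^ d * k * a * b := by
      have := Ex_CS h0 h1 (fun x => G x ^ 2) (fun x => H x ^ 2)
      simp only [← pow_mul] at this
      norm_num at this
      refine (abs_le_of_sq_le_sq' ?_ (by positivity)).2
      refine this.trans ?_
      calc _ ≤ ((k ^ 2) ^ (d + 1) * a ^ 2) * ((k ^ 2) ^ d * b ^ 2) := by
            apply mul_le_mul bG bH _ (by positivity)
            exact Ex_nonneg h0 h1 fun x => by positivity
        _ = _ := by ring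
    rw [hf2]
    set D := (k ^ 2) ^ d with hD
    have hD0 : 0 ≤ D := by positivity
    have hpow : (k ^ 2) ^ (d + 1) = D * k ^ 2 := pow_succ _ _
    rw [hpow] at bG ⊢
    calc _ ≤ D * k ^ 2 * a ^ 2 + v * (8 * (D * k * a * b) + 3 * (D * b ^ 2)) := by
          have := mul_le_mul_of_nonneg_left hcs hv0
          have := mul_le_mul_of_nonneg_left bH hv0
          linarith
      _ ≤ _ := by
          have e1 : 0 ≤ D * v * a * b * k * (2 * k - 8) := by
            apply mul_nonneg (by positivity); linarith
          have e2 : 0 ≤ D * v * b ^ 2 * (v * k ^ 2 - 3) := by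
            apply mul_nonneg (by positivity); linarith
          have e3 : D * k ^ 2 * (a + v * b) ^ 2 = D * k ^ 2 * a ^ 2 + v * (8 * (D * k * a * b) + 3 * (D * b ^ 2))
            + D * v * a * b * k * (2 * k - 8) + D * v * b ^ 2 * (v * k ^ 2 - 3) := by ring
          linarith

end Bon

theorem bonami_pow {lam : ℝ} (hl : 0 < lam) (hl2 : lam < 1 / 2) (d j : ℕ) : ∃ C : ℝ, 0 < C ∧
    ∀ (J : Type) [Fintype J] [DecidableEq J] (p : ℝ), lam ≤ p → p ≤ 1 - lam →
    ∀ (c : ℝ) (f : (J → Bool) → ℝ), Rep d c f →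
    Ex p (fun x => f x ^ (2 ^ (j + 1))) ≤ C * (Ex p (fun x => f x ^ 2)) ^ (2 ^ j) := by
  induction j with
  | zero => exact ⟨1, one_pos, fun J _ _ p hp hp1 c f hf => by simp⟩
  | succ j ih =>
    obtain ⟨C, hC, h⟩ := ih
    refine ⟨((4 / lam) ^ 2) ^ (2 ^ j * d) * C ^ 2, by positivity, fun J _ _ p hp hp1 c f hf => ?_⟩
    have h0 : 0 ≤ p := by linarith
    have h1 : p ≤ 1 := by linarith
    have b := bonami hl hl2 hp hp1 Finset.univ _ _ _ (hf.pow (2 ^ j)) (by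
      intro x y hxy
      have : x = y := by funext i; exact hxy i (by simp)
      rw [this])
    simp only [← pow_mul] at b
    have e1 : 2 ^ j * 4 = 2 ^ (j + 1 + 1) := by ring
    have e2 : 2 ^ j * 2 = 2 ^ (j + 1) := by ring
    rw [e1, e2] at b
    simp only [← pow_mul]
    refine b.trans ?_
    rw [mul_assoc]
    gcongr
    have := h J p hp hp1 c f hf
    calc _ ≤ (C * (Ex p (fun x => f x ^ 2)) ^ (2 ^ j)) ^ 2 := by
          gcongr
          refine Ex_nonneg h0 h1 fun x => ?_
          rw [pow_succ, pow_mul]; positivity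
      _ = _ := by rw [mul_pow, ← pow_mul]; congr 2
end SCL

namespace SCL
open Finset

section Dec
variable {J : Type*} [Fintype J] [DecidableEq J]

lemma Ex_avg (p : ℝ) (P : Finset J) (g k : (J → Bool) → ℂ) (hk : DependsOn k ((P : Set J)ᶜ)) :
    Ex p (fun x => g x * k x) = Ex p (fun x => Ex p (fun y => g (P.piecewise y x)) * k x) := by
  have h := Ex_swap p P (fun _ y => g y * k y)
  rw [Ex_const] at h
  rw [h]
  congr 1; funext x
  have e : ∀ y, g (P.piecewise y x) * k (P.piecewise y x) = k x * g (P.piecewise y x) := by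
    intro y
    rw [mul_comm]; congr 1
    apply hk
    intro i hi
    have : i ∉ P := by simpa using hi
    simp [this]
  simp only [e]
  rw [Ex_mul_left, mul_comm]

lemma dec_step {p : ℝ} (h0 : 0 ≤ p) (h1 : p ≤ 1) (P : Finset J) (σ : J ≃ J)
    (hσ : ∀ i, σ (σ i) = i) (hP : ∀ i ∈ P, σ i ∉ P) (hfix : ∀ i, i ∉ P → σ i ∉ P → σ i = i)
    (g : (J → Bool) → ℂ) (hg : DependsOn g {i | σ i ∉ P}) :
    ‖Ex p g‖ ^ 2 ≤ ‖Ex p (fun z => g z * (starRingEnd ℂ) (g (z ∘ σ)))‖ := by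
  set h : (J → Bool) → ℂ := fun x => Ex p (fun y => g (P.piecewise y x)) with hh
  have hgh : Ex p g = Ex p h := by
    have := Ex_avg p P g (fun _ => 1) (fun _ _ _ => rfl)
    simpa using this
  have hdep : ∀ x x' : J → Bool, (∀ i, i ∉ P → σ i ∉ P → x i = x' i) → h x = h x' := by
    intro x x' hx
    simp only [hh]
    congr 1; funext y
    apply hg
    intro i hi
    by_cases hiP : i ∈ P
    · simp [hiP]
    · simp [hiP]; exact hx i hiP hi
  have hσh : ∀ x, h (x ∘ σ) = h x := by
    intro x
    apply hdep
    intro i hi hi'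
    simp [hfix i hi hi']
  have e1 : Ex p (fun z => g z * (starRingEnd ℂ) (g (z ∘ σ))) =
      Ex p (fun z => h z * (starRingEnd ℂ) (g (z ∘ σ))) := by
    apply Ex_avg
    intro x y hxy
    show (starRingEnd ℂ) (g (x ∘ σ)) = (starRingEnd ℂ) (g (y ∘ σ))
    congr 1
    apply hg
    intro i hi
    exact hxy _ (by simpa using hi)
  have e2 : Ex p (fun z => h z * (starRingEnd ℂ) (g (z ∘ σ))) =
      Ex p (fun z => h z * (starRingEnd ℂ) (g z)) := by
    rw [← Ex_comp_equiv p σ (fun z => h z * (starRingEnd ℂ) (g z))]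
    simp only [hσh]
  have e3 : Ex p (fun z => h z * (starRingEnd ℂ) (g z)) =
      ((Ex p (fun z => ‖h z‖ ^ 2) : ℝ) : ℂ) := by
    have a := Ex_avg p P g (fun z => (starRingEnd ℂ) (h z)) (by
      intro x y hxy
      show (starRingEnd ℂ) (h x) = (starRingEnd ℂ) (h y)
      congr 1
      exact hdep x y fun i hi _ => hxy i (by simpa using hi))
    have b := congrArg (starRingEnd ℂ) a
    rw [← Ex_conj, ← Ex_conj] at b
    simp only [map_mul, Complex.conj_conj] at b
    rw [← Ex_ofReal]
    calc _ = Ex p (fun z => (starRingEnd ℂ) (g z) * h z) := by simp only [mul_comm]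
      _ = _ := by
        rw [b]; congr 1; funext z
        change (starRingEnd ℂ) (h z) * h z = _
        rw [← Complex.normSq_eq_norm_sq, ← Complex.mul_conj, mul_comm]
  rw [e1, e2, e3, hgh, Complex.norm_real, Real.norm_of_nonneg (Ex_nonneg h0 h1 fun x => by positivity)]
  exact norm_Ex_sq_le h0 h1 h

variable {I F : Type*} [Fintype I] [DecidableEq I] [DecidableEq F]

def pk (b : I → Option F) (η : Finset F) (e : I) : Bool := decide (∃ f ∈ η, b e = some f)

def Dec (b : I → Option F) (A : Finset F) (g : (I → Bool) → ℝ) (z : I × Bool → Bool) : ℝ :=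
  ∑ η ∈ A.powerset, (-1 : ℝ) ^ η.card * g (fun e => z (e, pk b η e))

def flipB (b : I → Option F) (f : F) : (I × Bool) ≃ (I × Bool) where
  toFun j := (j.1, if b j.1 = some f then !j.2 else j.2)
  invFun j := (j.1, if b j.1 = some f then !j.2 else j.2)
  left_inv j := by (ext <;> simp); split_ifs <;> simp
  right_inv j := by (ext <;> simp); split_ifs <;> simp

lemma Dec_insert (b : I → Option F) (f : F) (A : Finset F) (hf : f ∉ A) (g : (I → Bool) → ℝ)
    (z : I × Bool → Bool) : Dec b (insert f A) g z = Dec b A g z - Dec b A g (z ∘ flipB b f) := by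
  unfold Dec
  rw [Finset.sum_powerset_insert hf, sub_eq_add_neg, ← Finset.sum_neg_distrib]
  congr 1
  refine Finset.sum_congr rfl fun η hη => ?_
  have hfη : f ∉ η := fun h => hf (Finset.mem_powerset.mp hη h)
  rw [Finset.card_insert_of_notMem hfη, pow_succ]
  have : (fun e => z (e, pk b (insert f η) e)) = (fun e => (z ∘ flipB b f) (e, pk b η e)) := by
    funext e
    by_cases he : b e = some f
    · have h1 : pk b (insert f η) e = true := by simp [pk, he]
      have h2 : pk b η e = false := by simp [pk, he, hfη]
      simp [flipB, h1, h2, he]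
    · have h1 : pk b (insert f η) e = pk b η e := by simp [pk, he]
      simp [flipB, h1, he]
  rw [this]; ring

lemma Ex_marg (p : ℝ) (g : (I → Bool) → ℂ) :
    Ex p (fun z : I × Bool → Bool => g (fun e => z (e, false))) = Ex p g := by
  unfold Ex
  let E : ((I → Bool) × (I → Bool)) ≃ (I × Bool → Bool) :=
    { toFun := fun q j => if j.2 then q.2 j.1 else q.1 j.1
      invFun := fun z => (fun e => z (e, false), fun e => z (e, true))
      left_inv := fun q => by simp
      right_inv := fun z => by
        funext ⟨e, b⟩; cases b <;> simp }
  rw [← Equiv.sum_comp E, Fintype.sum_prod_type]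
  refine Finset.sum_congr rfl fun x _ => ?_
  have : ∀ y, W p (E (x, y)) = W p y * W p x := by
    intro y
    unfold W
    rw [Fintype.prod_prod_type, ← Finset.prod_mul_distrib]
    refine Finset.prod_congr rfl fun i _ => ?_
    simp [E]
  simp only [this]
  have h2 : ∀ y, (fun e => E (x, y) (e, false)) = x := by intro y; funext e; simp [E]
  simp only [h2, mul_smul, ← Finset.sum_smul, W_sum, one_smul]

theorem decouple {p : ℝ} (h0 : 0 ≤ p) (h1 : p ≤ 1) (b : I → Option F) (A : Finset F)
    (g : (I → Bool) → ℝ) (θ : ℝ) :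
    ‖Ex p (fun x => Complex.exp ((θ * g x : ℝ) * Complex.I))‖ ^ (2 ^ A.card) ≤
      ‖Ex p (fun z => Complex.exp ((θ * Dec b A g z : ℝ) * Complex.I))‖ := by
  induction A using Finset.induction_on with
  | empty =>
    simp only [card_empty, pow_zero, pow_one]
    rw [← Ex_marg]
    simp [Dec, pk]
  | insert f A hf ih =>
    rw [Finset.card_insert_of_notMem hf, pow_succ, pow_mul]
    refine (pow_le_pow_left₀ (by positivity) ih 2).trans ?_
    refine (dec_step h0 h1 (Finset.univ.filter fun j : I × Bool => b j.1 = some f ∧ j.2 = false)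
      (flipB b f) (fun j => (flipB b f).left_inv j) ?_ ?_ _ ?_).trans (le_of_eq ?_)
    · rintro ⟨e, c⟩ h
      simp at h
      simp [flipB, h.1, h.2]
    · rintro ⟨e, c⟩ h h'
      by_cases hb : b e = some f
      · cases c <;> simp [flipB, hb] at h h'
      · simp [flipB, hb]
    · intro x y hxy
      have : Dec b A g x = Dec b A g y := by
        unfold Dec
        refine Finset.sum_congr rfl fun η hη => ?_
        have hfη : f ∉ η := fun h => hf (Finset.mem_powerset.mp hη h)
        congr 2
        funext e
        apply hxy
        by_cases hb : b e = some f
        · simp [flipB, pk, hb, hfη]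
        · simp [flipB, hb]
      simp only [this]
    · congr 2
      funext z
      rw [Dec_insert b f A hf, ← Complex.exp_conj, ← Complex.exp_add]
      congr 1
      simp only [map_mul, Complex.conj_ofReal, Complex.conj_I]
      push_cast; ring

/-- the lifted index set -/
def lft (b : I → Option F) (S : Finset I) (η : Finset F) : Finset (I × Bool) :=
  S.image fun e => (e, pk b η e)

lemma lft_card (b : I → Option F) (S : Finset I) (η : Finset F) : (lft b S η).card = S.card :=
  Finset.card_image_of_injective _ fun _ _ h => (Prod.ext_iff.mp h).1

lemma Dec_mono (p : ℝ) (b : I → Option F) (A : Finset F) (S : Finset I) (z : I × Bool → Bool) :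
    Dec b A (mono p S) z = ∑ η ∈ A.powerset, (-1 : ℝ) ^ η.card * mono p (lft b S η) z := by
  unfold Dec
  refine Finset.sum_congr rfl fun η _ => ?_
  congr 1
  unfold mono lft
  rw [Finset.prod_image]
  intro x _ y _ h
  exact (Prod.ext_iff.mp h).1

lemma Dec_mono_zero (p : ℝ) (b : I → Option F) (A : Finset F) (S : Finset I) (f : F) (hf : f ∈ A)
    (hS : ∀ e ∈ S, b e ≠ some f) (z : I × Bool → Bool) : Dec b A (mono p S) z = 0 := by
  rw [← Finset.insert_erase hf, Dec_insert _ _ _ (Finset.notMem_erase f A), sub_eq_zero,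
    Dec_mono, Dec_mono]
  refine Finset.sum_congr rfl fun η _ => ?_
  congr 1
  apply mono_dep
  rintro ⟨e, c⟩ h
  simp only [lft, coe_image, Set.mem_image, mem_coe] at h
  obtain ⟨e', he', h⟩ := h
  have : e' = e := (Prod.ext_iff.mp h).1
  subst this
  simp [flipB, hS e' he']

lemma Dec_sum {ι : Type*} (b : I → Option F) (A : Finset F) (s : Finset ι) (a : ι → ℝ)
    (g : ι → (I → Bool) → ℝ) (z) :
    Dec b A (fun x => ∑ i ∈ s, a i * g i x) z = ∑ i ∈ s, a i * Dec b A (g i) z := by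
  unfold Dec
  simp only [Finset.mul_sum]
  rw [Finset.sum_comm]
  refine Finset.sum_congr rfl fun i _ => Finset.sum_congr rfl fun j _ => by ring

/-- injectivity of lifting on the sets meeting every class -/
lemma lft_inj (b : I → Option F) (A : Finset F) {S T : Finset I} {η ζ : Finset F} (hη : η ⊆ A)
    (hζ : ζ ⊆ A) (hS : ∀ f ∈ A, ∃ e ∈ S, b e = some f) (h : lft b S η = lft b T ζ) :
    S = T ∧ η = ζ := by
  have h1 : S = T := by
    have := congrArg (Finset.image Prod.fst) h
    simpa [lft, Finset.image_image, Function.comp_def] using this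
  refine ⟨h1, ?_⟩
  subst h1
  have key : ∀ e ∈ S, pk b η e = pk b ζ e := by
    intro e he
    have : (e, pk b η e) ∈ lft b S ζ := by rw [← h]; exact Finset.mem_image_of_mem _ he
    obtain ⟨e', he', h'⟩ := Finset.mem_image.mp this
    have e1 := (Prod.ext_iff.mp h').1
    have e2 := (Prod.ext_iff.mp h').2
    simp only at e1 e2
    subst e1; exact e2.symm
  ext f
  by_cases hf : f ∈ A
  · obtain ⟨e, he, hb⟩ := hS f hf
    have := key e he
    simpa [pk, hb] using this
  · exact ⟨fun h => absurd (hη h) hf, fun h => absurd (hζ h) hf⟩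

theorem Dec_parseval (p : ℝ) (b : I → Option F) (A : Finset F) (s : Finset (Finset I))
    (a : Finset I → ℝ) (hs : ∀ S ∈ s, ∀ f ∈ A, ∃ e ∈ S, b e = some f) :
    Ex p (fun z => (∑ S ∈ s, a S * Dec b A (mono p S) z) ^ 2) =
      2 ^ A.card * ∑ S ∈ s, a S ^ 2 * (p * (1 - p)) ^ S.card := by
  have e : ∀ z, ∑ S ∈ s, a S * Dec b A (mono p S) z =
      ∑ q ∈ s ×ˢ A.powerset, (a q.1 * (-1 : ℝ) ^ q.2.card) * mono p (lft b q.1 q.2) z := by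
    intro z
    rw [Finset.sum_product]
    refine Finset.sum_congr rfl fun S _ => ?_
    rw [Dec_mono, Finset.mul_sum]
    refine Finset.sum_congr rfl fun η _ => by ring
  simp only [e]
  rw [Ex_parseval p (s ×ˢ A.powerset) (fun q => a q.1 * (-1 : ℝ) ^ q.2.card)
    (fun q => lft b q.1 q.2)]
  · rw [Finset.sum_product, Finset.mul_sum]
    refine Finset.sum_congr rfl fun S _ => ?_
    simp only [lft_card, mul_pow, ← pow_mul, mul_comm _ 2]
    simp only [pow_mul, neg_one_sq, one_pow, mul_one, Finset.sum_const, Finset.card_powerset]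
    simp
  · rintro ⟨S, η⟩ h ⟨T, ζ⟩ h' hh
    simp only [coe_product, Set.mem_prod, mem_coe, Finset.mem_powerset] at h h'
    have := lft_inj b A h.2 h'.2 (hs S h.1) hh
    rw [this.1, this.2]

lemma Rep.monoLC {ι : Type*} {p : ℝ} (h0 : 0 ≤ p) (h1 : p ≤ 1) (d : ℕ) (s : Finset ι) (a : ι → ℝ)
    (T : ι → Finset J) (hT : ∀ i ∈ s, (T i).card ≤ d) :
    Rep d (∑ i ∈ s, |a i|) (fun x => ∑ i ∈ s, a i * mono p (T i) x) := by
  refine Rep.sum s _ _ fun i hi => Rep.base _ _ (T i) (hT i hi) ?_ ?_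
  · intro x y h; simp only [mono_dep p (T i) h]
  · intro x; rw [abs_mul]
    exact mul_le_of_le_one_right (abs_nonneg _) (abs_mono_le h0 h1 _ _)

lemma Rep.DecLC {p : ℝ} (h0 : 0 ≤ p) (h1 : p ≤ 1) (b : I → Option F) (A : Finset F) (d : ℕ)
    (s : Finset (Finset I)) (a : Finset I → ℝ) (hT : ∀ S ∈ s, S.card ≤ d) :
    Rep d (2 ^ A.card * ∑ S ∈ s, |a S|) (fun z => ∑ S ∈ s, a S * Dec b A (mono p S) z) := by
  have e : ∀ z, ∑ S ∈ s, a S * Dec b A (mono p S) z =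
      ∑ q ∈ s ×ˢ A.powerset, (a q.1 * (-1 : ℝ) ^ q.2.card) * mono p (lft b q.1 q.2) z := by
    intro z
    rw [Finset.sum_product]
    refine Finset.sum_congr rfl fun S _ => ?_
    rw [Dec_mono, Finset.mul_sum]
    refine Finset.sum_congr rfl fun η _ => by ring
  simp only [e]
  have := Rep.monoLC h0 h1 d (s ×ˢ A.powerset) (fun q => a q.1 * (-1 : ℝ) ^ q.2.card)
    (fun q => lft b q.1 q.2) (by
      rintro ⟨S, η⟩ h
      simp only [Finset.mem_product] at h
      rw [lft_card]; exact hT S h.1)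
  convert this using 1
  rw [Finset.sum_product, Finset.mul_sum]
  refine Finset.sum_congr rfl fun S _ => ?_
  simp [abs_mul]

end Dec

section Taylor

lemma exp_taylor (K : ℕ) (hK : 1 ≤ K) (y : ℝ) :
    ‖Complex.exp (y * Complex.I) - ∑ k ∈ Finset.range K, ((y : ℂ) * Complex.I) ^ k / (k.factorial : ℂ)‖
      ≤ (K + 1) * |y| ^ K := by
  have hn : ‖(y : ℂ) * Complex.I‖ = |y| := by simp
  rcases le_total |y| 1 with h | h
  · have := Complex.exp_bound (x := (y : ℂ) * Complex.I) (by rw [hn]; exact h) (n := K) hK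
    rw [hn] at this
    refine this.trans ?_
    rw [mul_comm]
    gcongr
    have h1 : (1 : ℝ) ≤ (K.factorial * K : ℝ) := by
      have : 1 ≤ K.factorial * K := Nat.mul_pos (Nat.factorial_pos K) hK
      exact_mod_cast this
    calc _ ≤ ((K.succ : ℕ) : ℝ) * 1 := by
          gcongr
          exact inv_le_one_of_one_le₀ h1
      _ = _ := by push_cast; ring
  · refine (norm_sub_le _ _).trans ?_
    rw [Complex.norm_exp_ofReal_mul_I]
    have h1 : ‖∑ k ∈ Finset.range K, ((y : ℂ) * Complex.I) ^ k / (k.factorial : ℂ)‖ ≤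
        ∑ k ∈ Finset.range K, |y| ^ K := by
      refine norm_sum_le_of_le _ fun k hk => ?_
      rw [norm_div, norm_pow, hn]
      have hf : (1 : ℝ) ≤ ‖(k.factorial : ℂ)‖ := by
        rw [Complex.norm_natCast]
        exact_mod_cast Nat.factorial_pos k
      calc _ ≤ |y| ^ k := div_le_self (by positivity) hf
        _ ≤ _ := pow_le_pow_right₀ h (Finset.mem_range.mp hk).le
    simp only [Finset.sum_const, Finset.card_range, nsmul_eq_mul] at h1
    have := one_le_pow₀ h (n := K)
    linarith

end Taylor

section Block
variable {J : Type*} [Fintype J] [DecidableEq J]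

lemma Ex_prod_indep {ι : Type*} [DecidableEq ι] (p : ℝ) (M : Finset ι) (Ψ : ι → (J → Bool) → ℂ)
    (T : ι → Finset J) (hΨ : ∀ i, DependsOn (Ψ i) (T i : Set J))
    (hT : ∀ i j, i ≠ j → Disjoint (T i) (T j)) (R : (J → Bool) → ℂ) (U : Finset J)
    (hR : DependsOn R (U : Set J)) (hU : ∀ i ∈ M, Disjoint (T i) U) :
    Ex p (fun x => (∏ i ∈ M, Ψ i x) * R x) = (∏ i ∈ M, Ex p (Ψ i)) * Ex p R := by
  induction M using Finset.induction_on with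
  | empty => simp
  | insert a M ha ih =>
    simp only [Finset.prod_insert ha, mul_assoc]
    rw [Ex_mul_indep p (T a) (hΨ a), ih fun i hi => hU i (by simp [hi])]
    intro x y hxy
    have h1 : ∀ i ∈ M, Ψ i x = Ψ i y := by
      intro i hi
      apply hΨ i
      intro j hj
      apply hxy
      have hai : a ≠ i := fun h => ha (h ▸ hi)
      intro hja
      exact (Finset.disjoint_left.mp (hT a i hai)) hja hj
    have h2 : R x = R y := by
      apply hR
      intro j hj
      apply hxy
      intro hja
      exact (Finset.disjoint_left.mp (hU a (by simp))) hja hj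
    simp only [Finset.prod_congr rfl h1, h2]

theorem block_rep {p : ℝ} (h0 : 0 ≤ p) (h1 : p ≤ 1) {m : ℕ} (Ψ : Fin m → (J → Bool) → ℂ)
    (T : Fin m → Finset J) (hΨ : ∀ i, DependsOn (Ψ i) (T i : Set J))
    (hT : ∀ i j, i ≠ j → Disjoint (T i) (T j)) (hn : ∀ i x, ‖Ψ i x‖ ≤ 1) {ρ : ℝ} (hρ : 0 ≤ ρ)
    (hρ1 : ρ ≤ 1) (hE : ∀ i, ‖Ex p (Ψ i)‖ ≤ ρ) {d : ℕ} {A : ℝ} {G : (J → Bool) → ℝ}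
    (hG : Rep d A G) :
    ‖Ex p (fun x => (∏ i, Ψ i x) * (G x : ℂ))‖ ≤ A * ρ ^ (m - d) := by
  induction hG with
  | base A f S hS hd hA =>
    have hA0 : 0 ≤ A := (abs_nonneg _).trans (hA fun _ => true)
    set M := Finset.univ.filter fun i => Disjoint (T i) S with hM
    have hcard : m - d ≤ M.card := by
      have h2 : (Finset.univ.filter fun i => ¬ Disjoint (T i) S).card ≤ S.card := by
        have : ∀ i ∈ (Finset.univ.filter fun i => ¬ Disjoint (T i) S), ∃ j, j ∈ S ∧ j ∈ T i := by
          intro i hi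
          simp [Finset.not_disjoint_iff] at hi
          obtain ⟨j, a, b⟩ := hi; exact ⟨j, b, a⟩
        refine Finset.card_le_card_of_forall_subsingleton (fun i j => j ∈ T i) this ?_
        intro j _ i hi i' hi'
        by_contra hne
        exact Finset.disjoint_left.mp (hT i i' hne) hi.2 hi'.2
      have h3 := Finset.card_filter_add_card_filter_not (s := (Finset.univ : Finset (Fin m)))
        (fun i => Disjoint (T i) S)
      simp only [Finset.card_univ, Fintype.card_fin] at h3
      rw [← hM] at h3
      omega
    have e : ∀ x, (∏ i, Ψ i x) * (f x : ℂ) = (∏ i ∈ M, Ψ i x) * ((∏ i ∈ Mᶜ, Ψ i x) * (f x : ℂ)) := by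
      intro x
      rw [← mul_assoc, Finset.prod_mul_prod_compl]
    simp only [e]
    rw [Ex_prod_indep p M Ψ T hΨ hT _ ((Mᶜ.biUnion T) ∪ S)]
    · rw [norm_mul, norm_prod, mul_comm]
      have h2 : ‖Ex p (fun x => (∏ i ∈ Mᶜ, Ψ i x) * (f x : ℂ))‖ ≤ A := by
        refine norm_Ex_le_of h0 h1 _ fun x => ?_
        rw [norm_mul, norm_prod, Complex.norm_real]
        calc _ ≤ 1 * A := by
              gcongr
              · exact Finset.prod_le_one (fun _ _ => norm_nonneg _) fun i _ => hn i x
              · exact hA x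
          _ = A := one_mul _
      have h3 : ∏ i ∈ M, ‖Ex p (Ψ i)‖ ≤ ρ ^ (m - d) := by
        calc _ ≤ ∏ i ∈ M, ρ := Finset.prod_le_prod (fun _ _ => norm_nonneg _) fun i _ => hE i
          _ = ρ ^ M.card := by simp
          _ ≤ _ := pow_le_pow_of_le_one hρ hρ1 hcard
      exact mul_le_mul h2 h3 (Finset.prod_nonneg fun _ _ => norm_nonneg _) hA0
    · intro x y hxy
      have a1 : ∀ i ∈ Mᶜ, Ψ i x = Ψ i y := by
        intro i hi
        apply hΨ
        intro j hj
        apply hxy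
        simp only [coe_union, coe_biUnion, Set.mem_union, Set.mem_iUnion]
        exact Or.inl ⟨i, hi, hj⟩
      have a2 : f x = f y := hd fun j hj => hxy j (by simp only [coe_union]; exact Or.inr hj)
      simp only [Finset.prod_congr rfl a1, a2]
    · intro i hi
      rw [Finset.disjoint_union_right]
      refine ⟨?_, (Finset.mem_filter.mp hi).2⟩
      rw [Finset.disjoint_biUnion_right]
      intro j hj
      apply hT
      rintro rfl
      exact (Finset.mem_compl.mp hj) hi
  | add A B f g hf hg ihf ihg =>
    have e : ∀ x, (∏ i, Ψ i x) * ((f x + g x : ℝ) : ℂ) =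
        (∏ i, Ψ i x) * (f x : ℂ) + (∏ i, Ψ i x) * (g x : ℂ) := by
      intro x; push_cast; ring
    simp only [e]
    rw [Ex_add, add_mul]
    exact (norm_add_le _ _).trans (add_le_add ihf ihg)

/-- the full block estimate -/
theorem block_full {p : ℝ} (h0 : 0 ≤ p) (h1 : p ≤ 1) {m : ℕ} (Φ : Fin m → (J → Bool) → ℝ)
    (T : Fin m → Finset J) (hΦ : ∀ i, DependsOn (Φ i) (T i : Set J))
    (hT : ∀ i j, i ≠ j → Disjoint (T i) (T j)) (θ : ℝ) {ρ : ℝ} (hρ : 0 ≤ ρ)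
    (hρ1 : ρ ≤ 1) (hE : ∀ i, ‖Ex p (fun x => Complex.exp ((θ * Φ i x : ℝ) * Complex.I))‖ ≤ ρ)
    {d : ℕ} {A : ℝ} {P : (J → Bool) → ℝ} (hP : Rep d A P) (hA : 1 ≤ |θ| * A)
    (K : ℕ) (hK : 1 ≤ K) (hK2 : Even K) :
    ‖Ex p (fun x => Complex.exp ((θ * (∑ i, Φ i x + P x) : ℝ) * Complex.I))‖ ≤
      K * (|θ| * A) ^ K * ρ ^ (m - K * d) + (K + 1) * (|θ| ^ K * Ex p (fun x => P x ^ K)) := by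
  set Ψ : Fin m → (J → Bool) → ℂ := fun i x => Complex.exp ((θ * Φ i x : ℝ) * Complex.I) with hΨ
  have hn : ∀ i x, ‖Ψ i x‖ ≤ 1 := fun i x => by
    simp only [hΨ]; rw [Complex.norm_exp_ofReal_mul_I]
  have hdep : ∀ i, DependsOn (Ψ i) (T i : Set J) := by
    intro i x y h; simp only [hΨ, hΦ i h]
  set R : (J → Bool) → ℂ := fun x => Complex.exp ((θ * P x : ℝ) * Complex.I) -
    ∑ k ∈ Finset.range K, (((θ * P x : ℝ) : ℂ) * Complex.I) ^ k / (k.factorial : ℂ) with hR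
  have e : ∀ x, Complex.exp ((θ * (∑ i, Φ i x + P x) : ℝ) * Complex.I) =
      (∑ k ∈ Finset.range K, (Complex.I ^ k / (k.factorial : ℂ)) *
        ((∏ i, Ψ i x) * ((θ ^ k * P x ^ k : ℝ) : ℂ))) + (∏ i, Ψ i x) * R x := by
    intro x
    have a : Complex.exp ((θ * (∑ i, Φ i x + P x) : ℝ) * Complex.I) =
        (∏ i, Ψ i x) * Complex.exp ((θ * P x : ℝ) * Complex.I) := by
      simp only [hΨ]
      rw [← Complex.exp_sum, ← Complex.exp_add, ← Finset.sum_mul, ← add_mul]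
      congr 2
      push_cast
      rw [mul_add, Finset.mul_sum]
    rw [a]
    have b : Complex.exp ((θ * P x : ℝ) * Complex.I) =
      R x + ∑ k ∈ Finset.range K, (((θ * P x : ℝ) : ℂ) * Complex.I) ^ k / (k.factorial : ℂ) := by
      simp only [hR]; ring
    rw [b, mul_add, add_comm, Finset.mul_sum]
    congr 1
    refine Finset.sum_congr rfl fun k _ => ?_
    push_cast
    ring
  simp only [e]
  rw [Ex_add, Ex_sum]
  refine (norm_add_le _ _).trans (add_le_add ?_ ?_)
  · have : ∀ k ∈ Finset.range K, ‖Ex p (fun x => (Complex.I ^ k / (k.factorial : ℂ)) *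
        ((∏ i, Ψ i x) * ((θ ^ k * P x ^ k : ℝ) : ℂ)))‖ ≤ (|θ| * A) ^ K * ρ ^ (m - K * d) := by
      intro k hk
      have hkK := (Finset.mem_range.mp hk).le
      rw [Ex_mul_left, norm_mul]
      have h3 : ‖Complex.I ^ k / (k.factorial : ℂ)‖ ≤ 1 := by
        rw [norm_div, norm_pow, Complex.norm_I, one_pow, Complex.norm_natCast]
        exact div_le_one_of_le₀ (by exact_mod_cast Nat.factorial_pos k) (by positivity)
      have h4 := block_rep h0 h1 Ψ T hdep hT hn hρ hρ1 hE ((hP.pow k).smul (θ ^ k))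
      calc _ ≤ 1 * (|θ ^ k| * A ^ k * ρ ^ (m - k * d)) := by gcongr
        _ = (|θ| * A) ^ k * ρ ^ (m - k * d) := by rw [abs_pow, mul_pow, one_mul]
        _ ≤ _ := by
          apply mul_le_mul (pow_le_pow_right₀ hA hkK) _ (by positivity) (by positivity)
          apply pow_le_pow_of_le_one hρ hρ1
          have := Nat.mul_le_mul_right d hkK
          omega
    refine (norm_sum_le_of_le _ this).trans (le_of_eq ?_)
    simp; ring
  · refine (norm_Ex_le h0 h1 _).trans ?_
    have : ∀ x, ‖(∏ i, Ψ i x) * R x‖ ≤ ((K : ℝ) + 1) * |θ| ^ K * P x ^ K := by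
      intro x
      rw [norm_mul, norm_prod]
      have h3 := exp_taylor K hK (θ * P x)
      calc _ ≤ 1 * ((K + 1) * |θ * P x| ^ K) := by
            gcongr
            exact Finset.prod_le_one (fun _ _ => norm_nonneg _) fun i _ => hn i x
        _ = _ := by rw [abs_mul, mul_pow, hK2.pow_abs (P x)]; ring
    refine (Ex_mono h0 h1 this).trans (le_of_eq ?_)
    rw [Ex_mul_left, mul_assoc]

/-- single block characteristic function bound -/
lemma block_cf {p : ℝ} (h0 : 0 ≤ p) (h1 : p ≤ 1) (Φ : (J → Bool) → ℝ) (hE : Ex p Φ = 0)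
    (θ B : ℝ) (hB : 0 ≤ B) (h4 : Ex p (fun x => Φ x ^ 4) ≤ B * (Ex p (fun x => Φ x ^ 2)) ^ 2)
    (hu : (256 * B + 1) * (θ ^ 2 * Ex p (fun x => Φ x ^ 2)) ≤ 1) :
    ‖Ex p (fun x => Complex.exp ((θ * Φ x : ℝ) * Complex.I))‖ ≤
      1 - θ ^ 2 * Ex p (fun x => Φ x ^ 2) / 4 := by
  set u := θ ^ 2 * Ex p (fun x => Φ x ^ 2) with hu'
  have hs0 : 0 ≤ Ex p (fun x => Φ x ^ 2) := Ex_nonneg h0 h1 fun x => by positivity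
  have hu0 : 0 ≤ u := by positivity
  have e : ∀ x, Complex.exp ((θ * Φ x : ℝ) * Complex.I) =
      (((1 : ℝ) - θ ^ 2 / 2 * Φ x ^ 2 : ℝ) : ℂ) + Complex.I * ((θ * Φ x : ℝ) : ℂ) +
      (Complex.exp ((θ * Φ x : ℝ) * Complex.I) -
        ∑ k ∈ Finset.range 3, (((θ * Φ x : ℝ) : ℂ) * Complex.I) ^ k / (k.factorial : ℂ)) := by
    intro x
    simp only [Finset.sum_range_succ, Finset.sum_range_zero, Nat.factorial, mul_pow, Complex.I_sq]
    push_cast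
    ring
  have hb : ∀ x, ‖Complex.exp ((θ * Φ x : ℝ) * Complex.I) -
        ∑ k ∈ Finset.range 3, (((θ * Φ x : ℝ) : ℂ) * Complex.I) ^ k / (k.factorial : ℂ)‖ ≤
        θ ^ 2 / 8 * Φ x ^ 2 + 32 * θ ^ 4 * Φ x ^ 4 := by
    intro x
    refine (exp_taylor 3 (by norm_num) _).trans ?_
    set y := θ * Φ x with hy
    have h5 : θ ^ 2 / 8 * Φ x ^ 2 + 32 * θ ^ 4 * Φ x ^ 4 = |y| ^ 2 / 8 + 32 * |y| ^ 4 := by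
      have : |y| ^ 4 = y ^ 4 := by rw [show (4 : ℕ) = 2 * 2 from rfl, pow_mul, sq_abs, ← pow_mul]
      rw [sq_abs, this, hy]; ring
    rw [h5]
    push_cast
    nlinarith [mul_nonneg (sq_nonneg |y|) (sq_nonneg (16 * |y| - 1)), sq_nonneg |y|]
  rw [show (fun x => Complex.exp ((θ * Φ x : ℝ) * Complex.I)) = _ from funext e]
  rw [Ex_add, Ex_add, Ex_ofReal, Ex_mul_left, Ex_ofReal, Ex_mul_left, hE, Ex_sub, Ex_const,
    Ex_mul_left]
  have h6 := (norm_Ex_le h0 h1 _).trans (Ex_mono h0 h1 hb)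
  rw [Ex_add, Ex_mul_left, Ex_mul_left] at h6
  refine (norm_add_le _ _).trans ?_
  have h7 : ‖((1 - θ ^ 2 / 2 * Ex p (fun x => Φ x ^ 2) : ℝ) : ℂ) + Complex.I * ((θ * 0 : ℝ) : ℂ)‖ =
      1 - u / 2 := by
    simp only [mul_zero, Complex.ofReal_zero, add_zero]
    rw [Complex.norm_real, Real.norm_of_nonneg]
    · rw [hu']; ring
    · rw [show θ ^ 2 / 2 * Ex p (fun x => Φ x ^ 2) = u / 2 by rw [hu']; ring]
      nlinarith [mul_nonneg hB hu0]
  rw [h7]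
  have h8 : θ ^ 4 * Ex p (fun x => Φ x ^ 4) ≤ B * u ^ 2 := by
    calc _ ≤ θ ^ 4 * (B * (Ex p (fun x => Φ x ^ 2)) ^ 2) := by gcongr
      _ = _ := by rw [hu']; ring
  have h9 : θ ^ 2 / 8 * Ex p (fun x => Φ x ^ 2) = u / 8 := by rw [hu']; ring
  rw [h9] at h6
  nlinarith [mul_nonneg hB hu0, mul_le_mul_of_nonneg_right hu hu0]
end Block
end SCL

namespace SCL
open Finset
open scoped Classical

section Comb
variable {β : Type*} [Fintype β] (H : SimpleGraph β) {n : ℕ}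

noncomputable def HE : Finset (Sym2 β) := Finset.univ.filter (fun e => e ∈ H.edgeSet)
noncomputable def cp (f : β → Fin n) : Finset (Sym2 (Fin n)) := (HE H).image (Sym2.map f)
noncomputable def copies (n : ℕ) : Finset (Finset (Sym2 (Fin n))) :=
  Finset.univ.image (fun f : β ↪ Fin n => cp H f)
noncomputable def spt {α : Type*} [Fintype α] (S : Finset (Sym2 α)) : Finset α :=
  Finset.univ.filter (fun x => ∃ e ∈ S, x ∈ e)
noncomputable def NS (S : Finset (Sym2 (Fin n))) : ℕ := ((copies H n).filter (fun E => S ⊆ E)).card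

lemma spt_mono {α : Type*} [Fintype α] {S T : Finset (Sym2 α)} (h : S ⊆ T) : spt S ⊆ spt T := by
  intro x hx
  simp only [spt, mem_filter, mem_univ, true_and] at *
  obtain ⟨e, he, hx⟩ := hx
  exact ⟨e, h he, hx⟩

lemma spt_cp_sub (f : β → Fin n) : spt (cp H f) ⊆ Finset.univ.image f := by
  intro x hx
  simp only [spt, cp, mem_filter, mem_univ, true_and, mem_image, exists_exists_and_eq_and] at *
  obtain ⟨e, he, hx⟩ := hx
  obtain ⟨y, hy, rfl⟩ := Sym2.mem_map.mp hx
  exact ⟨y, rfl⟩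

lemma spt_cp (hiso : ∀ x : β, ∃ y, H.Adj x y) (f : β → Fin n) :
    spt (cp H f) = Finset.univ.image f := by
  refine (spt_cp_sub H f).antisymm ?_
  intro x hx
  simp only [spt, cp, HE, mem_filter, mem_univ, true_and, mem_image, exists_exists_and_eq_and] at *
  obtain ⟨y, rfl⟩ := hx
  obtain ⟨z, hz⟩ := hiso y
  exact ⟨s(y, z), hz, by simp⟩

lemma cp_card (f : β → Fin n) (hf : Function.Injective f) : (cp H f).card = (HE H).card :=
  Finset.card_image_of_injective _ (Sym2.map.injective hf)

lemma copies_card {E : Finset (Sym2 (Fin n))} (hE : E ∈ copies H n) : E.card = (HE H).card := by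
  simp only [copies, mem_image, mem_univ, true_and] at hE
  obtain ⟨f, rfl⟩ := hE
  exact cp_card H f f.injective

lemma count_range (Q : Finset (Fin n)) :
    (Finset.univ.filter fun f : β → Fin n => Q ⊆ Finset.univ.image f).card * n ^ Q.card ≤
      Fintype.card β ^ Q.card * n ^ Fintype.card β := by
  set P := {f : β → Fin n // Q ⊆ Finset.univ.image f}
  have hσ : ∀ f : P, ∀ q : Q, ∃ x, f.1 x = q := by
    intro f q
    have := f.2 q.2
    simpa using this
  choose σ hσ using hσ
  have hinj : ∀ f, Function.Injective (σ f) := by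
    intro f a b h
    have := hσ f a
    rw [h, hσ f b] at this
    exact Subtype.ext this.symm
  let F : P × (Q → Fin n) → (Q → β) × (β → Fin n) := fun q =>
    (σ q.1, fun x => if h : ∃ r, σ q.1 r = x then q.2 h.choose else q.1.1 x)
  have hF : Function.Injective F := by
    rintro ⟨f, g⟩ ⟨f', g'⟩ h
    have h1 : σ f = σ f' := (Prod.ext_iff.mp h).1
    have h2 := congrFun (Prod.ext_iff.mp h).2
    simp only [F] at h2
    have hff : f = f' := by
      apply Subtype.ext
      funext x
      by_cases hx : ∃ r, σ f r = x
      · obtain ⟨r, rfl⟩ := hx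
        rw [hσ f r, h1, hσ f' r]
      · have := h2 x
        rw [dif_neg hx, dif_neg (by rwa [← h1])] at this
        exact this
    subst hff
    congr 1
    funext r
    have := h2 (σ f r)
    have hx : ∃ r', σ f r' = σ f r := ⟨r, rfl⟩
    rw [dif_pos hx, dif_pos hx] at this
    have : hx.choose = r := hinj f hx.choose_spec
    simp_all
  have := Fintype.card_le_of_injective F hF
  simp only [Fintype.card_prod, Fintype.card_fun, Fintype.card_coe, Fintype.card_fin] at this
  rw [Fintype.card_subtype] at this
  exact this

lemma NS_le (S : Finset (Sym2 (Fin n))) :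
    NS H S ≤ (Finset.univ.filter fun f : β → Fin n => spt S ⊆ Finset.univ.image f).card := by
  unfold NS
  refine (Finset.card_le_card ?_).trans (Finset.card_image_le (f := cp H))
  intro E hE
  simp only [copies, mem_filter, mem_image, mem_univ, true_and] at *
  obtain ⟨⟨f, rfl⟩, hS⟩ := hE
  exact ⟨f, (spt_mono hS).trans (spt_cp_sub H f), rfl⟩

lemma spt_card_le (S : Finset (Sym2 (Fin n))) (h : NS H S ≠ 0) :
    (spt S).card ≤ Fintype.card β := by
  unfold NS at h
  obtain ⟨E, hE⟩ := Finset.card_pos.mp (Nat.pos_of_ne_zero h)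
  simp only [copies, mem_filter, mem_image, mem_univ, true_and] at hE
  obtain ⟨⟨f, rfl⟩, hS⟩ := hE
  exact (Finset.card_le_card ((spt_mono hS).trans (spt_cp_sub H f))).trans Finset.card_image_le

lemma NS_bound (hv : 1 ≤ Fintype.card β) (S : Finset (Sym2 (Fin n))) :
    NS H S * n ^ (spt S).card ≤ Fintype.card β ^ Fintype.card β * n ^ Fintype.card β := by
  by_cases h : NS H S = 0
  · simp [h]
  calc _ ≤ _ := Nat.mul_le_mul_right _ (NS_le H S)
    _ ≤ _ := count_range _
    _ ≤ _ := Nat.mul_le_mul_right _ (Nat.pow_le_pow_right hv (spt_card_le H S h))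

lemma count_meet (Q : Finset (Fin n)) (s : ℕ) :
    (Finset.univ.filter fun f : β → Fin n => s ≤ (Finset.univ.image f ∩ Q).card).card * n ^ s ≤
      2 ^ Fintype.card β * (Q.card ^ s * n ^ Fintype.card β) := by
  have hsub : (Finset.univ.filter fun f : β → Fin n => s ≤ (Finset.univ.image f ∩ Q).card) ⊆
      (Finset.powersetCard s (Finset.univ : Finset β)).biUnion
        (fun T => Fintype.piFinset (fun x => if x ∈ T then Q else Finset.univ)) := by
    intro f hf
    simp only [mem_filter, mem_univ, true_and] at hf
    have h1 : s ≤ (Finset.univ.filter fun x => f x ∈ Q).card := by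
      refine hf.trans ?_
      refine (Finset.card_le_card ?_).trans (Finset.card_image_le (f := f))
      intro y hy
      simp only [mem_inter, mem_image, mem_univ, true_and, mem_filter] at *
      obtain ⟨⟨x, rfl⟩, hy⟩ := hy
      exact ⟨x, hy, rfl⟩
    obtain ⟨T, hT, hc⟩ := Finset.exists_subset_card_eq h1
    simp only [mem_biUnion, mem_powersetCard, subset_univ, true_and, Fintype.mem_piFinset]
    refine ⟨T, hc, fun x => ?_⟩
    split_ifs with hx
    · exact (Finset.mem_filter.mp (hT hx)).2
    · simp
  calc _ ≤ (∑ T ∈ Finset.powersetCard s (Finset.univ : Finset β),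
        (Fintype.piFinset (fun x => if x ∈ T then Q else Finset.univ)).card) * n ^ s :=
        Nat.mul_le_mul_right _ ((Finset.card_le_card hsub).trans Finset.card_biUnion_le)
    _ = ∑ T ∈ Finset.powersetCard s (Finset.univ : Finset β),
        (Fintype.piFinset (fun x => if x ∈ T then Q else (Finset.univ : Finset (Fin n)))).card * n ^ s :=
        Finset.sum_mul _ _ _
    _ = ∑ T ∈ Finset.powersetCard s (Finset.univ : Finset β), Q.card ^ s * n ^ Fintype.card β := by
        refine Finset.sum_congr rfl fun T hT => ?_
        have hT := (Finset.mem_powersetCard.mp hT).2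
        rw [Fintype.card_piFinset]
        have : ∀ x, (if x ∈ T then Q else (Finset.univ : Finset (Fin n))).card =
            if x ∈ T then Q.card else n := by intro x; split_ifs <;> simp
        simp only [this]
        rw [Finset.prod_ite]
        simp only [prod_const]
        have e1 : (Finset.univ.filter fun x => x ∈ T) = T := by ext; simp
        have e2 : (Finset.univ.filter fun x => x ∉ T) = Tᶜ := by ext; simp
        rw [e1, e2, hT, mul_assoc, ← pow_add, ← hT, add_comm, Finset.card_add_card_compl]
    _ ≤ _ := by
        rw [Finset.sum_const, smul_eq_mul, Finset.card_powersetCard, Finset.card_univ]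
        exact Nat.mul_le_mul_right _ (Nat.choose_le_two_pow _ _)

lemma sum_NS (T : Finset (Finset (Sym2 (Fin n)))) (Q : Finset (Fin n)) (s : ℕ)
    (hs : ∀ S ∈ T, NS H S ≠ 0 → s ≤ (spt S ∩ Q).card) :
    (∑ S ∈ T, NS H S) * n ^ s ≤
      2 ^ (HE H).card * (2 ^ Fintype.card β * (Q.card ^ s * n ^ Fintype.card β)) := by
  refine le_trans ?_ (Nat.mul_le_mul_left _ (count_meet (β := β) Q s))
  rw [← mul_assoc]
  refine Nat.mul_le_mul_right _ ?_
  unfold NS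
  simp only [Finset.card_filter]
  rw [Finset.sum_comm]
  have h1 : ∀ E ∈ copies H n, ∑ S ∈ T, (if S ⊆ E then 1 else 0) ≤
      if s ≤ (spt E ∩ Q).card then 2 ^ (HE H).card else 0 := by
    intro E hE
    split_ifs with h
    · rw [← Finset.card_filter, ← copies_card H hE, ← Finset.card_powerset]
      apply Finset.card_le_card
      intro S hS
      simpa using (Finset.mem_filter.mp hS).2
    · apply le_of_eq
      apply Finset.sum_eq_zero
      intro S hS
      rw [if_neg]
      intro hSE
      apply h
      refine (hs S hS ?_).trans (Finset.card_le_card (Finset.inter_subset_inter_right (spt_mono hSE)))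
      unfold NS
      exact (Finset.card_pos.mpr ⟨E, by simp [hE, hSE]⟩).ne'
  refine (Finset.sum_le_sum h1).trans ?_
  rw [← Finset.sum_filter, Finset.sum_const, smul_eq_mul, mul_comm]
  refine Nat.mul_le_mul_left _ ?_
  rw [← Finset.card_filter]
  refine (Finset.card_le_card ?_).trans (Finset.card_image_le (f := cp H))
  intro E hE
  simp only [copies, mem_filter, mem_image, mem_univ, true_and] at *
  obtain ⟨⟨f, rfl⟩, hS⟩ := hE
  exact ⟨f, hS.trans (Finset.card_le_card (Finset.inter_subset_inter_right (spt_cp_sub H f))), rfl⟩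

lemma sum_NS_sq (hv : 1 ≤ Fintype.card β) (hn : 1 ≤ n) (T : Finset (Finset (Sym2 (Fin n))))
    (Q : Finset (Fin n)) (s t : ℕ) (hs : ∀ S ∈ T, NS H S ≠ 0 → s ≤ (spt S ∩ Q).card)
    (ht : ∀ S ∈ T, NS H S ≠ 0 → t ≤ (spt S).card) :
    (∑ S ∈ T, NS H S ^ 2) * n ^ t * n ^ s ≤
      (Fintype.card β ^ Fintype.card β * n ^ Fintype.card β) *
      (2 ^ (HE H).card * (2 ^ Fintype.card β * (Q.card ^ s * n ^ Fintype.card β))) := by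
  calc _ ≤ (Fintype.card β ^ Fintype.card β * n ^ Fintype.card β) * ((∑ S ∈ T, NS H S) * n ^ s) := by
        rw [← mul_assoc]
        refine Nat.mul_le_mul_right _ ?_
        rw [Finset.sum_mul, Finset.mul_sum]
        refine Finset.sum_le_sum fun S hS => ?_
        by_cases h : NS H S = 0
        · simp [h]
        · rw [sq, mul_assoc, mul_comm]
          refine Nat.mul_le_mul_right _ ?_
          refine le_trans ?_ (NS_bound H hv S)
          exact Nat.mul_le_mul_left _ (Nat.pow_le_pow_right hn (ht S hS h))
    _ ≤ _ := Nat.mul_le_mul_left _ (sum_NS H T Q s hs)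

noncomputable def EU (U : Finset β) : Finset (Sym2 β) := (HE H).filter fun e => ∀ x ∈ e, x ∈ U

lemma fiber_count (hiso : ∀ x : β, ∃ y, H.Adj x y) (P : Finset (β → Fin n))
    (hP : ∀ f ∈ P, Function.Injective f) (F : Finset (Finset (Sym2 (Fin n))))
    (hF : ∀ f ∈ P, cp H f ∈ F) : P.card ≤ Fintype.card β ^ Fintype.card β * F.card := by
  refine Finset.card_le_mul_card_image_of_maps_to (f := cp H) hF _ ?_
  intro E hE
  rcases (P.filter fun f => cp H f = E).eq_empty_or_nonempty with h | ⟨f0, h0⟩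
  · rw [h]; simp
  · obtain ⟨hf0, hE0⟩ := Finset.mem_filter.mp h0
    have hc : (spt E).card = Fintype.card β := by
      rw [← hE0, spt_cp H hiso, Finset.card_image_of_injective _ (hP f0 hf0), Finset.card_univ]
    have : (P.filter fun f => cp H f = E) ⊆ Fintype.piFinset (fun _ => spt E) := by
      intro f hf
      obtain ⟨hf, hE⟩ := Finset.mem_filter.mp hf
      rw [Fintype.mem_piFinset]
      intro x
      rw [← hE, spt_cp H hiso]
      simp
    refine (Finset.card_le_card this).trans ?_
    rw [Fintype.card_piFinset]
    simp [hc]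

lemma ext_count (hiso : ∀ x : β, ∃ y, H.Adj x y) (hn : Fintype.card β ≤ n)
    (hv : 1 ≤ Fintype.card β) (U : Finset β)
    (w : β → Fin n) (hw : Set.InjOn w U) :
    n ^ Fintype.card β ≤ Fintype.card β ^ Fintype.card β * (Fintype.card β ^ Fintype.card β *
      NS H ((EU H U).image (Sym2.map w))) * n ^ U.card := by
  set v := Fintype.card β
  set W := U.image w
  let ext : ({x // x ∉ U} ↪ {y // y ∉ W}) → (β → Fin n) := fun g x =>
    if h : x ∈ U then w x else (g ⟨x, h⟩).1
  have hext : Function.Injective ext := by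
    intro g g' h
    ext ⟨x, hx⟩
    have := congrFun h x
    simp only [ext, dif_neg hx] at this
    rw [this]
  have hinj : ∀ g, Function.Injective (ext g) := by
    intro g x y h
    by_cases hx : x ∈ U <;> by_cases hy : y ∈ U
    · simp only [ext, dif_pos hx, dif_pos hy] at h
      exact hw hx hy h
    · simp only [ext, dif_pos hx, dif_neg hy] at h
      exact absurd (Finset.mem_image_of_mem w hx) (h ▸ (g ⟨y, hy⟩).2)
    · simp only [ext, dif_neg hx, dif_pos hy] at h
      exact absurd (Finset.mem_image_of_mem w hy) (h ▸ (g ⟨x, hx⟩).2)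
    · simp only [ext, dif_neg hx, dif_neg hy] at h
      have := g.injective (Subtype.ext h)
      simpa using this
  have hfib := fiber_count H hiso (Finset.univ.image ext) (by
    intro f hf
    simp only [mem_image, mem_univ, true_and] at hf
    obtain ⟨g, rfl⟩ := hf
    exact hinj g) ((copies H n).filter fun E => (EU H U).image (Sym2.map w) ⊆ E) (by
    intro f hf
    simp only [mem_image, mem_univ, true_and] at hf
    obtain ⟨g, rfl⟩ := hf
    simp only [mem_filter]
    refine ⟨Finset.mem_image.mpr ⟨⟨ext g, hinj g⟩, by simp, rfl⟩, ?_⟩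
    intro e he
    simp only [EU, mem_image, mem_filter] at he
    obtain ⟨e', ⟨he', hU⟩, rfl⟩ := he
    refine Finset.mem_image.mpr ⟨e', he', ?_⟩
    apply Sym2.map_congr
    intro x hx
    simp only [ext, dif_pos (hU x hx)])
  rw [Finset.card_image_of_injective _ hext, Finset.card_univ, Fintype.card_embedding_eq] at hfib
  have c1 : Fintype.card {y // y ∉ W} = n - U.card := by
    rw [Fintype.card_subtype_compl, Fintype.card_fin]
    rw [Fintype.card_coe, Finset.card_image_of_injOn hw]
  have c2 : Fintype.card {x // x ∉ U} = v - U.card := by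
    rw [Fintype.card_subtype_compl]; simp [v]
  rw [c1, c2] at hfib
  have hUv : U.card ≤ v := Finset.card_le_univ U
  have h3 := Nat.pow_sub_le_descFactorial (n - U.card) (v - U.card)
  have h4 : n ≤ v * (n - U.card + 1 - (v - U.card)) := by
    have : n - U.card + 1 - (v - U.card) = n + 1 - v := by omega
    rw [this]
    obtain ⟨k, rfl⟩ := Nat.exists_eq_add_of_le hn
    have : v + k + 1 - v = k + 1 := by omega
    rw [this]; nlinarith
  calc n ^ v = n ^ (v - U.card) * n ^ U.card := by rw [← pow_add]; congr 1; omega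
    _ ≤ (v * (n - U.card + 1 - (v - U.card))) ^ (v - U.card) * n ^ U.card := by gcongr
    _ = v ^ (v - U.card) * (n - U.card + 1 - (v - U.card)) ^ (v - U.card) * n ^ U.card := by
        rw [mul_pow]
    _ ≤ v ^ v * (v ^ v * NS H ((EU H U).image (Sym2.map w))) * n ^ U.card := by
        refine Nat.mul_le_mul_right _ (Nat.mul_le_mul ?_ (h3.trans hfib))
        exact Nat.pow_le_pow_right hv (by omega)

/-- grown connected sets -/
lemma exists_U (hconn : H.Connected) (s : ℕ) (hs : 2 ≤ s) (hsv : s ≤ Fintype.card β) :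
    ∃ U : Finset β, U.card = s ∧ (∀ x ∈ U, ∃ y ∈ U, H.Adj x y) ∧
      ∀ {τ : Type} (g : β → τ), (∀ x ∈ U, ∀ y ∈ U, H.Adj x y → g x = g y) →
        ∀ x ∈ U, ∀ y ∈ U, g x = g y := by
  induction s, hs using Nat.le_induction with
  | base =>
    have : Nontrivial β := Fintype.one_lt_card_iff_nontrivial.mp (by omega)
    obtain ⟨x⟩ := hconn.nonempty
    obtain ⟨y, hxy⟩ := hconn.preconnected.exists_adj_of_nontrivial x
    have hne := hxy.ne
    refine ⟨{x, y}, by simp [hne], ?_, ?_⟩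
    · intro z hz
      simp at hz
      rcases hz with rfl | rfl
      · exact ⟨y, by simp, hxy⟩
      · exact ⟨x, by simp, hxy.symm⟩
    · intro τ g hg
      have := hg x (by simp) y (by simp) hxy
      intro a ha b hb
      simp at ha hb
      rcases ha with rfl | rfl <;> rcases hb with rfl | rfl <;> simp [this]
  | succ s hs ih =>
    obtain ⟨U, hU, hN, hC⟩ := ih (by omega)
    have hex : ∃ x ∈ U, ∃ y, y ∉ U ∧ H.Adj x y := by
      by_contra hcon
      push Not at hcon
      obtain ⟨a, ha⟩ : U.Nonempty := Finset.card_pos.mp (by omega)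
      have : ∀ b, b ∈ U := by
        intro b
        obtain ⟨p⟩ := hconn.preconnected a b
        induction p with
        | nil => exact ha
        | cons h p ih =>
          apply ih
          by_contra hv
          exact hcon _ ha _ hv h
      have : U = Finset.univ := by ext; simp [this]
      rw [this, Finset.card_univ] at hU
      omega
    obtain ⟨x, hx, y, hy, hxy⟩ := hex
    refine ⟨insert y U, by rw [Finset.card_insert_of_notMem hy, hU], ?_, ?_⟩
    · intro z hz
      rcases Finset.mem_insert.mp hz with rfl | hz
      · exact ⟨x, by simp [hx], hxy.symm⟩
      · obtain ⟨w, hw, h⟩ := hN z hz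
        exact ⟨w, by simp [hw], h⟩
    · intro τ g hg
      have h1 := hC g (fun a ha b hb h => hg a (by simp [ha]) b (by simp [hb]) h)
      have h2 : g x = g y := hg x (by simp [hx]) y (by simp) hxy
      have h3 : ∀ a ∈ insert y U, g a = g x := by
        intro a ha
        rcases Finset.mem_insert.mp ha with rfl | ha
        · exact h2.symm
        · exact h1 a ha x hx
      intro a ha b hb
      rw [h3 a ha, h3 b hb]

end Comb
end SCL

namespace SCL
open Finset
open scoped Classical

section Coef
variable {β : Type*} [Fintype β] (H : SimpleGraph β) {n : ℕ}

noncomputable def XX (x : Sym2 (Fin n) → Bool) : ℝ :=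
  ∑ E ∈ copies H n, ∏ e ∈ E, if x e then (1 : ℝ) else 0

noncomputable def aS (p : ℝ) (S : Finset (Sym2 (Fin n))) : ℝ :=
  ∑ E ∈ (copies H n).filter (fun E => S ⊆ E), p ^ (E.card - S.card)

lemma XX_eq (p : ℝ) (x : Sym2 (Fin n) → Bool) : XX H x = ∑ S, aS H p S * mono p S x := by
  unfold XX aS
  have h : ∀ E : Finset (Sym2 (Fin n)), ∏ e ∈ E, (if x e then (1 : ℝ) else 0) =
      ∑ S, if S ⊆ E then p ^ (E.card - S.card) * mono p S x else 0 := by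
    intro E
    have h1 : ∀ e, (if x e then (1 : ℝ) else 0) = xi p (x e) + p := by intro e; simp [xi]
    simp only [h1]
    rw [Finset.prod_add, ← Finset.sum_filter]
    have : Finset.univ.filter (fun S => S ⊆ E) = E.powerset := by ext; simp
    rw [this]
    refine Finset.sum_congr rfl fun S hS => ?_
    rw [Finset.prod_const, Finset.card_sdiff_of_subset (Finset.mem_powerset.mp hS), mul_comm]
    rfl
  simp only [h]
  rw [Finset.sum_comm]
  refine Finset.sum_congr rfl fun S _ => ?_
  rw [Finset.sum_mul, Finset.sum_filter]

lemma aS_nonneg {p : ℝ} (h0 : 0 ≤ p) (S : Finset (Sym2 (Fin n))) : 0 ≤ aS H p S :=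
  Finset.sum_nonneg fun _ _ => by positivity

lemma aS_le {p : ℝ} (h0 : 0 ≤ p) (h1 : p ≤ 1) (S : Finset (Sym2 (Fin n))) :
    aS H p S ≤ NS H S := by
  unfold aS NS
  calc _ ≤ ∑ E ∈ (copies H n).filter (fun E => S ⊆ E), (1 : ℝ) :=
        Finset.sum_le_sum fun _ _ => pow_le_one₀ h0 h1
    _ = _ := by simp

lemma le_aS {lam p : ℝ} (hl : 0 ≤ lam) (h0 : lam ≤ p) (h1 : p ≤ 1) (S : Finset (Sym2 (Fin n))) :
    lam ^ (HE H).card * NS H S ≤ aS H p S := by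
  unfold aS NS
  rw [mul_comm, ← nsmul_eq_mul]
  refine Finset.card_nsmul_le_sum _ _ _ fun E hE => ?_
  rw [copies_card H (Finset.mem_filter.mp hE).1]
  calc lam ^ (HE H).card ≤ lam ^ ((HE H).card - S.card) :=
        pow_le_pow_of_le_one hl (h0.trans h1) (Nat.sub_le _ _)
    _ ≤ _ := by gcongr

lemma aS_zero (p : ℝ) (S : Finset (Sym2 (Fin n))) (h : NS H S = 0) : aS H p S = 0 := by
  unfold aS NS at *
  rw [Finset.card_eq_zero.mp h]; simp

lemma card_le_of_NS (S : Finset (Sym2 (Fin n))) (h : NS H S ≠ 0) : S.card ≤ (HE H).card := by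
  obtain ⟨E, hE⟩ := Finset.card_pos.mp (Nat.pos_of_ne_zero h)
  obtain ⟨a, b⟩ := Finset.mem_filter.mp hE
  rw [← copies_card H a]
  exact Finset.card_le_card b

lemma sum_aS_le {p : ℝ} (h0 : 0 ≤ p) (h1 : p ≤ 1) (T : Finset (Finset (Sym2 (Fin n)))) :
    ∑ S ∈ T, |aS H p S| ≤ 2 ^ (HE H).card * 2 ^ Fintype.card β * (n : ℝ) ^ Fintype.card β := by
  have := sum_NS H T ∅ 0 (by simp)
  simp only [pow_zero, mul_one, one_mul] at this
  calc _ ≤ ∑ S ∈ T, (NS H S : ℝ) := Finset.sum_le_sum fun S _ => by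
        rw [abs_of_nonneg (aS_nonneg H h0 S)]; exact aS_le H h0 h1 S
    _ ≤ _ := by
        rw [mul_assoc]
        exact_mod_cast this

lemma sum_aS_sq_le {p : ℝ} (h0 : 0 ≤ p) (h1 : p ≤ 1) (hv : 1 ≤ Fintype.card β) (hn : 1 ≤ n)
    (T : Finset (Finset (Sym2 (Fin n))))
    (Q : Finset (Fin n)) (s t : ℕ) (hs : ∀ S ∈ T, NS H S ≠ 0 → s ≤ (spt S ∩ Q).card)
    (ht : ∀ S ∈ T, NS H S ≠ 0 → t ≤ (spt S).card) :
    (∑ S ∈ T, aS H p S ^ 2 * (p * (1 - p)) ^ S.card) * (n : ℝ) ^ (t + s) ≤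
      ((Fintype.card β : ℝ) ^ Fintype.card β * 2 ^ (HE H).card * 2 ^ Fintype.card β) *
      ((Q.card : ℝ) ^ s * (n : ℝ) ^ (2 * Fintype.card β)) := by
  have := sum_NS_sq H hv hn T Q s t hs ht
  have h2 : ((∑ S ∈ T, (NS H S : ℝ) ^ 2) * (n : ℝ) ^ t * (n : ℝ) ^ s) ≤
      ((Fintype.card β : ℝ) ^ Fintype.card β * (n : ℝ) ^ Fintype.card β) *
      (2 ^ (HE H).card * (2 ^ Fintype.card β * ((Q.card : ℝ) ^ s * (n : ℝ) ^ Fintype.card β))) := by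
    exact_mod_cast this
  have h3 : ∑ S ∈ T, aS H p S ^ 2 * (p * (1 - p)) ^ S.card ≤ ∑ S ∈ T, (NS H S : ℝ) ^ 2 := by
    refine Finset.sum_le_sum fun S _ => ?_
    have a := aS_le H h0 h1 S
    have b := aS_nonneg H h0 S
    have c : (p * (1 - p)) ^ S.card ≤ 1 :=
      pow_le_one₀ (mul_nonneg h0 (by linarith)) (by nlinarith)
    have d : 0 ≤ (p * (1 - p)) ^ S.card := pow_nonneg (mul_nonneg h0 (by linarith)) _
    calc _ ≤ (NS H S : ℝ) ^ 2 * 1 := by gcongr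
      _ = _ := mul_one _
  calc _ ≤ (∑ S ∈ T, (NS H S : ℝ) ^ 2) * (n : ℝ) ^ (t + s) := by gcongr
    _ = (∑ S ∈ T, (NS H S : ℝ) ^ 2) * (n : ℝ) ^ t * (n : ℝ) ^ s := by rw [pow_add]; ring
    _ ≤ _ := h2
    _ = _ := by rw [two_mul, pow_add]; ring

end Coef

section Blocks
variable {β : Type*} [Fintype β] (H : SimpleGraph β) {n m l : ℕ} (ι : Fin m × β × Fin l ↪ Fin n)

noncomputable def col (y : Fin n) : Option (Fin m × β) :=
  if h : ∃ q, ι q = y then some (h.choose.1, h.choose.2.1) else none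

lemma col_ι (i : Fin m) (x : β) (j : Fin l) : col ι (ι (i, x, j)) = some (i, x) := by
  have h : ∃ q, ι q = ι (i, x, j) := ⟨_, rfl⟩
  have := ι.injective h.choose_spec
  simp only [col]; rw [dif_pos h, this]

lemma col_some {y : Fin n} {i : Fin m} {x : β} (h : col ι y = some (i, x)) :
    ∃ j, y = ι (i, x, j) := by
  unfold col at h
  split_ifs at h with hh
  simp only [Option.some.injEq, Prod.mk.injEq] at h
  refine ⟨hh.choose.2.2, ?_⟩
  rw [← h.1, ← h.2]; exact hh.choose_spec.symm

noncomputable def bb (e : Sym2 (Fin n)) : Option (Sym2 β) :=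
  if h : ∃ f, ∃ i, Sym2.map (col ι) e = Sym2.map (fun x => some (i, x)) f then some h.choose else none

lemma bb_iff (e : Sym2 (Fin n)) (f : Sym2 β) :
    bb ι e = some f ↔ ∃ i, Sym2.map (col ι) e = Sym2.map (fun x => some (i, x)) f := by
  unfold bb
  constructor
  · intro h
    split_ifs at h with hh
    simp only [Option.some.injEq] at h
    rw [← h]; exact hh.choose_spec
  · intro h
    have hh : ∃ f, ∃ i, Sym2.map (col ι) e = Sym2.map (fun x => some (i, x)) f := ⟨f, h⟩
    rw [dif_pos hh]
    obtain ⟨i, hi⟩ := h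
    obtain ⟨i', hi'⟩ := hh.choose_spec
    congr 1
    have := hi'.symm.trans hi
    have h2 := congrArg (Sym2.map (Option.map (Prod.snd : Fin m × β → β))) this
    rw [Sym2.map_map, Sym2.map_map] at h2
    exact Sym2.map.injective (Option.some_injective β) h2

noncomputable def VB (i : Fin m) : Finset (Fin n) := Finset.univ.image (fun q : β × Fin l => ι (i, q))

lemma VB_card (i : Fin m) : (VB ι i).card ≤ Fintype.card β * l := by
  refine Finset.card_image_le.trans ?_
  simp

lemma mem_VB {i : Fin m} {y : Fin n} : y ∈ VB ι i ↔ ∃ x, col ι y = some (i, x) := by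
  constructor
  · intro h
    simp only [VB, mem_image, mem_univ, true_and, Prod.exists] at h
    obtain ⟨x, j, rfl⟩ := h
    exact ⟨x, col_ι ι i x j⟩
  · rintro ⟨x, h⟩
    obtain ⟨j, rfl⟩ := col_some ι h
    exact Finset.mem_image.mpr ⟨(x, j), by simp, rfl⟩

def Mp (U : Finset β) (S : Finset (Sym2 (Fin n))) : Prop := ∀ f ∈ EU H U, ∃ e ∈ S, bb ι e = some f

variable {H} {U : Finset β}

lemma Mp_adj (hN : ∀ x ∈ U, ∃ y ∈ U, H.Adj x y) {S : Finset (Sym2 (Fin n))} (hS : Mp H ι U S) {x y : β} (hx : x ∈ U) (hy : y ∈ U)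
    (h : H.Adj x y) : ∃ i, (∃ z ∈ spt S, col ι z = some (i, x)) ∧ (∃ z ∈ spt S, col ι z = some (i, y)) := by
  obtain ⟨e, he, hb⟩ := hS s(x, y) (by
    simp only [EU, HE, mem_filter, mem_univ, true_and, SimpleGraph.mem_edgeSet, h, Sym2.mem_iff]
    rintro a (rfl | rfl) <;> assumption)
  obtain ⟨i, hi⟩ := (bb_iff ι _ _).mp hb
  have key : ∀ w ∈ s(x, y), ∃ z ∈ spt S, col ι z = some (i, w) := by
    intro w hw
    have : some (i, w) ∈ Sym2.map (col ι) e := by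
      rw [hi]; exact Sym2.mem_map.mpr ⟨w, hw, rfl⟩
    obtain ⟨z, hz, h⟩ := Sym2.mem_map.mp this
    exact ⟨z, by simp only [spt, mem_filter, mem_univ, true_and]; exact ⟨e, he, hz⟩, h⟩
  exact ⟨i, key x (by simp), key y (by simp)⟩

lemma Mp_lab (hN : ∀ x ∈ U, ∃ y ∈ U, H.Adj x y) {S : Finset (Sym2 (Fin n))} (hS : Mp H ι U S) {x : β} (hx : x ∈ U) :
    ∃ z, ∃ i, z ∈ spt S ∧ col ι z = some (i, x) := by
  obtain ⟨y, hy, h⟩ := hN x hx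
  obtain ⟨i, ⟨z, hz, h⟩, _⟩ := Mp_adj ι hN hS hx hy h
  exact ⟨z, i, hz, h⟩

lemma Mp_card (hN : ∀ x ∈ U, ∃ y ∈ U, H.Adj x y) {S : Finset (Sym2 (Fin n))} (hS : Mp H ι U S) :
    U.card ≤ (spt S ∩ Finset.univ.image ι).card := by
  refine Finset.card_le_card_of_forall_subsingleton (fun x z => ∃ i, col ι z = some (i, x)) ?_ ?_
  · intro x hx
    obtain ⟨z, i, hz, h⟩ := Mp_lab ι hN hS hx
    refine ⟨z, ?_, i, h⟩
    obtain ⟨j, rfl⟩ := col_some ι h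
    simp [hz]
  · rintro z _ x ⟨_, i, hx⟩ y ⟨_, i', hy⟩
    have := hx.symm.trans hy
    simp at this
    exact this.2

lemma Mp_multi (hN : ∀ x ∈ U, ∃ y ∈ U, H.Adj x y) {S : Finset (Sym2 (Fin n))} (hS : Mp H ι U S)
    (hU : U.Nonempty)
    (hC : ∀ {τ : Type} (g : β → τ), (∀ x ∈ U, ∀ y ∈ U, H.Adj x y → g x = g y) →
        ∀ x ∈ U, ∀ y ∈ U, g x = g y)
    (hm : ∀ i, ¬ spt S ⊆ VB ι i) : U.card + 1 ≤ (spt S).card := by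
  by_contra hcon
  push Not at hcon
  obtain ⟨x0, hx0⟩ := hU
  have : Nonempty (Fin n) := ⟨(Mp_lab ι hN hS hx0).choose⟩
  have : Nonempty (Fin m) := ⟨(Mp_lab ι hN hS hx0).choose_spec.choose⟩
  have hl : ∀ x, ∃ z, ∃ i, x ∈ U → (z ∈ spt S ∧ col ι z = some (i, x)) := by
    intro x
    by_cases hx : x ∈ U
    · obtain ⟨z, i, h⟩ := Mp_lab ι hN hS hx
      exact ⟨z, i, fun _ => h⟩
    · exact ⟨Classical.arbitrary _, Classical.arbitrary _, fun h => absurd h hx⟩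
  choose y g hyg using hl
  have hinj : Set.InjOn y U := by
    intro a ha b hb h
    have h1 := (hyg a ha).2
    rw [h, (hyg b hb).2] at h1
    simp at h1
    exact h1.2.symm
  have hYeq : U.image y = spt S := by
    apply Finset.eq_of_subset_of_card_le
    · intro z hz
      obtain ⟨a, ha, rfl⟩ := Finset.mem_image.mp hz
      exact (hyg a ha).1
    · rw [Finset.card_image_of_injOn hinj]; omega
  have huniq : ∀ z ∈ spt S, ∀ i x, col ι z = some (i, x) → i = g x := by
    intro z hz i x h
    rw [← hYeq] at hz
    obtain ⟨a, ha, rfl⟩ := Finset.mem_image.mp hz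
    rw [(hyg a ha).2] at h
    simp at h
    rw [← h.1, h.2]
  have hg := hC g (by
    intro a ha b hb hab
    obtain ⟨i, ⟨z, hz, h⟩, ⟨z', hz', h'⟩⟩ := Mp_adj ι hN hS ha hb hab
    rw [← huniq z hz i a h, ← huniq z' hz' i b h'])
  apply hm (g x0)
  intro z hz
  rw [← hYeq] at hz
  obtain ⟨a, ha, rfl⟩ := Finset.mem_image.mp hz
  rw [mem_VB, ← hg a ha x0 hx0]
  exact ⟨a, (hyg a ha).2⟩

end Blocks
end SCL

namespace SCL
open Finset
open scoped Classical

section BS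
variable {β : Type*} [Fintype β] (H : SimpleGraph β) {n m l : ℕ} (ι : Fin m × β × Fin l ↪ Fin n)
  (U : Finset β) (p : ℝ)

noncomputable def MB (i : Fin m) : Finset (Finset (Sym2 (Fin n))) :=
  Finset.univ.filter fun S => NS H S ≠ 0 ∧ Mp H ι U S ∧ spt S ⊆ VB ι i
noncomputable def MR : Finset (Finset (Sym2 (Fin n))) :=
  Finset.univ.filter fun S => NS H S ≠ 0 ∧ Mp H ι U S ∧ ∀ i, ¬ spt S ⊆ VB ι i
noncomputable def PhiB (i : Fin m) (z : Sym2 (Fin n) × Bool → Bool) : ℝ :=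
  ∑ S ∈ MB H ι U i, aS H p S * Dec (bb ι) (EU H U) (mono p S) z
noncomputable def PR (z : Sym2 (Fin n) × Bool → Bool) : ℝ :=
  ∑ S ∈ MR H ι U, aS H p S * Dec (bb ι) (EU H U) (mono p S) z

variable {H U}

lemma EU_nonempty (hN : ∀ x ∈ U, ∃ y ∈ U, H.Adj x y) (hU : U.Nonempty) : (EU H U).Nonempty := by
  obtain ⟨x, hx⟩ := hU
  obtain ⟨y, hy, h⟩ := hN x hx
  refine ⟨s(x, y), ?_⟩
  simp only [EU, HE, mem_filter, mem_univ, true_and, SimpleGraph.mem_edgeSet, h, Sym2.mem_iff]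
  rintro a (rfl | rfl) <;> assumption

lemma Mp_nonempty (hN : ∀ x ∈ U, ∃ y ∈ U, H.Adj x y) (hU : U.Nonempty)
    {S : Finset (Sym2 (Fin n))} (hS : Mp H ι U S) : S.Nonempty := by
  obtain ⟨f, hf⟩ := EU_nonempty hN hU
  obtain ⟨e, he, _⟩ := hS f hf
  exact ⟨e, he⟩

lemma VB_disj {i j : Fin m} (h : i ≠ j) : Disjoint (VB ι i) (VB ι j) := by
  rw [Finset.disjoint_left]
  intro y hi hj
  obtain ⟨x, hx⟩ := (mem_VB ι).mp hi
  obtain ⟨x', hx'⟩ := (mem_VB ι).mp hj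
  rw [hx] at hx'
  simp at hx'
  exact h hx'.1

lemma edge_spt {S : Finset (Sym2 (Fin n))} {e : Sym2 (Fin n)} (he : e ∈ S) {x : Fin n} (hx : x ∈ e) :
    x ∈ spt S := by
  simp only [spt, mem_filter, mem_univ, true_and]; exact ⟨e, he, hx⟩

lemma sym2_exists (e : Sym2 (Fin n)) : ∃ x, x ∈ e := by
  induction e using Sym2.ind with
  | _ a b => exact ⟨a, by simp⟩

lemma Dec_XX (hN : ∀ x ∈ U, ∃ y ∈ U, H.Adj x y) (hU : U.Nonempty) (z : Sym2 (Fin n) × Bool → Bool) :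
    Dec (bb ι) (EU H U) (XX H) z = ∑ i, PhiB H ι U p i z + PR H ι U p z := by
  have e : (XX H : (Sym2 (Fin n) → Bool) → ℝ) = fun x => ∑ S, aS H p S * mono p S x :=
    funext (XX_eq H p)
  rw [e, Dec_sum]
  unfold PhiB PR
  rw [← Finset.sum_biUnion, ← Finset.sum_union]
  · symm
    apply Finset.sum_subset (Finset.subset_univ _)
    intro S _ hS
    by_cases h1 : NS H S = 0
    · rw [aS_zero H p S h1, zero_mul]
    by_cases h2 : Mp H ι U S
    · exfalso
      apply hS
      simp only [mem_union, mem_biUnion, mem_univ, true_and, MB, MR, mem_filter]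
      by_cases h3 : ∃ i, spt S ⊆ VB ι i
      · obtain ⟨i, hi⟩ := h3
        exact Or.inl ⟨i, h1, h2, hi⟩
      · push Not at h3
        exact Or.inr ⟨h1, h2, h3⟩
    · unfold Mp at h2
      push Not at h2
      obtain ⟨f, hf, h⟩ := h2
      rw [Dec_mono_zero p (bb ι) (EU H U) S f hf h, mul_zero]
  · rw [Finset.disjoint_left]
    intro S hS hS'
    simp only [mem_biUnion, mem_univ, true_and, MB, MR, mem_filter] at hS hS'
    obtain ⟨i, hi⟩ := hS
    exact hS'.2.2 i hi.2.2
  · intro i _ j _ hij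
    simp only [Function.onFun]
    rw [Finset.disjoint_left]
    intro S hS hS'
    simp only [MB, mem_filter, mem_univ, true_and] at hS hS'
    obtain ⟨e, he⟩ := Mp_nonempty ι hN hU hS.2.1
    obtain ⟨x, hx⟩ := sym2_exists e
    exact Finset.disjoint_left.mp (VB_disj ι hij) (hS.2.2 (edge_spt he hx)) (hS'.2.2 (edge_spt he hx))

noncomputable def TB (i : Fin m) : Finset (Sym2 (Fin n) × Bool) :=
  Finset.univ.filter fun q => ∀ x ∈ q.1, x ∈ VB ι i

lemma TB_disj (i j : Fin m) (h : i ≠ j) : Disjoint (TB ι i) (TB ι j) := by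
  rw [Finset.disjoint_left]
  rintro ⟨e, b⟩ hi hj
  simp only [TB, mem_filter, mem_univ, true_and] at hi hj
  obtain ⟨x, hx⟩ := sym2_exists e
  exact Finset.disjoint_left.mp (VB_disj ι h) (hi x hx) (hj x hx)

lemma PhiB_dep (i : Fin m) : DependsOn (PhiB H ι U p i) (TB ι i : Set (Sym2 (Fin n) × Bool)) := by
  intro x y hxy
  unfold PhiB
  refine Finset.sum_congr rfl fun S hS => ?_
  rw [Dec_mono, Dec_mono]
  congr 1
  refine Finset.sum_congr rfl fun η _ => ?_
  congr 1
  apply mono_dep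
  rintro ⟨e, b⟩ he
  apply hxy
  simp only [lft, coe_image, Set.mem_image, mem_coe, Prod.mk.injEq] at he
  obtain ⟨e', he', rfl, _⟩ := he
  simp only [TB, coe_filter, mem_univ, true_and, Set.mem_ofPred_eq]
  simp only [MB, mem_filter, mem_univ, true_and] at hS
  intro x hx
  exact hS.2.2 (edge_spt he' hx)

lemma PhiB_mean (hN : ∀ x ∈ U, ∃ y ∈ U, H.Adj x y) (hU : U.Nonempty) (i : Fin m) :
    Ex p (PhiB H ι U p i) = 0 := by
  have : PhiB H ι U p i = fun z => ∑ S ∈ MB H ι U i, aS H p S * Dec (bb ι) (EU H U) (mono p S) z := rfl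
  rw [this, Ex_sum]
  refine Finset.sum_eq_zero fun S hS => ?_
  rw [Ex_mul_left]
  have h2 : Dec (bb ι) (EU H U) (mono p S) = fun z => ∑ η ∈ (EU H U).powerset,
    (-1 : ℝ) ^ η.card * mono p (lft (bb ι) S η) z := funext (Dec_mono p _ _ S)
  rw [h2, Ex_sum, Finset.sum_eq_zero, mul_zero]
  intro η _
  rw [Ex_mul_left, Ex_mono_zero, mul_zero]
  simp only [MB, mem_filter, mem_univ, true_and] at hS
  exact (Mp_nonempty ι hN hU hS.2.1).image _

variable {p}

lemma EU_card_le : (EU H U).card ≤ (HE H).card := Finset.card_le_card (Finset.filter_subset _ _)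

lemma Rep_aux (h0 : 0 ≤ p) (h1 : p ≤ 1) (T : Finset (Finset (Sym2 (Fin n))))
    (hT : ∀ S ∈ T, NS H S ≠ 0) : ∃ A, A ≤ 2 ^ (HE H).card * (2 ^ (HE H).card * 2 ^ Fintype.card β * (n : ℝ) ^ Fintype.card β) ∧
    Rep (HE H).card A (fun z => ∑ S ∈ T, aS H p S * Dec (bb ι) (EU H U) (mono p S) z) := by
  refine ⟨_, ?_, Rep.DecLC h0 h1 (bb ι) (EU H U) (HE H).card T (aS H p)
    (fun S hS => card_le_of_NS H S (hT S hS))⟩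
  have h2 := sum_aS_le H h0 h1 T
  have h3 : 0 ≤ ∑ S ∈ T, |aS H p S| := Finset.sum_nonneg fun _ _ => abs_nonneg _
  gcongr
  · norm_num
  · first | exact EU_card_le (H := H) (U := U) | exact Finset.filter_subset _ _

lemma Rep_weaken {J : Type*} [Fintype J] {d : ℕ} {A B : ℝ} {f : (J → Bool) → ℝ} (h : Rep d A f)
    (hAB : A ≤ B) : Rep d B f := by
  have h2 : Rep d (B - A) (fun _ : J → Bool => (0 : ℝ)) :=
    Rep.base _ _ ∅ (by simp) (fun _ _ _ => rfl) (by intro; simpa using hAB)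
  have := Rep.add _ _ _ _ h h2
  simpa using this

lemma PhiB_rep (h0 : 0 ≤ p) (h1 : p ≤ 1) (i : Fin m) : Rep (HE H).card
    (2 ^ (HE H).card * (2 ^ (HE H).card * 2 ^ Fintype.card β * (n : ℝ) ^ Fintype.card β))
    (PhiB H ι U p i) := by
  obtain ⟨A, hA, h⟩ := Rep_aux (H := H) (U := U) ι h0 h1 (MB H ι U i)
    (fun S hS => (Finset.mem_filter.mp hS).2.1)
  exact Rep_weaken h hA

lemma PR_rep (h0 : 0 ≤ p) (h1 : p ≤ 1) : Rep (HE H).card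
    (2 ^ (HE H).card * (2 ^ (HE H).card * 2 ^ Fintype.card β * (n : ℝ) ^ Fintype.card β))
    (PR H ι U p) := by
  obtain ⟨A, hA, h⟩ := Rep_aux (H := H) (U := U) ι h0 h1 (MR H ι U)
    (fun S hS => (Finset.mem_filter.mp hS).2.1)
  exact Rep_weaken h hA

variable (H) in
/-- upper constant -/
noncomputable def CH : ℝ := 2 ^ (HE H).card * ((Fintype.card β : ℝ) ^ Fintype.card β *
  2 ^ (HE H).card * 2 ^ Fintype.card β * (Fintype.card β : ℝ) ^ Fintype.card β)

lemma CH_aux (hv : 1 ≤ Fintype.card β) (T : Finset (Finset (Sym2 (Fin n)))) (q N : ℕ)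
    (h0 : 0 ≤ p) (h1 : p ≤ 1) (k : ℕ)
    (hq : ((∑ S ∈ T, aS H p S ^ 2 * (p * (1 - p)) ^ S.card) * (n : ℝ) ^ k ≤
      ((Fintype.card β : ℝ) ^ Fintype.card β * 2 ^ (HE H).card * 2 ^ Fintype.card β) *
      ((q : ℝ) ^ U.card * (n : ℝ) ^ (2 * Fintype.card β)))) (hqN : q ≤ Fintype.card β * N) :
    (2 ^ (EU H U).card * ∑ S ∈ T, aS H p S ^ 2 * (p * (1 - p)) ^ S.card) * (n : ℝ) ^ k ≤
      CH H * ((N : ℝ) ^ U.card * (n : ℝ) ^ (2 * Fintype.card β)) := by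
  have hs : 0 ≤ ∑ S ∈ T, aS H p S ^ 2 * (p * (1 - p)) ^ S.card :=
    Finset.sum_nonneg fun S _ => mul_nonneg (sq_nonneg _) (pow_nonneg (mul_nonneg h0 (by linarith)) _)
  have hqN' : (q : ℝ) ≤ Fintype.card β * N := by exact_mod_cast hqN
  have hv' : (1 : ℝ) ≤ Fintype.card β := by exact_mod_cast hv
  calc _ ≤ (2 ^ (HE H).card * ∑ S ∈ T, aS H p S ^ 2 * (p * (1 - p)) ^ S.card) * (n : ℝ) ^ k := by
        gcongr
        · norm_num
        · first | exact EU_card_le (H := H) (U := U) | exact Finset.filter_subset _ _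
    _ = 2 ^ (HE H).card * ((∑ S ∈ T, aS H p S ^ 2 * (p * (1 - p)) ^ S.card) * (n : ℝ) ^ k) := by ring
    _ ≤ 2 ^ (HE H).card * (((Fintype.card β : ℝ) ^ Fintype.card β * 2 ^ (HE H).card * 2 ^ Fintype.card β) *
      ((Fintype.card β * N : ℝ) ^ U.card * (n : ℝ) ^ (2 * Fintype.card β))) := by
        refine mul_le_mul_of_nonneg_left (hq.trans ?_) (by positivity)
        gcongr
    _ = 2 ^ (HE H).card * (((Fintype.card β : ℝ) ^ Fintype.card β * 2 ^ (HE H).card * 2 ^ Fintype.card β) *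
      ((Fintype.card β : ℝ) ^ U.card)) * ((N : ℝ) ^ U.card * (n : ℝ) ^ (2 * Fintype.card β)) := by
        rw [mul_pow]; ring
    _ ≤ _ := by
        unfold CH
        gcongr
        exact Finset.card_le_univ U

lemma PhiB_var (i : Fin m) : Ex p (fun z => PhiB H ι U p i z ^ 2) =
    2 ^ (EU H U).card * ∑ S ∈ MB H ι U i, aS H p S ^ 2 * (p * (1 - p)) ^ S.card :=
  Dec_parseval p (bb ι) (EU H U) _ _ fun _ hS => (Finset.mem_filter.mp hS).2.2.1

lemma PR_var : Ex p (fun z => PR H ι U p z ^ 2) =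
    2 ^ (EU H U).card * ∑ S ∈ MR H ι U, aS H p S ^ 2 * (p * (1 - p)) ^ S.card :=
  Dec_parseval p (bb ι) (EU H U) _ _ fun _ hS => (Finset.mem_filter.mp hS).2.2.1

lemma PhiB_upper (h0 : 0 ≤ p) (h1 : p ≤ 1) (hv : 1 ≤ Fintype.card β) (hn : 1 ≤ n)
    (hN : ∀ x ∈ U, ∃ y ∈ U, H.Adj x y) (i : Fin m) :
    Ex p (fun z => PhiB H ι U p i z ^ 2) * (n : ℝ) ^ (U.card + U.card) ≤
      CH H * ((l : ℝ) ^ U.card * (n : ℝ) ^ (2 * Fintype.card β)) := by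
  rw [PhiB_var]
  have hc : ∀ S ∈ MB H ι U i, U.card ≤ (spt S).card := fun S hS =>
    (Mp_card ι hN (Finset.mem_filter.mp hS).2.2.1).trans (Finset.card_le_card Finset.inter_subset_left)
  refine CH_aux hv _ (VB ι i).card l h0 h1 _ ?_ (VB_card ι i)
  refine sum_aS_sq_le H h0 h1 hv hn _ (VB ι i) U.card U.card ?_ (fun S hS _ => hc S hS)
  intro S hS _
  rw [Finset.inter_eq_left.mpr (Finset.mem_filter.mp hS).2.2.2]
  exact hc S hS

lemma PR_upper (h0 : 0 ≤ p) (h1 : p ≤ 1) (hv : 1 ≤ Fintype.card β) (hn : 1 ≤ n)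
    (hN : ∀ x ∈ U, ∃ y ∈ U, H.Adj x y) (hU : U.Nonempty)
    (hC : ∀ {τ : Type} (g : β → τ), (∀ x ∈ U, ∀ y ∈ U, H.Adj x y → g x = g y) →
        ∀ x ∈ U, ∀ y ∈ U, g x = g y) :
    Ex p (fun z => PR H ι U p z ^ 2) * (n : ℝ) ^ (U.card + 1 + U.card) ≤
      CH H * (((m * l : ℕ) : ℝ) ^ U.card * (n : ℝ) ^ (2 * Fintype.card β)) := by
  rw [PR_var]
  refine CH_aux hv _ (Finset.univ.image ι).card (m * l) h0 h1 _ ?_ ?_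
  · refine sum_aS_sq_le H h0 h1 hv hn _ (Finset.univ.image ι) U.card (U.card + 1) ?_ ?_
    · intro S hS _
      exact Mp_card ι hN (Finset.mem_filter.mp hS).2.2.1
    · intro S hS _
      have := (Finset.mem_filter.mp hS).2.2
      exact Mp_multi ι hN this.1 hU hC this.2
  · refine Finset.card_image_le.trans (le_of_eq ?_)
    simp; ring

noncomputable def FW (i : Fin m) (hl : 0 < l) (w : U → Fin l) (x : β) : Fin n :=
  ι (i, x, if h : x ∈ U then w ⟨x, h⟩ else ⟨0, hl⟩)

lemma FW_inj (i : Fin m) (hl : 0 < l) (w : U → Fin l) : Function.Injective (FW ι i hl w) := by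
  intro x y h
  have := ι.injective h
  simp at this
  exact this.1

lemma spt_FW (hN : ∀ x ∈ U, ∃ y ∈ U, H.Adj x y) (f : β → Fin n) (x : β) (hx : x ∈ U) :
    f x ∈ spt ((EU H U).image (Sym2.map f)) := by
  obtain ⟨y, hy, h⟩ := hN x hx
  refine edge_spt (e := Sym2.map f s(x, y)) (Finset.mem_image_of_mem _ ?_) (by simp)
  simp only [EU, HE, mem_filter, mem_univ, true_and, SimpleGraph.mem_edgeSet, h, Sym2.mem_iff]
  rintro a (rfl | rfl) <;> assumption

lemma spt_FW' (f : β → Fin n) (y : Fin n)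
    (hy : y ∈ spt ((EU H U).image (Sym2.map f))) : ∃ x ∈ U, f x = y := by
  simp only [spt, EU, mem_filter, mem_univ, true_and, mem_image, exists_exists_and_eq_and] at hy
  obtain ⟨e, he, hy⟩ := hy
  obtain ⟨x, hx, rfl⟩ := Sym2.mem_map.mp hy
  exact ⟨x, he.2 x hx, rfl⟩

lemma FW_mem (hiso : ∀ x : β, ∃ y, H.Adj x y) (hn : Fintype.card β ≤ n) (hv : 1 ≤ Fintype.card β)
    (i : Fin m) (hl : 0 < l) (w : U → Fin l) :
    (EU H U).image (Sym2.map (FW ι i hl w)) ∈ MB H ι U i := by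
  simp only [MB, mem_filter, mem_univ, true_and]
  refine ⟨?_, ?_, ?_⟩
  · intro h
    have := ext_count H hiso hn hv U (FW ι i hl w) (FW_inj ι i hl w).injOn
    rw [h] at this
    simp at this
    omega
  · intro f hf
    refine ⟨_, Finset.mem_image_of_mem _ hf, ?_⟩
    rw [bb_iff]
    refine ⟨i, ?_⟩
    rw [Sym2.map_map]
    congr 1
    funext x
    exact col_ι ι i x _
  · intro y hy
    obtain ⟨x, hx, rfl⟩ := spt_FW' _ y hy
    rw [mem_VB]
    exact ⟨x, col_ι ι i x _⟩

lemma PhiB_lower {lam : ℝ} (hlam : 0 < lam) (hp : lam ≤ p) (hp1 : p ≤ 1 - lam)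
    (hiso : ∀ x : β, ∃ y, H.Adj x y) (hn : Fintype.card β ≤ n) (hv : 1 ≤ Fintype.card β)
    (hN : ∀ x ∈ U, ∃ y ∈ U, H.Adj x y) (i : Fin m) (hl : 0 < l) :
    (l : ℝ) ^ U.card * (n : ℝ) ^ (2 * Fintype.card β) ≤
    (((Fintype.card β : ℝ) ^ Fintype.card β) ^ 4 / lam ^ (4 * (HE H).card)) *
     (Ex p (fun z => PhiB H ι U p i z ^ 2) * (n : ℝ) ^ (U.card + U.card)) := by
  set v := Fintype.card β with hvv
  set e := (HE H).card with he
  set V : ℝ := (v : ℝ) ^ v with hV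
  have h1 : p ≤ 1 := by linarith
  have h0 : 0 ≤ p := by linarith
  have hn1 : 0 < n := by omega
  have hn0 : (0 : ℝ) < (n : ℝ) := by exact_mod_cast hn1
  have hV0 : 0 < V := by have : (0 : ℝ) < v := by exact_mod_cast hv
                         positivity
  have hvar : lam ^ 2 ≤ p * (1 - p) := by rw [sq]; gcongr; linarith
  set I := (Finset.univ : Finset (U → Fin l)).image
    (fun w => (EU H U).image (Sym2.map (FW ι i hl w))) with hI
  have hIc : I.card = l ^ U.card := by
    rw [hI, Finset.card_image_of_injective]
    · simp
    · intro w w' h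
      funext ⟨x, hx⟩
      have h2 := spt_FW hN (FW ι i hl w) x hx
      simp only at h
      rw [h] at h2
      obtain ⟨x', hx', h3⟩ := spt_FW' _ _ h2
      have := ι.injective h3
      simp only [Prod.mk.injEq, true_and] at this
      obtain ⟨rfl, h4⟩ := this
      simp only [dif_pos hx] at h4
      exact h4.symm
  have hterm : ∀ S ∈ I, lam ^ (4 * e) * ((n : ℝ) ^ (2 * v) / (V ^ 4 * (n : ℝ) ^ (U.card + U.card))) ≤
      aS H p S ^ 2 * (p * (1 - p)) ^ S.card := by
    intro S hS
    obtain ⟨w, _, rfl⟩ := Finset.mem_image.mp hS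
    set S := (EU H U).image (Sym2.map (FW ι i hl w))
    have a := le_aS H hlam.le hp h1 S
    have b := ext_count H hiso hn hv U (FW ι i hl w) (FW_inj ι i hl w).injOn
    have b' : (n : ℝ) ^ v ≤ V * (V * NS H S) * (n : ℝ) ^ U.card := by
      rw [hV]; exact_mod_cast b
    have hSc : S.card ≤ e := Finset.card_image_le.trans EU_card_le
    have c : lam ^ (2 * e) ≤ (p * (1 - p)) ^ S.card := by
      calc lam ^ (2 * e) = (lam ^ 2) ^ e := by rw [pow_mul]
        _ ≤ (lam ^ 2) ^ S.card := by
            apply pow_le_pow_of_le_one (by positivity) _ hSc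
            nlinarith
        _ ≤ _ := by gcongr
    have d : (n : ℝ) ^ (2 * v) / (V ^ 4 * (n : ℝ) ^ (U.card + U.card)) ≤ (NS H S : ℝ) ^ 2 := by
      rw [div_le_iff₀ (by positivity)]
      calc (n : ℝ) ^ (2 * v) = ((n : ℝ) ^ v) ^ 2 := by rw [← pow_mul, mul_comm]
        _ ≤ (V * (V * NS H S) * (n : ℝ) ^ U.card) ^ 2 := by gcongr
        _ = _ := by rw [pow_add]; ring
    calc lam ^ (4 * e) * ((n : ℝ) ^ (2 * v) / (V ^ 4 * (n : ℝ) ^ (U.card + U.card))) ≤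
          lam ^ (4 * e) * (NS H S : ℝ) ^ 2 := by gcongr
      _ = (lam ^ e * NS H S) ^ 2 * lam ^ (2 * e) := by ring
      _ ≤ _ := by gcongr
  have hsum : (l : ℝ) ^ U.card * (lam ^ (4 * e) * ((n : ℝ) ^ (2 * v) / (V ^ 4 * (n : ℝ) ^ (U.card + U.card))))
      ≤ Ex p (fun z => PhiB H ι U p i z ^ 2) := by
    rw [PhiB_var]
    have q1 := Finset.card_nsmul_le_sum I _ _ hterm
    rw [hIc, nsmul_eq_mul] at q1
    push_cast at q1
    have nn : ∀ S : Finset (Sym2 (Fin n)), 0 ≤ aS H p S ^ 2 * (p * (1 - p)) ^ S.card := fun S =>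
      mul_nonneg (sq_nonneg _) (pow_nonneg (mul_nonneg h0 (by linarith)) _)
    have q2 : ∑ S ∈ I, aS H p S ^ 2 * (p * (1 - p)) ^ S.card ≤
        ∑ S ∈ MB H ι U i, aS H p S ^ 2 * (p * (1 - p)) ^ S.card := by
      apply Finset.sum_le_sum_of_subset_of_nonneg
      · intro S hS
        obtain ⟨w, _, rfl⟩ := Finset.mem_image.mp hS
        exact FW_mem ι hiso hn hv i hl w
      · intro S _ _; exact nn S
    refine (q1.trans q2).trans (le_mul_of_one_le_left (Finset.sum_nonneg fun S _ => nn S) ?_)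
    exact one_le_pow₀ (by norm_num)
  calc _ = (V ^ 4 / lam ^ (4 * e)) * (((l : ℝ) ^ U.card * (lam ^ (4 * e) * ((n : ℝ) ^ (2 * v) / (V ^ 4 * (n : ℝ) ^ (U.card + U.card))))) * (n : ℝ) ^ (U.card + U.card)) := by
        field_simp
    _ ≤ _ := by gcongr

/-- for `l = 1`, `U = univ` the blocks are Dec of a single monomial -/
lemma Dec_prod {I F : Type*} [Fintype I] [DecidableEq I] [DecidableEq F] (b : I → Option F)
    (A : Finset F) (φ : F → I) (hφ : ∀ f ∈ A, b (φ f) = some f) (q : ℝ) (z : I × Bool → Bool) :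
    Dec b A (mono q (A.image φ)) z =
      ∏ f ∈ A, (-(xi q (z (φ f, true))) + xi q (z (φ f, false))) := by
  rw [Finset.prod_add]
  unfold Dec
  refine Finset.sum_congr rfl fun η hη => ?_
  have hηA := Finset.mem_powerset.mp hη
  have hinj : Set.InjOn φ A := by
    intro f hf g hg h
    have := hφ f hf
    rw [h, hφ g hg] at this
    simpa using this.symm
  unfold mono
  rw [Finset.prod_image hinj, Finset.prod_neg, mul_assoc]
  congr 1
  rw [← Finset.prod_sdiff hηA, mul_comm]
  congr 1
  · refine Finset.prod_congr rfl fun f hf => ?_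
    have : pk b η (φ f) = true := by simp [pk, hφ f (hηA hf), hf]
    simp only [this]
  · refine Finset.prod_congr rfl fun f hf => ?_
    obtain ⟨h1, h2⟩ := Finset.mem_sdiff.mp hf
    have : pk b η (φ f) = false := by simp [pk, hφ f h1, h2]
    simp only [this]

end BS
end SCL

namespace SCL
open Finset
open scoped Classical

section PGs
variable {β : Type*} [Fintype β] {H : SimpleGraph β} {n m : ℕ} {p : ℝ}

lemma MB_special (ι : Fin m × β × Fin 1 ↪ Fin n) (hiso : ∀ x : β, ∃ y, H.Adj x y)
    (hn : Fintype.card β ≤ n) (hv : 1 ≤ Fintype.card β) (i : Fin m) :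
    MB H ι Finset.univ i = {cp H (fun x => ι (i, x, 0))} := by
  have hinj : Function.Injective (fun x => ι (i, x, 0)) := by
    intro x y h
    have := ι.injective h
    simpa using this
  have hEU : EU H Finset.univ = HE H := by
    unfold EU; simp
  ext S
  rw [Finset.mem_singleton]
  constructor
  · intro hS
    simp only [MB, mem_filter, mem_univ, true_and] at hS
    obtain ⟨h1, h2, h3⟩ := hS
    symm
    apply Finset.eq_of_subset_of_card_le
    · intro e he
      obtain ⟨f, hf, rfl⟩ := Finset.mem_image.mp he
      obtain ⟨e, he, hb⟩ := h2 f (by rw [hEU]; exact hf)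
      have hV : ∀ x ∈ e, x ∈ VB ι i := fun x hx => h3 (edge_spt he hx)
      obtain ⟨j, hj⟩ := (bb_iff ι _ _).mp hb
      convert he using 1
      induction e using Sym2.ind with
      | _ a b =>
        obtain ⟨x, hx⟩ := (mem_VB ι).mp (hV a (by simp))
        obtain ⟨y, hy⟩ := (mem_VB ι).mp (hV b (by simp))
        rw [Sym2.map_mk, hx, hy] at hj
        obtain ⟨kx, hkx⟩ := col_some ι hx
        obtain ⟨ky, hky⟩ := col_some ι hy
        have e1 : kx = 0 := Subsingleton.elim _ _
        have e2 : ky = 0 := Subsingleton.elim _ _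
        subst e1 e2
        have hij : i = j := by
          have : some (i, x) ∈ Sym2.map (fun x => some (j, x)) f := by rw [← hj]; simp
          obtain ⟨w, _, hw⟩ := Sym2.mem_map.mp this
          simp at hw
          exact hw.1.symm
        subst hij
        have : s(x, y) = f := by
          have hi : Function.Injective (fun x : β => some (i, x)) := by
            intro a b h; simpa using h
          apply Sym2.map.injective hi
          rw [← hj, Sym2.map_mk]
        rw [← this, Sym2.map_mk, ← hkx, ← hky]
    · rw [cp_card H _ hinj]
      exact card_le_of_NS H S h1
  · rintro rfl
    have := FW_mem (U := Finset.univ) ι hiso hn hv i one_pos (fun _ => 0)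
    rw [hEU] at this
    convert this using 1
    unfold cp
    congr 2
    funext x
    simp [FW]

lemma aS_special (f : β ↪ Fin n) : aS H p (cp H f) = 1 := by
  unfold aS
  have : (copies H n).filter (fun E => cp H f ⊆ E) = {cp H f} := by
    ext E
    simp only [mem_filter, mem_singleton]
    constructor
    · rintro ⟨h1, h2⟩
      symm
      apply Finset.eq_of_subset_of_card_le h2
      rw [copies_card H h1, cp_card H f f.injective]
    · rintro rfl
      exact ⟨Finset.mem_image.mpr ⟨f, by simp, rfl⟩, subset_rfl⟩
  rw [this]; simp

lemma special_cf {lam : ℝ} (hlam : 0 < lam) (hp : lam ≤ p) (hp1 : p ≤ 1 - lam)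
    (ι : Fin m × β × Fin 1 ↪ Fin n) (hiso : ∀ x : β, ∃ y, H.Adj x y)
    (hn : Fintype.card β ≤ n) (hv : 1 ≤ Fintype.card β) (i : Fin m) (θ c0 : ℝ) (hc0 : 0 ≤ c0)
    (hθ : c0 ≤ |θ|) (hθ2 : |θ| ≤ Real.pi) :
    ‖Ex p (fun z => Complex.exp ((θ * PhiB H ι Finset.univ p i z : ℝ) * Complex.I))‖ ≤
      1 - 2 / Real.pi ^ 2 * c0 ^ 2 * (2 * lam ^ 2) ^ (HE H).card := by
  have h0 : 0 ≤ p := by linarith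
  have h1 : p ≤ 1 := by linarith
  have hinj : Function.Injective (fun x => ι (i, x, 0)) := by
    intro x y h
    have := ι.injective h
    simpa using this
  have hEU : EU H Finset.univ = HE H := by
    unfold EU; simp
  have hU : (Finset.univ : Finset β).Nonempty := by
    rw [← Finset.card_pos, Finset.card_univ]; omega
  have hN : ∀ x ∈ (Finset.univ : Finset β), ∃ y ∈ (Finset.univ : Finset β), H.Adj x y := by
    intro x _; obtain ⟨y, h⟩ := hiso x; exact ⟨y, by simp, h⟩
  have haS : aS H p (cp H (fun x => ι (i, x, 0))) = 1 := aS_special (H := H) (p := p) ⟨_, hinj⟩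
  set Φ := PhiB H ι Finset.univ p i with hΦ
  have hval : ∀ z, Φ z = 0 ∨ Φ z = 1 ∨ Φ z = -1 := by
    intro z
    rw [hΦ]
    unfold PhiB
    rw [MB_special ι hiso hn hv i, Finset.sum_singleton, haS, one_mul, hEU]
    unfold cp
    rw [Dec_prod (bb ι) (HE H) (Sym2.map fun x => ι (i, x, 0))]
    · refine Finset.prod_induction _ (fun t : ℝ => t = 0 ∨ t = 1 ∨ t = -1) ?_ (by simp) ?_
      · rintro a b (rfl | rfl | rfl) (rfl | rfl | rfl) <;> simp
      · intro f _
        cases z (Sym2.map (fun x => ι (i, x, 0)) f, true) <;>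
          cases z (Sym2.map (fun x => ι (i, x, 0)) f, false) <;> simp [xi]
        right; right; ring
    · intro f hf
      rw [bb_iff]
      refine ⟨i, ?_⟩
      rw [Sym2.map_map]
      congr 1
      funext x
      exact col_ι ι i x _
  have hmean : Ex p Φ = 0 := PhiB_mean ι p hN hU i
  set q := (2 * (p * (1 - p))) ^ (HE H).card with hq
  have hvar : Ex p (fun z => Φ z ^ 2) = q := by
    rw [hΦ, PhiB_var, MB_special ι hiso hn hv i, Finset.sum_singleton, haS, hEU, cp_card H _ hinj, hq, mul_pow 2]
    ring
  have hvarl : lam ^ 2 ≤ p * (1 - p) := by rw [sq]; gcongr; linarith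
  have hq1 : (2 * lam ^ 2) ^ (HE H).card ≤ q := by rw [hq]; gcongr
  have hHE : 1 ≤ (HE H).card := by
    rw [← hEU]; exact Finset.card_pos.mpr (EU_nonempty hN hU)
  have hvq : p * (1 - p) ≤ 1 / 4 := by nlinarith [sq_nonneg (p - 1 / 2)]
  have hq2 : q ≤ 1 / 2 := by
    calc q ≤ (1 / 2) ^ (HE H).card := by rw [hq]; gcongr; linarith
      _ ≤ (1 / 2) ^ 1 := pow_le_pow_of_le_one (by norm_num) (by norm_num) hHE
      _ = _ := by norm_num
  have hq0 : 0 ≤ q := le_trans (by positivity) hq1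
  have e : ∀ z, Complex.exp ((θ * Φ z : ℝ) * Complex.I) =
      (1 : ℂ) - ((1 - Real.cos θ : ℝ) : ℂ) * ((Φ z ^ 2 : ℝ) : ℂ) + Complex.I * (Real.sin θ : ℂ) * ((Φ z : ℝ) : ℂ) := by
    intro z
    rw [Complex.exp_mul_I, ← Complex.ofReal_cos, ← Complex.ofReal_sin]
    rcases hval z with h | h | h <;> rw [h] <;> simp <;> ring
  have hE : Ex p (fun z => Complex.exp ((θ * Φ z : ℝ) * Complex.I)) = ((1 - (1 - Real.cos θ) * q : ℝ) : ℂ) := by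
    simp only [e]
    rw [Ex_add, Ex_sub, Ex_mul_left, Ex_mul_left, Ex_const, Ex_ofReal, Ex_ofReal, hvar, hmean]
    push_cast; ring
  rw [hE, Complex.norm_real, Real.norm_eq_abs, _root_.abs_of_nonneg]
  · have := Real.cos_le_one_sub_mul_cos_sq hθ2
    have hsq : c0 ^ 2 ≤ θ ^ 2 := by rw [← sq_abs θ]; gcongr
    have hpi := Real.pi_pos
    have h3 : 2 / Real.pi ^ 2 * c0 ^ 2 ≤ 1 - Real.cos θ := by
      have : 2 / Real.pi ^ 2 * c0 ^ 2 ≤ 2 / Real.pi ^ 2 * θ ^ 2 := by gcongr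
      linarith
    have : 2 / Real.pi ^ 2 * c0 ^ 2 * (2 * lam ^ 2) ^ (HE H).card ≤ (1 - Real.cos θ) * q :=
      mul_le_mul h3 hq1 (by positivity) (by linarith [Real.cos_le_one θ])
    linarith
  · have := Real.neg_one_le_cos θ
    have := Real.cos_le_one θ
    nlinarith
end PGs
end SCL

namespace SCL
open Finset
open scoped Classical

section PHs
variable {β : Type*} [Fintype β] {H : SimpleGraph β}

lemma norm_cf_le {J : Type*} [Fintype J] [DecidableEq J] {p : ℝ} (h0 : 0 ≤ p) (h1 : p ≤ 1) (f : (J → Bool) → ℝ) :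
    ‖Ex p (fun x => Complex.exp ((f x : ℝ) * Complex.I))‖ ≤ 1 :=
  norm_Ex_le_of h0 h1 _ fun x => by rw [Complex.norm_exp_ofReal_mul_I]

lemma geom_bdd (ρ : ℝ) (h0 : 0 < ρ) (h1 : ρ < 1) (T q : ℕ) :
    ∃ C : ℝ, 0 < C ∧ ∀ m : ℕ, (m : ℝ) ^ T * ρ ^ (m - q) ≤ C := by
  have h := (tendsto_pow_const_mul_const_pow_of_lt_one T h0.le h1).bddAbove_range
  obtain ⟨C, hC⟩ := h
  have hC' : ∀ m : ℕ, (m : ℝ) ^ T * ρ ^ m ≤ C := fun m => hC ⟨m, rfl⟩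
  refine ⟨(|C| + 1) / ρ ^ q, by positivity, fun m => ?_⟩
  rw [le_div_iff₀ (by positivity)]
  calc (m : ℝ) ^ T * ρ ^ (m - q) * ρ ^ q = (m : ℝ) ^ T * ρ ^ (m - q + q) := by rw [pow_add]; ring
    _ ≤ (m : ℝ) ^ T * ρ ^ m := by
        gcongr (m : ℝ) ^ T * ?_
        exact pow_le_pow_of_le_one h0.le h1.le (by omega)
    _ ≤ C := hC' m
    _ ≤ _ := by linarith [le_abs_self C]

lemma mid_core {lam : ℝ} (hlam : 0 < lam) (hlam2 : lam < 1 / 2) (ρ C1 D : ℝ) (hρ : 0 < ρ) (hρ1 : ρ < 1)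
    (hC1 : 0 ≤ C1) (hD : 0 ≤ D) (r : ℕ) (hv : 1 ≤ Fintype.card β) :
    ∃ C : ℝ, 0 < C ∧ ∀ (n m l : ℕ) (p θ : ℝ) (ι : Fin m × β × Fin l ↪ Fin n) (U : Finset β),
      lam ≤ p → p ≤ 1 - lam → 1 ≤ n → (∀ x ∈ U, ∃ y ∈ U, H.Adj x y) → U.Nonempty →
      |θ| ≤ Real.pi → 1 ≤ |θ| * (n : ℝ) ^ Fintype.card β → (n : ℝ) ≤ D * (m : ℝ) ^ r →
      (∀ i, ‖Ex p (fun z => Complex.exp ((θ * PhiB H ι U p i z : ℝ) * Complex.I))‖ ≤ ρ) →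
      (θ ^ 2 * Ex p (fun z => PR H ι U p z ^ 2)) ^ 2 * n ≤ C1 →
      ‖Ex p (fun x : Sym2 (Fin n) → Bool => Complex.exp ((θ * XX H x : ℝ) * Complex.I))‖ * (n : ℝ) ^ Fintype.card β ≤ C := by
  set v := Fintype.card β with hvd
  set e := (HE H).card with he
  set M := v * 2 ^ e with hM
  obtain ⟨j, hj⟩ : ∃ j : ℕ, M ≤ 2 ^ j := ⟨M, Nat.lt_two_pow_self.le⟩
  set K := 2 ^ (j + 1 + 1) with hK
  obtain ⟨Cb, hCb, hbon⟩ := bonami_pow hlam hlam2 e (j + 1)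
  obtain ⟨Cg, hCg, hgeom⟩ := geom_bdd ρ hρ hρ1 (r * (v * K + M)) (K * e)
  set A0 : ℝ := 2 ^ e * (2 ^ e * 2 ^ v) with hA0
  have hA01 : 1 ≤ A0 := by
    have h1 : (1 : ℝ) ≤ 2 ^ e := one_le_pow₀ (by norm_num)
    have h2 : (1 : ℝ) ≤ 2 ^ v := one_le_pow₀ (by norm_num)
    rw [hA0]; nlinarith [mul_le_mul h1 h2 (by norm_num) (by positivity)]
  set C : ℝ := K * (Real.pi * A0) ^ K * (D ^ (v * K + M) * Cg) + (K + 1) * (Cb * C1 ^ (2 ^ j)) + 1 with hC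
  have hpi := Real.pi_pos
  have hC0 : 1 ≤ C := by
    rw [hC]
    have : 0 ≤ (K : ℝ) * (Real.pi * A0) ^ K * (D ^ (v * K + M) * Cg) + (K + 1) * (Cb * C1 ^ (2 ^ j)) := by positivity
    linarith
  refine ⟨C, by linarith, ?_⟩
  intro n m l p θ ι U hp hp1 hn hN hU hθ hθ1 hnm hcf hPR
  have h0 : 0 ≤ p := by linarith
  have h1 : p ≤ 1 := by linarith
  have hn1 : (1 : ℝ) ≤ n := by exact_mod_cast hn
  set φ := ‖Ex p (fun x : Sym2 (Fin n) → Bool => Complex.exp ((θ * XX H x : ℝ) * Complex.I))‖ with hφ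
  have hφ1 : φ ≤ 1 := norm_cf_le h0 h1 _
  have hφ0 : 0 ≤ φ := norm_nonneg _
  have d1 := decouple h0 h1 (bb ι) (EU H U) (XX H) θ
  rw [← hφ] at d1
  have hrw : (fun z => Complex.exp ((θ * Dec (bb ι) (EU H U) (XX H) z : ℝ) * Complex.I)) =
      (fun z => Complex.exp ((θ * (∑ i, PhiB H ι U p i z + PR H ι U p z) : ℝ) * Complex.I)) := by
    funext z
    rw [Dec_XX ι p hN hU z]
  rw [hrw] at d1
  have hrep := PR_rep (H := H) (U := U) ι h0 h1
  have hA : 1 ≤ |θ| * (2 ^ e * (2 ^ e * 2 ^ v * (n : ℝ) ^ v)) := by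
    calc (1 : ℝ) ≤ A0 * (|θ| * (n : ℝ) ^ v) := by nlinarith
      _ = _ := by rw [hA0]; ring
  have d2 := block_full h0 h1 (fun i => PhiB H ι U p i) (TB ι) (PhiB_dep ι p) (TB_disj ι) θ
    hρ.le hρ1.le hcf hrep hA K Nat.one_le_two_pow (by rw [hK, pow_succ]; exact even_iff_two_dvd.mpr (dvd_mul_left _ _))
  have d3 : φ ^ (2 ^ e) ≤ φ ^ (2 ^ (EU H U).card) := by
    apply pow_le_pow_of_le_one hφ0 hφ1
    exact Nat.pow_le_pow_right (by norm_num) (EU_card_le (H := H) (U := U))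
  set Y := θ ^ 2 * Ex p (fun z => PR H ι U p z ^ 2) with hY
  have hY0 : 0 ≤ Y := mul_nonneg (sq_nonneg _) (Ex_nonneg h0 h1 fun z => sq_nonneg _)
  have t2 : |θ| ^ K * Ex p (fun x => PR H ι U p x ^ K) * (n : ℝ) ^ M ≤ Cb * C1 ^ (2 ^ j) := by
    have b := hbon _ p hp hp1 _ _ hrep
    calc |θ| ^ K * Ex p (fun x => PR H ι U p x ^ K) * (n : ℝ) ^ M
        ≤ |θ| ^ K * (Cb * Ex p (fun x => PR H ι U p x ^ 2) ^ (2 ^ (j + 1))) * (n : ℝ) ^ (2 ^ j) := by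
          have hE0 : 0 ≤ Ex p (fun x => PR H ι U p x ^ 2) := Ex_nonneg h0 h1 fun z => sq_nonneg _
          gcongr
      _ = Cb * (Y ^ 2 * n) ^ (2 ^ j) := by
          have : |θ| ^ K = (θ ^ 2) ^ (2 ^ (j + 1)) := by
            rw [← sq_abs, ← pow_mul, hK, pow_succ 2 (j + 1), mul_comm 2]
          rw [this, mul_pow _ (n : ℝ), ← pow_mul Y, ← pow_succ' 2 j, hY, mul_pow (θ ^ 2)]; ring
      _ ≤ _ := by gcongr
  have t1 : (|θ| * (2 ^ e * (2 ^ e * 2 ^ v * (n : ℝ) ^ v))) ^ K * ρ ^ (m - K * e) * (n : ℝ) ^ M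
      ≤ (Real.pi * A0) ^ K * (D ^ (v * K + M) * Cg) := by
    calc _ = (|θ| * A0) ^ K * ((n : ℝ) ^ (v * K + M) * ρ ^ (m - K * e)) := by
          rw [pow_add, pow_mul, hA0, mul_pow, mul_pow, mul_pow, mul_pow, mul_pow, mul_pow, mul_pow]; ring
      _ ≤ (Real.pi * A0) ^ K * ((D * (m : ℝ) ^ r) ^ (v * K + M) * ρ ^ (m - K * e)) := by gcongr
      _ = (Real.pi * A0) ^ K * (D ^ (v * K + M) * ((m : ℝ) ^ (r * (v * K + M)) * ρ ^ (m - K * e))) := by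
          rw [mul_pow D, ← pow_mul]; ring
      _ ≤ _ := by gcongr; exact hgeom m
  have key : (φ * (n : ℝ) ^ v) ^ (2 ^ e) ≤ C ^ (2 ^ e) := by
    calc (φ * (n : ℝ) ^ v) ^ (2 ^ e) = φ ^ (2 ^ e) * (n : ℝ) ^ M := by rw [mul_pow, ← pow_mul]
      _ ≤ (K * (|θ| * (2 ^ e * (2 ^ e * 2 ^ v * (n : ℝ) ^ v))) ^ K * ρ ^ (m - K * e) +
          (K + 1) * (|θ| ^ K * Ex p (fun x => PR H ι U p x ^ K))) * (n : ℝ) ^ M := by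
          gcongr
          exact d3.trans (d1.trans d2)
      _ = K * ((|θ| * (2 ^ e * (2 ^ e * 2 ^ v * (n : ℝ) ^ v))) ^ K * ρ ^ (m - K * e) * (n : ℝ) ^ M) +
          (K + 1) * (|θ| ^ K * Ex p (fun x => PR H ι U p x ^ K) * (n : ℝ) ^ M) := by ring
      _ ≤ K * ((Real.pi * A0) ^ K * (D ^ (v * K + M) * Cg)) + (K + 1) * (Cb * C1 ^ (2 ^ j)) := by gcongr
      _ ≤ C := by rw [hC]; linarith
      _ ≤ C ^ (2 ^ e) := le_self_pow₀ hC0 (by positivity)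
  exact (pow_le_pow_iff_left₀ (by positivity) (by linarith) (by positivity)).mp key

lemma pick_m (v r D1 : ℕ) (hv : 1 ≤ v) (hr : 2 * v ≤ r) (hD1 : 1 ≤ D1) (n l : ℕ) (hn : 1 ≤ n)
    (hl : l ^ r * n ≤ D1 * n ^ r) (hnD : v ^ r * D1 ≤ n) :
    ∃ m : ℕ, m * (v * l) ≤ n ∧ m ^ (2 * v) ≤ n ∧ n ≤ (v ^ r * D1 * 2 ^ r) * m ^ r := by
  set D2 := v ^ r * D1 with hD2
  have hD2' : 1 ≤ D2 := Nat.mul_pos (Nat.pow_pos hv) hD1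
  set m := Nat.findGreatest (fun m => D2 * m ^ r ≤ n) n with hm
  have h1 : D2 * m ^ r ≤ n := Nat.findGreatest_spec (P := fun m => D2 * m ^ r ≤ n) (m := 1) hn (by simpa using hnD)
  have hm1 : 1 ≤ m := Nat.le_findGreatest hn (by simpa using hnD)
  have h2 : n < D2 * (m + 1) ^ r := by
    by_contra hc
    push Not at hc
    have : m + 1 ≤ n := by
      calc m + 1 ≤ (m + 1) ^ r := Nat.le_self_pow (by omega) _
        _ ≤ D2 * (m + 1) ^ r := Nat.le_mul_of_pos_left _ hD2'
        _ ≤ n := hc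
    have := Nat.le_findGreatest (P := fun m => D2 * m ^ r ≤ n) this hc
    omega
  have hmr : m ^ r ≤ n := le_trans (Nat.le_mul_of_pos_left _ hD2') h1
  refine ⟨m, ?_, ?_, ?_⟩
  · rw [← Nat.pow_le_pow_iff_left (n := r) (by omega)]
    have : (m * (v * l)) ^ r * n ≤ n ^ r * n := by
      calc (m * (v * l)) ^ r * n = v ^ r * m ^ r * (l ^ r * n) := by rw [mul_pow, mul_pow]; ring
        _ ≤ v ^ r * m ^ r * (D1 * n ^ r) := Nat.mul_le_mul_left _ hl
        _ = n ^ r * (D2 * m ^ r) := by rw [hD2]; ring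
        _ ≤ _ := Nat.mul_le_mul_left _ h1
    exact Nat.le_of_mul_le_mul_right this hn
  · exact le_trans (Nat.pow_le_pow_right hm1 hr) hmr
  · calc n ≤ D2 * (m + 1) ^ r := h2.le
      _ ≤ D2 * (2 * m) ^ r := by gcongr; omega
      _ = _ := by rw [mul_pow]; ring
end PHs
end SCL

namespace SCL
open Finset
open scoped Classical

section PIs
variable {β : Type*} [Fintype β] {H : SimpleGraph β}

lemma CH_pos (hv : 1 ≤ Fintype.card β) : 0 < CH H := by
  unfold CH
  have : (0 : ℝ) < Fintype.card β := by exact_mod_cast hv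
  positivity

lemma emb_exists {m l n : ℕ} (h : m * (Fintype.card β * l) ≤ n) : Nonempty (Fin m × β × Fin l ↪ Fin n) := by
  apply Function.Embedding.nonempty_of_card_le
  simpa using h

lemma mid_step {lam : ℝ} (hlam : 0 < lam) (hlam2 : lam < 1 / 2) (ρ u2 : ℝ) (hρ : 0 < ρ) (hρ1 : ρ < 1)
    (hu2 : 0 ≤ u2) (r D1 : ℕ) (hv : 1 ≤ Fintype.card β) (hr : 2 * Fintype.card β ≤ r) (hD1 : 1 ≤ D1) :
    ∃ C : ℝ, 0 < C ∧ ∀ (n l : ℕ) (p θ : ℝ) (U : Finset β),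
      lam ≤ p → p ≤ 1 - lam → 1 ≤ n → (∀ x ∈ U, ∃ y ∈ U, H.Adj x y) → U.Nonempty →
      (∀ {τ : Type} (g : β → τ), (∀ x ∈ U, ∀ y ∈ U, H.Adj x y → g x = g y) →
        ∀ x ∈ U, ∀ y ∈ U, g x = g y) →
      |θ| ≤ Real.pi → 1 ≤ |θ| * (n : ℝ) ^ Fintype.card β →
      l ^ r * n ≤ D1 * n ^ r → Fintype.card β ^ r * D1 ≤ n →
      (l : ℝ) ^ U.card * (θ * (n : ℝ) ^ (Fintype.card β - U.card)) ^ 2 ≤ u2 →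
      (∀ (m : ℕ) (ι : Fin m × β × Fin l ↪ Fin n) i,
        ‖Ex p (fun z => Complex.exp ((θ * PhiB H ι U p i z : ℝ) * Complex.I))‖ ≤ ρ) →
      ‖Ex p (fun x : Sym2 (Fin n) → Bool => Complex.exp ((θ * XX H x : ℝ) * Complex.I))‖ *
        (n : ℝ) ^ Fintype.card β ≤ C := by
  set v := Fintype.card β with hvd
  obtain ⟨C, hC, h⟩ := mid_core (H := H) hlam hlam2 ρ ((CH H * u2) ^ 2) ((v ^ r * D1 * 2 ^ r : ℕ) : ℝ) hρ hρ1
    (sq_nonneg _) (Nat.cast_nonneg _) r hv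
  refine ⟨C, hC, ?_⟩
  intro n l p θ U hp hp1 hn hN hU hCU hθ hθ1 hl hnD hu hcf
  obtain ⟨m, hm1, hm2, hm3⟩ := pick_m v r D1 hv hr hD1 n l hn hl hnD
  obtain ⟨ι⟩ := emb_exists (β := β) hm1
  have h0 : 0 ≤ p := by linarith
  have h1 : p ≤ 1 := by linarith
  have hn0 : (0 : ℝ) < n := by exact_mod_cast hn
  have hsv : U.card ≤ v := Finset.card_le_univ U
  have hup := PR_upper ι h0 h1 hv hn hN hU hCU
  rw [← hvd] at hup
  have hE0 : 0 ≤ Ex p (fun x => PR H ι U p x ^ 2) := Ex_nonneg h0 h1 fun z => sq_nonneg _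
  have hm1' : 1 ≤ m := by
    by_contra hc
    have : m = 0 := by omega
    subst this
    rw [zero_pow (by omega)] at hm3
    omega
  have hm1r : (1 : ℝ) ≤ m := by exact_mod_cast hm1'
  have hCH := CH_pos (H := H) hv
  refine h n m l p θ ι U hp hp1 hn hN hU hθ hθ1 (by exact_mod_cast hm3) (hcf m ι) ?_
  set s := U.card with hs
  have key : θ ^ 2 * Ex p (fun x => PR H ι U p x ^ 2) * n ≤ CH H * u2 * (m : ℝ) ^ v := by
    have : (θ ^ 2 * Ex p (fun x => PR H ι U p x ^ 2) * n) * (n : ℝ) ^ (2 * s) ≤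
        (CH H * u2 * (m : ℝ) ^ v) * (n : ℝ) ^ (2 * s) := by
      calc (θ ^ 2 * Ex p (fun x => PR H ι U p x ^ 2) * n) * (n : ℝ) ^ (2 * s)
          = θ ^ 2 * (Ex p (fun x => PR H ι U p x ^ 2) * (n : ℝ) ^ (s + 1 + s)) := by ring
        _ ≤ θ ^ 2 * (CH H * (((m * l : ℕ) : ℝ) ^ s * (n : ℝ) ^ (2 * v))) := by gcongr
        _ = CH H * ((l : ℝ) ^ s * (θ * (n : ℝ) ^ (v - s)) ^ 2) * (m : ℝ) ^ s * (n : ℝ) ^ (2 * s) := by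
            have : 2 * v = (v - s) * 2 + 2 * s := by omega
            rw [this, pow_add, pow_mul]; push_cast; rw [mul_pow]; ring
        _ ≤ _ := by gcongr
    exact le_of_mul_le_mul_right this (by positivity)
  have k2 : (θ ^ 2 * Ex p (fun x => PR H ι U p x ^ 2) * n) ^ 2 ≤ (CH H * u2) ^ 2 * n := by
    calc _ ≤ (CH H * u2 * (m : ℝ) ^ v) ^ 2 := by gcongr
      _ = (CH H * u2) ^ 2 * (m : ℝ) ^ (2 * v) := by ring
      _ ≤ _ := by gcongr; exact_mod_cast hm2
  have k3 : ((θ ^ 2 * Ex p (fun x => PR H ι U p x ^ 2)) ^ 2 * n) * n ≤ (CH H * u2) ^ 2 * n := by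
    calc _ = (θ ^ 2 * Ex p (fun x => PR H ι U p x ^ 2) * n) ^ 2 := by ring
      _ ≤ _ := k2
  exact le_of_mul_le_mul_right k3 hn0

lemma pick_l (u1 t : ℝ) (s n : ℕ) (hs : 1 ≤ s) (hu1 : 0 < u1) (ht : 0 < t) (ht1 : t ^ 2 ≤ u1) :
    ∃ l : ℕ, 1 ≤ l ∧ (l : ℝ) ^ s * t ^ 2 ≤ u1 ∧ u1 < (2 : ℝ) ^ s * ((l : ℝ) ^ s * t ^ 2) := by
  set N := ⌈u1 / t ^ 2⌉₊ with hN
  have hN1 : 1 ≤ N := by rw [hN, Nat.one_le_ceil_iff]; positivity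
  set l := Nat.findGreatest (fun l => (l : ℝ) ^ s * t ^ 2 ≤ u1) N with hl
  have h1 : (l : ℝ) ^ s * t ^ 2 ≤ u1 :=
    Nat.findGreatest_spec (P := fun l : ℕ => (l : ℝ) ^ s * t ^ 2 ≤ u1) (m := 1) hN1 (by simpa using ht1)
  have hl1 : 1 ≤ l := Nat.le_findGreatest hN1 (by simpa using ht1)
  refine ⟨l, hl1, h1, ?_⟩
  have h2 : u1 < ((l + 1 : ℕ) : ℝ) ^ s * t ^ 2 := by
    by_contra hc
    push Not at hc
    have : l + 1 ≤ N := by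
      have h3 : ((l + 1 : ℕ) : ℝ) ≤ u1 / t ^ 2 := by
        rw [le_div_iff₀ (by positivity)]
        refine le_trans ?_ hc
        gcongr
        refine le_self_pow₀ ?_ (by omega)
        push_cast; linarith [Nat.cast_nonneg (α := ℝ) l]
      exact_mod_cast h3.trans (Nat.le_ceil _)
    have := Nat.le_findGreatest (P := fun l : ℕ => (l : ℝ) ^ s * t ^ 2 ≤ u1) this hc
    omega
  refine h2.trans_le ?_
  rw [← mul_assoc, ← mul_pow]
  gcongr
  push_cast
  have : (1 : ℝ) ≤ l := by exact_mod_cast hl1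
  linarith

theorem mid_range {lam : ℝ} (hlam : 0 < lam) (hlam2 : lam < 1 / 2) (hconn : H.Connected)
    (hv2 : 2 ≤ Fintype.card β) (q : ℕ) (hq : Fintype.card β ≤ q) (D0 : ℝ) (hD0 : 0 < D0) :
    ∃ C : ℝ, 0 < C ∧ ∀ (n : ℕ) (p θ : ℝ), lam ≤ p → p ≤ 1 - lam → Fintype.card β ≤ n →
      |θ| ≤ Real.pi → (n : ℝ) ≤ D0 * (|θ| * (n : ℝ) ^ (Fintype.card β - 1)) ^ (3 * q) →
      ‖Ex p (fun x : Sym2 (Fin n) → Bool => Complex.exp ((θ * XX H x : ℝ) * Complex.I))‖ *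
        (n : ℝ) ^ Fintype.card β ≤ C := by
  have hiso : ∀ x : β, ∃ y, H.Adj x y := by
    have : Nontrivial β := Fintype.one_lt_card_iff_nontrivial.mp (by omega)
    intro x
    exact hconn.preconnected.exists_adj_of_nontrivial x
  set v := Fintype.card β with hvd
  set e := (HE H).card with he
  set r := 3 * q with hr
  have hv1 : 1 ≤ v := by omega
  have hCH := CH_pos (H := H) hv1
  set B := ((4 / lam) ^ 2) ^ e with hB
  have hB0 : 0 < B := by positivity
  set u1 : ℝ := 1 / ((256 * B + 1) * CH H) with hu1
  have hu10 : 0 < u1 := by positivity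
  set c0 := Real.sqrt u1 with hc0
  have hc00 : 0 < c0 := Real.sqrt_pos.mpr hu10
  have hc0sq : c0 ^ 2 = u1 := Real.sq_sqrt hu10.le
  have hvr : (0 : ℝ) < v := by exact_mod_cast hv1
  set CL : ℝ := ((v : ℝ) ^ v) ^ 4 / lam ^ (4 * e) with hCL
  have hCL0 : 0 < CL := by positivity
  set κ := u1 / (2 ^ v * CL) with hκ
  have hκ0 : 0 < κ := by positivity
  have hpi := Real.pi_pos
  set ρ : ℝ := max (1 - κ / 4) (max (1 - 2 / Real.pi ^ 2 * c0 ^ 2 * (2 * lam ^ 2) ^ e) (1 / 2)) with hρ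
  have hρ0 : 0 < ρ := lt_of_lt_of_le (by norm_num) ((le_max_right _ _).trans (le_max_right _ _))
  have hρ1 : ρ < 1 := by
    have : 0 < 2 / Real.pi ^ 2 * c0 ^ 2 * (2 * lam ^ 2) ^ e := by positivity
    refine max_lt (by linarith) (max_lt (by linarith) (by norm_num))
  set D1 : ℕ := ⌈D0 * c0 ^ r⌉₊ + 1 with hD1
  obtain ⟨C, hC, hstep⟩ := mid_step (H := H) hlam hlam2 ρ (max u1 (Real.pi ^ 2)) hρ0 hρ1
    (hu10.le.trans (le_max_left _ _)) r D1 hv1 (by omega) (by omega)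
  set N0 : ℕ := v ^ r * D1 + ⌈D0⌉₊ with hN0
  refine ⟨C + (N0 : ℝ) ^ v, by positivity, ?_⟩
  intro n p θ hp hp1 hn hθ hθn
  have h0 : 0 ≤ p := by linarith
  have h1 : p ≤ 1 := by linarith
  have hn1 : 1 ≤ n := by omega
  have hn1r : (1 : ℝ) ≤ n := by exact_mod_cast hn1
  have hn0r : (0 : ℝ) < n := by linarith
  by_cases hnN : n < N0
  · have := norm_cf_le h0 h1 (fun x : Sym2 (Fin n) → Bool => θ * XX H x)
    calc _ ≤ 1 * (N0 : ℝ) ^ v := by gcongr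
      _ ≤ _ := by linarith
  push Not at hnN
  refine le_trans ?_ (le_add_of_nonneg_right (by positivity))
  have hnD : v ^ r * D1 ≤ n := by omega
  have hnD0 : D0 ≤ n := by
    have : ⌈D0⌉₊ ≤ n := by omega
    exact Nat.ceil_le.mp this
  have hT1 : 1 ≤ |θ| * (n : ℝ) ^ (v - 1) := by
    by_contra hc
    push Not at hc
    have : (|θ| * (n : ℝ) ^ (v - 1)) ^ r < 1 := pow_lt_one₀ (by positivity) hc (by omega)
    have : D0 * (|θ| * (n : ℝ) ^ (v - 1)) ^ r < D0 * 1 := by gcongr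
    linarith
  have hθ1 : 1 ≤ |θ| * (n : ℝ) ^ v := hT1.trans (by gcongr; exact Nat.sub_le _ _)
  have hθ0 : 0 < |θ| := by
    by_contra hc
    have : |θ| = 0 := le_antisymm (not_lt.mp hc) (abs_nonneg _)
    rw [this, zero_mul] at hθ1; linarith
  have hnr : n ≤ n ^ r := Nat.le_self_pow (by omega) _
  by_cases hcase : c0 ≤ |θ|
  · -- large θ
    have hN : ∀ x ∈ (Finset.univ : Finset β), ∃ y ∈ (Finset.univ : Finset β), H.Adj x y := by
      intro x _; obtain ⟨y, h⟩ := hiso x; exact ⟨y, by simp, h⟩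
    have hU : (Finset.univ : Finset β).Nonempty := by
      rw [← Finset.card_pos, Finset.card_univ]; omega
    obtain ⟨U', hU1, hU2, hU3⟩ := exists_U H hconn v hv2 le_rfl
    have hUu : U' = Finset.univ := Finset.card_eq_iff_eq_univ _ |>.mp hU1
    subst hUu
    refine hstep n 1 p θ Finset.univ hp hp1 hn1 hN hU hU3 hθ hθ1 ?_ hnD ?_ ?_
    · rw [one_pow, one_mul]; exact hnr.trans (Nat.le_mul_of_pos_left _ (by omega))
    · refine le_trans ?_ (le_max_right _ _)
      rw [hU1, ← hvd]
      simp only [Nat.cast_one, one_pow, one_mul, Nat.sub_self, pow_zero, mul_one]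
      rw [← sq_abs]; gcongr
    · intro m ι i
      refine (special_cf hlam hp hp1 ι hiso hn hv1 i θ c0 hc00.le hcase hθ).trans ?_
      exact (le_max_left _ _).trans (le_max_right _ _)
  · push Not at hcase
    have hex : ∃ s, 2 ≤ s ∧ s ≤ v ∧ |θ| * (n : ℝ) ^ (v - s) ≤ c0 := ⟨v, hv2, le_rfl, by simpa using hcase.le⟩
    set s := Nat.find hex with hs
    obtain ⟨hs2, hsv, hsc⟩ := Nat.find_spec hex
    rw [← hs] at hs2 hsv hsc
    obtain ⟨U, hU1, hU2, hU3⟩ := exists_U H hconn s hs2 hsv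
    set t := |θ| * (n : ℝ) ^ (v - s) with ht
    have ht0 : 0 < t := by positivity
    have ht1 : t ^ 2 ≤ u1 := by rw [← hc0sq]; gcongr
    obtain ⟨l, hl1, hl2, hl3⟩ := pick_l u1 t s n (by omega) hu10 ht0 ht1
    have hl1r : (1 : ℝ) ≤ l := by exact_mod_cast hl1
    have hU : U.Nonempty := by rw [← Finset.card_pos]; omega
    have hlr : l ^ r * n ≤ D1 * n ^ r := by
      rcases Nat.lt_or_ge 2 s with h3 | h3
      · -- s ≥ 3
        have hmin := Nat.find_min hex (m := s - 1) (by omega)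
        have hc : c0 < |θ| * (n : ℝ) ^ (v - s) * n := by
          by_contra hc'
          push Not at hc'
          apply hmin
          refine ⟨by omega, by omega, ?_⟩
          have : v - (s - 1) = (v - s) + 1 := by omega
          rw [this, pow_succ, ← mul_assoc]; exact hc'
        have hl3' : (l : ℝ) ^ 3 ≤ (n : ℝ) ^ 2 := by
          have a1 : (l : ℝ) ^ 3 ≤ (l : ℝ) ^ s := pow_le_pow_right₀ hl1r h3
          have a2 : c0 ^ 2 ≤ (t * n) ^ 2 := by gcongr
          have a3 : (l : ℝ) ^ s * u1 ≤ (n : ℝ) ^ 2 * u1 := by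
            calc (l : ℝ) ^ s * u1 ≤ (l : ℝ) ^ s * (t * n) ^ 2 := by rw [← hc0sq]; gcongr
              _ = ((l : ℝ) ^ s * t ^ 2) * (n : ℝ) ^ 2 := by ring
              _ ≤ u1 * (n : ℝ) ^ 2 := by gcongr
              _ = _ := by ring
          exact a1.trans (le_of_mul_le_mul_right a3 hu10)
        have hl3n : l ^ 3 ≤ n ^ 2 := by exact_mod_cast hl3'
        calc l ^ r * n = (l ^ 3) ^ q * n := by rw [hr, pow_mul]
          _ ≤ (n ^ 2) ^ q * n ^ q := by
              gcongr
              exact Nat.le_self_pow (by omega) _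
          _ = 1 * n ^ r := by rw [hr, ← pow_mul, ← pow_add, one_mul]; congr 1; ring
          _ ≤ _ := Nat.mul_le_mul_right _ (by omega)
      · have hs2' : s = 2 := by omega
        rw [hs2'] at hl2
        have hlt : (l : ℝ) * t ≤ c0 := by
          rw [← pow_le_pow_iff_left₀ (by positivity) hc00.le two_ne_zero, mul_pow, hc0sq]; exact hl2
        have htn : |θ| * (n : ℝ) ^ (v - 1) = t * n := by
          have : v - 1 = (v - s) + 1 := by omega
          rw [ht, this, pow_succ]; ring
        have hR : (l : ℝ) ^ r * n ≤ (D1 : ℝ) * (n : ℝ) ^ r := by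
          calc (l : ℝ) ^ r * n ≤ (l : ℝ) ^ r * (D0 * (t * n) ^ r) := by rw [← htn]; gcongr
            _ = D0 * (l * t) ^ r * (n : ℝ) ^ r := by rw [mul_pow, mul_pow]; ring
            _ ≤ D0 * c0 ^ r * (n : ℝ) ^ r := by gcongr
            _ ≤ _ := by
                gcongr
                rw [hD1]; push_cast
                linarith [Nat.le_ceil (D0 * c0 ^ r)]
        exact_mod_cast hR
    have htθ : t ^ 2 = (θ * (n : ℝ) ^ (v - s)) ^ 2 := by rw [ht, mul_pow, mul_pow, sq_abs]
    refine hstep n l p θ U hp hp1 hn1 hU2 hU hU3 hθ hθ1 hlr hnD ?_ ?_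
    · rw [hU1, ← htθ]; exact hl2.trans (le_max_left _ _)
    · intro m ι i
      refine le_trans ?_ (le_max_left _ _)
      set E2 := Ex p (fun z => PhiB H ι U p i z ^ 2) with hE2
      have hup := PhiB_upper (H := H) ι h0 h1 hv1 hn1 hU2 i
      have hlo := PhiB_lower ι hlam hp hp1 hiso hn hv1 hU2 i (by omega : 0 < l)
      rw [hU1, ← hvd, ← hE2] at hup hlo
      rw [← he, ← hCL] at hlo
      have hpow : (n : ℝ) ^ (2 * v) = ((n : ℝ) ^ (v - s)) ^ 2 * (n : ℝ) ^ (s + s) := by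
        rw [← pow_mul, ← pow_add]; congr 1; omega
      have hns : 0 < (n : ℝ) ^ (s + s) := by positivity
      have htt : t ^ 2 = θ ^ 2 * ((n : ℝ) ^ (v - s)) ^ 2 := by rw [htθ, mul_pow]
      have hup' : E2 ≤ CH H * ((l : ℝ) ^ s * ((n : ℝ) ^ (v - s)) ^ 2) := by
        refine le_of_mul_le_mul_right (hup.trans (le_of_eq ?_)) hns
        rw [hpow]; ring
      have hlo' : (l : ℝ) ^ s * ((n : ℝ) ^ (v - s)) ^ 2 ≤ CL * E2 := by
        refine le_of_mul_le_mul_right (le_trans (le_of_eq ?_) (hlo.trans (le_of_eq ?_))) hns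
        · rw [hpow]; ring
        · ring
      have h4 := bonami hlam hlam2 hp hp1 (TB ι i) e _ _ (PhiB_rep (H := H) (U := U) ι h0 h1 i) (PhiB_dep ι p i)
      refine (block_cf h0 h1 (PhiB H ι U p i) (PhiB_mean ι p hU2 hU i) θ B hB0.le h4 ?_).trans ?_
      · rw [← hE2]
        calc (256 * B + 1) * (θ ^ 2 * E2) ≤ (256 * B + 1) * (θ ^ 2 * (CH H * ((l : ℝ) ^ s * ((n : ℝ) ^ (v - s)) ^ 2))) := by gcongr
          _ = ((256 * B + 1) * CH H) * ((l : ℝ) ^ s * t ^ 2) := by rw [htt]; ring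
          _ ≤ ((256 * B + 1) * CH H) * u1 := by gcongr
          _ = 1 := by rw [hu1]; field_simp
      · rw [← hE2]
        have : κ ≤ θ ^ 2 * E2 := by
          rw [hκ, div_le_iff₀ (by positivity)]
          calc u1 ≤ 2 ^ s * ((l : ℝ) ^ s * t ^ 2) := hl3.le
            _ ≤ 2 ^ v * ((l : ℝ) ^ s * t ^ 2) := by gcongr; norm_num
            _ = 2 ^ v * (θ ^ 2 * ((l : ℝ) ^ s * ((n : ℝ) ^ (v - s)) ^ 2)) := by rw [htt]; ring
            _ ≤ 2 ^ v * (θ ^ 2 * (CL * E2)) := by gcongr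
            _ = _ := by ring
        linarith
end PIs
end SCL

namespace SCL
open Finset
open scoped Classical

section PJs

lemma norm_prod_sub_le {ι : Type*} (s : Finset ι) (a b : ι → ℂ) (ha : ∀ i, ‖a i‖ ≤ 1) (hb : ∀ i, ‖b i‖ ≤ 1) :
    ‖∏ i ∈ s, a i - ∏ i ∈ s, b i‖ ≤ ∑ i ∈ s, ‖a i - b i‖ := by
  induction s using Finset.induction_on with
  | empty => simp
  | insert i s hi ih =>
    rw [prod_insert hi, prod_insert hi, sum_insert hi]
    have h1 : ‖∏ i ∈ s, a i‖ ≤ 1 := by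
      rw [norm_prod]; exact prod_le_one (fun _ _ => norm_nonneg _) fun i _ => ha i
    calc ‖a i * ∏ i ∈ s, a i - b i * ∏ i ∈ s, b i‖
        = ‖(a i - b i) * ∏ i ∈ s, a i + b i * (∏ i ∈ s, a i - ∏ i ∈ s, b i)‖ := by congr 1; ring
      _ ≤ ‖a i - b i‖ * ‖∏ i ∈ s, a i‖ + ‖b i‖ * ‖∏ i ∈ s, a i - ∏ i ∈ s, b i‖ := by
          refine (norm_add_le _ _).trans ?_
          rw [norm_mul, norm_mul]
      _ ≤ ‖a i - b i‖ * 1 + 1 * ∑ i ∈ s, ‖a i - b i‖ := by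
          gcongr; exact hb i
      _ = _ := by ring

lemma taylor3 (y : ℝ) : ‖Complex.exp (y * Complex.I) - (1 + y * Complex.I - ((y ^ 2 / 2 : ℝ) : ℂ))‖ ≤ 4 * |y| ^ 3 := by
  have h := exp_taylor 3 (by norm_num) y
  have e : ∑ k ∈ range 3, ((y : ℂ) * Complex.I) ^ k / (k.factorial : ℂ) = 1 + y * Complex.I - ((y ^ 2 / 2 : ℝ) : ℂ) := by
    simp only [sum_range_succ, range_zero, sum_empty, pow_zero, Nat.factorial, pow_one, mul_pow, Complex.I_sq]
    push_cast; ring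
  rw [e] at h
  refine h.trans (le_of_eq ?_)
  norm_num

lemma one_factor {p : ℝ} (h0 : 0 ≤ p) (h1 : p ≤ 1) (t : ℝ) :
    ‖(p • Complex.exp ((t * xi p true : ℝ) * Complex.I) + (1 - p) • Complex.exp ((t * xi p false : ℝ) * Complex.I)) -
      ((Real.exp (-(t ^ 2 * (p * (1 - p))) / 2) : ℝ) : ℂ)‖ ≤ 6 * |t| ^ 3 := by
  set v := p * (1 - p) with hv
  have hv0 : 0 ≤ v := mul_nonneg h0 (by linarith)
  have hv1 : v ≤ 1 / 4 := by rw [hv]; nlinarith [sq_nonneg (p - 1 / 2)]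
  have h1p : 0 ≤ 1 - p := by linarith
  by_cases ht : 1 ≤ |t|
  · have : (1 : ℝ) ≤ |t| ^ 3 := one_le_pow₀ ht
    have a : ‖(p • Complex.exp ((t * xi p true : ℝ) * Complex.I) + (1 - p) • Complex.exp ((t * xi p false : ℝ) * Complex.I))‖ ≤ 1 := by
      refine (norm_add_le _ _).trans ?_
      rw [norm_smul, norm_smul, Complex.norm_exp_ofReal_mul_I, Complex.norm_exp_ofReal_mul_I,
        Real.norm_of_nonneg h0, Real.norm_of_nonneg h1p]
      linarith
    have b : ‖((Real.exp (-(t ^ 2 * v) / 2) : ℝ) : ℂ)‖ ≤ 1 := by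
      rw [Complex.norm_real, Real.norm_of_nonneg (Real.exp_pos _).le, Real.exp_le_one_iff]
      have : 0 ≤ t ^ 2 * v := by positivity
      linarith
    refine (norm_sub_le _ _).trans ?_
    linarith
  · push Not at ht
    have a1 := taylor3 (t * xi p true)
    have a2 := taylor3 (t * xi p false)
    have b1 : |t * xi p true| ^ 3 ≤ |t| ^ 3 := 
      pow_le_pow_left₀ (abs_nonneg _) (by rw [abs_mul]; exact mul_le_of_le_one_right (abs_nonneg _) (abs_xi_le h0 h1 _)) 3
    have b2 : |t * xi p false| ^ 3 ≤ |t| ^ 3 := 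
      pow_le_pow_left₀ (abs_nonneg _) (by rw [abs_mul]; exact mul_le_of_le_one_right (abs_nonneg _) (abs_xi_le h0 h1 _)) 3
    set x := t ^ 2 * v / 2 with hx
    have ht2 : t ^ 2 ≤ 1 := by rw [← sq_abs]; exact pow_le_one₀ (abs_nonneg _) ht.le
    have hx0 : 0 ≤ x := by positivity
    have hx1 : x ≤ 1 := by rw [hx]; nlinarith
    have ex : |Real.exp (-x) - (1 - x)| ≤ x ^ 2 := by
      have := Real.abs_exp_sub_one_sub_id_le (x := -x) (by rw [abs_neg, _root_.abs_of_nonneg hx0]; exact hx1)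
      rw [neg_sq] at this
      convert this using 2; ring
    have hx2 : x ^ 2 ≤ |t| ^ 3 := by
      have : x ≤ t ^ 2 := by rw [hx]; nlinarith [sq_nonneg t]
      calc x ^ 2 ≤ (t ^ 2) ^ 2 := by gcongr
        _ = |t| ^ 4 := by rw [← sq_abs t]; ring
        _ ≤ |t| ^ 3 := pow_le_pow_of_le_one (abs_nonneg _) ht.le (by norm_num)
    have hexp : Real.exp (-(t ^ 2 * v) / 2) = Real.exp (-x) := by congr 1; rw [hx]; ring
    rw [hexp]
    set e1 := Complex.exp ((t * xi p true : ℝ) * Complex.I)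
    set e2 := Complex.exp ((t * xi p false : ℝ) * Complex.I)
    have hid : (p • e1 + (1 - p) • e2) - ((Real.exp (-x) : ℝ) : ℂ) =
        p • (e1 - (1 + (t * xi p true : ℝ) * Complex.I - (((t * xi p true) ^ 2 / 2 : ℝ) : ℂ))) +
        (1 - p) • (e2 - (1 + (t * xi p false : ℝ) * Complex.I - (((t * xi p false) ^ 2 / 2 : ℝ) : ℂ))) -
        ((Real.exp (-x) - (1 - x) : ℝ) : ℂ) := by
      simp only [Complex.real_smul, xi, hx, hv]
      simp
      ring
    rw [hid]
    have c1 := norm_smul_le p (e1 - (1 + (t * xi p true : ℝ) * Complex.I - (((t * xi p true) ^ 2 / 2 : ℝ) : ℂ)))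
    have c2 := norm_smul_le (1 - p) (e2 - (1 + (t * xi p false : ℝ) * Complex.I - (((t * xi p false) ^ 2 / 2 : ℝ) : ℂ)))
    rw [Real.norm_of_nonneg h0] at c1
    rw [Real.norm_of_nonneg h1p] at c2
    have c3 : ‖((Real.exp (-x) - (1 - x) : ℝ) : ℂ)‖ ≤ |t| ^ 3 := by
      rw [Complex.norm_real, Real.norm_eq_abs]; exact ex.trans hx2
    calc _ ≤ _ := norm_sub_le _ _
      _ ≤ _ + _ := add_le_add (norm_add_le _ _) c3
      _ ≤ p * (4 * |t| ^ 3) + (1 - p) * (4 * |t| ^ 3) + |t| ^ 3 := by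
          gcongr
          · exact c1.trans (by gcongr; linarith)
          · exact c2.trans (by gcongr; linarith)
      _ = 5 * |t| ^ 3 := by ring
      _ ≤ _ := by gcongr; norm_num

/-- characteristic function of a linear form -/
lemma linear_cf {J : Type*} [Fintype J] [DecidableEq J] {p : ℝ} (h0 : 0 ≤ p) (h1 : p ≤ 1) (a : J → ℝ) (θ : ℝ) :
    ‖Ex p (fun x => Complex.exp ((θ * ∑ e, a e * xi p (x e) : ℝ) * Complex.I)) -
      ((Real.exp (-(θ ^ 2 * ∑ e, a e ^ 2 * (p * (1 - p))) / 2) : ℝ) : ℂ)‖ ≤ ∑ e, 6 * |θ * a e| ^ 3 := by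
  have e1 : ∀ x : J → Bool, Complex.exp ((θ * ∑ e, a e * xi p (x e) : ℝ) * Complex.I) =
      ∏ e, Complex.exp (((θ * a e) * xi p (x e) : ℝ) * Complex.I) := by
    intro x
    rw [← Complex.exp_sum]
    congr 1
    rw [← Finset.sum_mul, ← Complex.ofReal_sum, Finset.mul_sum]
    congr 3
    funext e; ring
  have e2 : ((Real.exp (-(θ ^ 2 * ∑ e, a e ^ 2 * (p * (1 - p))) / 2) : ℝ) : ℂ) =
      ∏ e, ((Real.exp (-((θ * a e) ^ 2 * (p * (1 - p))) / 2) : ℝ) : ℂ) := by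
    rw [← Complex.ofReal_prod, ← Real.exp_sum]
    congr 2
    rw [Finset.mul_sum, ← Finset.sum_neg_distrib, Finset.sum_div]
    refine Finset.sum_congr rfl fun e _ => ?_
    ring
  simp only [e1]
  rw [e2, Ex_prod p (fun e b => Complex.exp (((θ * a e) * xi p b : ℝ) * Complex.I))]
  have h1p : 0 ≤ 1 - p := by linarith
  refine (norm_prod_sub_le _ _ _ ?_ ?_).trans (Finset.sum_le_sum fun e _ => one_factor h0 h1 _)
  · intro e
    refine (norm_add_le _ _).trans ?_
    rw [norm_smul, norm_smul, Complex.norm_exp_ofReal_mul_I, Complex.norm_exp_ofReal_mul_I,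
      Real.norm_of_nonneg h0, Real.norm_of_nonneg h1p]
    linarith
  · intro e
    rw [Complex.norm_real, Real.norm_of_nonneg (Real.exp_pos _).le, Real.exp_le_one_iff]
    have : 0 ≤ (θ * a e) ^ 2 * (p * (1 - p)) := mul_nonneg (sq_nonneg _) (mul_nonneg h0 h1p)
    linarith

variable {β : Type*} [Fintype β] (H : SimpleGraph β)

noncomputable def mH (n : ℕ) (p : ℝ) : ℝ := Ex p (fun x : Sym2 (Fin n) → Bool => XX H x)
noncomputable def vH (n : ℕ) (p : ℝ) : ℝ := Ex p (fun x : Sym2 (Fin n) → Bool => (XX H x - mH H n p) ^ 2)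
noncomputable def QQ (n : ℕ) (p : ℝ) (x : Sym2 (Fin n) → Bool) : ℝ :=
  ∑ S ∈ Finset.univ.filter (fun S : Finset (Sym2 (Fin n)) => 2 ≤ S.card), aS H p S * mono p S x

variable {n : ℕ} {p : ℝ}

lemma mH_eq : mH H n p = aS H p (∅ : Finset (Sym2 (Fin n))) := by
  unfold mH
  have e : (fun x : Sym2 (Fin n) → Bool => XX H x) = fun x => ∑ S, aS H p S * mono p S x := funext (XX_eq H p)
  rw [e, Ex_sum, Finset.sum_eq_single ∅]
  · rw [Ex_mul_left]
    have : mono p (∅ : Finset (Sym2 (Fin n))) = fun _ => (1 : ℝ) := by funext x; simp [mono]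
    rw [this, Ex_const, mul_one]
  · intro S _ hS
    rw [Ex_mul_left, Ex_mono_zero p S (Finset.nonempty_iff_ne_empty.mpr hS), mul_zero]
  · simp

lemma XX_centered (x : Sym2 (Fin n) → Bool) : XX H x - mH H n p =
    ∑ S ∈ Finset.univ.erase (∅ : Finset (Sym2 (Fin n))), aS H p S * mono p S x := by
  rw [mH_eq, XX_eq H p, ← Finset.add_sum_erase _ _ (Finset.mem_univ (∅ : Finset (Sym2 (Fin n))))]
  simp [mono]

lemma erase_split (f : Finset (Sym2 (Fin n)) → ℝ) : ∑ S ∈ Finset.univ.erase (∅ : Finset (Sym2 (Fin n))), f S =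
    ∑ e, f {e} + ∑ S ∈ Finset.univ.filter (fun S : Finset (Sym2 (Fin n)) => 2 ≤ S.card), f S := by
  have h1 : ∑ e, f {e} = ∑ S ∈ (Finset.univ : Finset (Sym2 (Fin n))).image (fun e => ({e} : Finset (Sym2 (Fin n)))), f S := by
    rw [Finset.sum_image]
    intro a _ b _ h
    exact Finset.singleton_injective h
  rw [h1, ← Finset.sum_union]
  · congr 1
    ext S
    simp only [mem_erase, mem_univ, and_true, mem_union, mem_image, true_and, mem_filter]
    constructor
    · intro h
      have : 1 ≤ S.card := Finset.card_pos.mpr (Finset.nonempty_iff_ne_empty.mpr h)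
      by_cases h2 : S.card = 1
      · obtain ⟨e, rfl⟩ := Finset.card_eq_one.mp h2
        exact Or.inl ⟨e, rfl⟩
      · right; omega
    · rintro (⟨e, rfl⟩ | h)
      · simp
      · rintro rfl; simp at h
  · rw [Finset.disjoint_left]
    intro S h1 h2
    simp only [mem_image, mem_univ, true_and, mem_filter] at h1 h2
    obtain ⟨e, rfl⟩ := h1
    simp at h2

lemma XX_split (x : Sym2 (Fin n) → Bool) : XX H x - mH H n p =
    ∑ e, aS H p {e} * xi p (x e) + QQ H n p x := by
  rw [XX_centered, erase_split]
  simp [mono, QQ]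

lemma vH_eq : vH H n p = ∑ S ∈ Finset.univ.erase (∅ : Finset (Sym2 (Fin n))), aS H p S ^ 2 * (p * (1 - p)) ^ S.card := by
  unfold vH
  simp only [XX_centered]
  exact Ex_parseval p _ (aS H p) (fun S => S) (fun a _ b _ h => h)

lemma QQ_var : Ex p (fun x => QQ H n p x ^ 2) =
    ∑ S ∈ Finset.univ.filter (fun S : Finset (Sym2 (Fin n)) => 2 ≤ S.card), aS H p S ^ 2 * (p * (1 - p)) ^ S.card :=
  Ex_parseval p _ (aS H p) (fun S => S) (fun a _ b _ h => h)

lemma vH_split : vH H n p = ∑ e : Sym2 (Fin n), aS H p {e} ^ 2 * (p * (1 - p)) + Ex p (fun x => QQ H n p x ^ 2) := by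
  rw [vH_eq, erase_split, QQ_var]; simp

lemma NS_nondiag {S : Finset (Sym2 (Fin n))} (h : NS H S ≠ 0) {e : Sym2 (Fin n)} (he : e ∈ S) : ¬ e.IsDiag := by
  obtain ⟨E, hE⟩ := Finset.card_pos.mp (Nat.pos_of_ne_zero h)
  obtain ⟨a, b⟩ := Finset.mem_filter.mp hE
  obtain ⟨f, _, rfl⟩ := Finset.mem_image.mp a
  obtain ⟨g, hg, rfl⟩ := Finset.mem_image.mp (b he)
  simp only [HE, mem_filter, mem_univ, true_and] at hg
  intro hd
  rw [Sym2.isDiag_map f.injective] at hd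
  exact H.not_isDiag_of_mem_edgeSet hg hd

lemma two_le_spt {S : Finset (Sym2 (Fin n))} (h : NS H S ≠ 0) (hS : S.Nonempty) : 2 ≤ (spt S).card := by
  obtain ⟨e, he⟩ := hS
  have hd := NS_nondiag H h he
  induction e using Sym2.ind with
  | _ a b =>
    have hab : a ≠ b := by simpa using hd
    rw [← Finset.card_pair hab]
    apply Finset.card_le_card
    intro x hx
    refine edge_spt he ?_
    simpa using hx

lemma three_le_spt {S : Finset (Sym2 (Fin n))} (h : NS H S ≠ 0) (hS : 2 ≤ S.card) : 3 ≤ (spt S).card := by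
  obtain ⟨e, he, f, hf, hef⟩ := Finset.one_lt_card.mp hS
  have hd := NS_nondiag H h he
  have hd' := NS_nondiag H h hf
  induction e using Sym2.ind with
  | _ a b =>
  induction f using Sym2.ind with
  | _ c d =>
    have hab : a ≠ b := by simpa using hd
    have hcd : c ≠ d := by simpa using hd'
    have : ∃ x ∈ s(c, d), x ≠ a ∧ x ≠ b := by
      by_contra hc
      push Not at hc
      apply hef
      have h1 := hc c (by simp)
      have h2 := hc d (by simp)
      rw [Sym2.eq_iff]
      by_cases hca : c = a
      · left
        refine ⟨hca.symm, (h2 ?_).symm⟩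
        rintro rfl; exact hcd hca
      · have hcb := h1 hca
        right
        refine ⟨?_, hcb.symm⟩
        by_contra hda
        have := h2 (fun h => hda h.symm)
        exact hcd (hcb.trans this.symm)
    obtain ⟨x, hx, hxa, hxb⟩ := this
    have hc3 : ({x, a, b} : Finset (Fin n)).card = 3 := Finset.card_eq_three.mpr ⟨x, a, b, hxa, hxb, hab, rfl⟩
    rw [← hc3]
    apply Finset.card_le_card
    intro y hy
    simp only [mem_insert, mem_singleton] at hy
    rcases hy with rfl | rfl | rfl
    · exact edge_spt hf hx
    · exact edge_spt he (by simp)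
    · exact edge_spt he (by simp)

variable {H} in
lemma vH_upper (h0 : 0 ≤ p) (h1 : p ≤ 1) (hv : 1 ≤ Fintype.card β) (hn : 1 ≤ n) :
    vH H n p * (n : ℝ) ^ 2 ≤ ((Fintype.card β : ℝ) ^ Fintype.card β * 2 ^ (HE H).card * 2 ^ Fintype.card β) * (n : ℝ) ^ (2 * Fintype.card β) := by
  rw [vH_eq]
  have := sum_aS_sq_le H h0 h1 hv hn (Finset.univ.erase (∅ : Finset (Sym2 (Fin n)))) ∅ 0 2 (by simp)
    (fun S hS h => two_le_spt H h (Finset.nonempty_iff_ne_empty.mpr (Finset.mem_erase.mp hS).1))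
  simpa using this

variable {H} in
lemma QQ_upper (h0 : 0 ≤ p) (h1 : p ≤ 1) (hv : 1 ≤ Fintype.card β) (hn : 1 ≤ n) :
    Ex p (fun x => QQ H n p x ^ 2) * (n : ℝ) ^ 3 ≤ ((Fintype.card β : ℝ) ^ Fintype.card β * 2 ^ (HE H).card * 2 ^ Fintype.card β) * (n : ℝ) ^ (2 * Fintype.card β) := by
  rw [QQ_var]
  have := sum_aS_sq_le H h0 h1 hv hn (Finset.univ.filter (fun S : Finset (Sym2 (Fin n)) => 2 ≤ S.card)) ∅ 0 3 (by simp)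
    (fun S hS h => three_le_spt H h (Finset.mem_filter.mp hS).2)
  simpa using this

variable {H} in
lemma ae_upper (h0 : 0 ≤ p) (h1 : p ≤ 1) (hv : 1 ≤ Fintype.card β) (hn : 1 ≤ n) (e : Sym2 (Fin n)) :
    |aS H p {e}| * (n : ℝ) ^ 2 ≤ (Fintype.card β : ℝ) ^ Fintype.card β * (n : ℝ) ^ Fintype.card β := by
  by_cases h : NS H {e} = 0
  · rw [aS_zero H p _ h]; simp; positivity
  · rw [_root_.abs_of_nonneg (aS_nonneg H h0 _)]
    have h2 := two_le_spt H h (by simp)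
    have h3 := NS_bound H hv ({e} : Finset (Sym2 (Fin n)))
    have hn1 : (1 : ℝ) ≤ n := by exact_mod_cast hn
    calc aS H p {e} * (n : ℝ) ^ 2 ≤ NS H {e} * (n : ℝ) ^ (spt ({e} : Finset (Sym2 (Fin n)))).card := by
          gcongr
          exact aS_le H h0 h1 _
      _ ≤ _ := by exact_mod_cast h3

variable {H} in
lemma vH_lower {lam : ℝ} (hlam : 0 < lam) (hp : lam ≤ p) (hp1 : p ≤ 1 - lam) (hconn : H.Connected)
    (hv2 : 2 ≤ Fintype.card β) (hn : Fintype.card β ≤ n) :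
    (n : ℝ) ^ (2 * Fintype.card β) ≤ (4 * (Fintype.card β : ℝ) ^ 2 * ((((Fintype.card β : ℝ) ^ Fintype.card β) ^ 4 / lam ^ (4 * (HE H).card)) * 2 ^ (HE H).card)) *
      (vH H n p * (n : ℝ) ^ 2) := by
  have h0 : 0 ≤ p := by linarith
  have h1 : p ≤ 1 := by linarith
  have hiso : ∀ x : β, ∃ y, H.Adj x y := by
    have : Nontrivial β := Fintype.one_lt_card_iff_nontrivial.mp (by omega)
    intro x
    exact hconn.preconnected.exists_adj_of_nontrivial x
  obtain ⟨U, hU1, hU2, hU3⟩ := exists_U H hconn 2 le_rfl hv2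
  have hU : U.Nonempty := by rw [← Finset.card_pos]; omega
  set v := Fintype.card β with hvd
  set l := n / v with hl
  have hl0 : 0 < l := Nat.div_pos hn (by omega)
  obtain ⟨ι⟩ := emb_exists (β := β) (m := 1) (l := l) (n := n) (by rw [one_mul]; exact Nat.mul_div_le n v)
  have hlo := PhiB_lower ι hlam hp hp1 hiso hn (by omega) hU2 0 hl0
  rw [hU1, ← hvd] at hlo
  have hln : (n : ℝ) ≤ 2 * v * l := by
    have : n ≤ 2 * v * l := by
      have := Nat.lt_div_mul_add (a := n) (b := v) (by omega)
      rw [← hl] at this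
      nlinarith
    exact_mod_cast this
  set CL : ℝ := ((v : ℝ) ^ v) ^ 4 / lam ^ (4 * (HE H).card) with hCL
  have hCL0 : 0 ≤ CL := by positivity
  have hn0 : (0 : ℝ) < n := by
    have : 0 < n := by omega
    exact_mod_cast this
  have nn : ∀ S : Finset (Sym2 (Fin n)), 0 ≤ aS H p S ^ 2 * (p * (1 - p)) ^ S.card := fun S =>
      mul_nonneg (sq_nonneg _) (pow_nonneg (mul_nonneg h0 (by linarith)) _)
  have hE : Ex p (fun z => PhiB H ι U p 0 z ^ 2) ≤ 2 ^ (HE H).card * vH H n p := by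
    rw [PhiB_var, vH_eq]
    have : ∑ S ∈ MB H ι U 0, aS H p S ^ 2 * (p * (1 - p)) ^ S.card ≤
        ∑ S ∈ Finset.univ.erase (∅ : Finset (Sym2 (Fin n))), aS H p S ^ 2 * (p * (1 - p)) ^ S.card := by
      apply Finset.sum_le_sum_of_subset_of_nonneg
      · intro S hS
        simp only [MB, mem_filter, mem_univ, true_and] at hS
        simp only [mem_erase, mem_univ, and_true]
        exact Finset.nonempty_iff_ne_empty.mp (Mp_nonempty ι hU2 hU hS.2.1)
      · intro S _ _; exact nn S
    refine mul_le_mul ?_ this (Finset.sum_nonneg fun S _ => nn S) (by positivity)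
    exact pow_le_pow_right₀ (by norm_num) (EU_card_le (H := H) (U := U))
  have : (n : ℝ) ^ (2 * v) * (n : ℝ) ^ 2 ≤ ((4 * (v : ℝ) ^ 2 * (CL * 2 ^ (HE H).card)) *
      (vH H n p * (n : ℝ) ^ 2)) * (n : ℝ) ^ 2 := by
    calc (n : ℝ) ^ (2 * v) * (n : ℝ) ^ 2 ≤ (n : ℝ) ^ (2 * v) * (2 * v * l) ^ 2 := by gcongr
      _ = 4 * (v : ℝ) ^ 2 * ((l : ℝ) ^ 2 * (n : ℝ) ^ (2 * v)) := by ring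
      _ ≤ 4 * (v : ℝ) ^ 2 * (CL * (Ex p (fun z => PhiB H ι U p 0 z ^ 2) * (n : ℝ) ^ (2 + 2))) := by gcongr
      _ ≤ 4 * (v : ℝ) ^ 2 * (CL * ((2 ^ (HE H).card * vH H n p) * (n : ℝ) ^ (2 + 2))) := by gcongr
      _ = _ := by ring
  exact le_of_mul_le_mul_right this (by positivity)
end PJs
end SCL

namespace SCL
open Finset
open scoped Classical

section PKs
variable {β : Type*} [Fintype β] {H : SimpleGraph β}

/-- centered characteristic function -/
noncomputable def chi (H : SimpleGraph β) (n : ℕ) (p θ : ℝ) : ℂ :=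
  Ex p (fun x : Sym2 (Fin n) → Bool => Complex.exp ((θ * (XX H x - mH H n p) : ℝ) * Complex.I))

lemma card_sym2_le (n : ℕ) (hn : 1 ≤ n) : (Fintype.card (Sym2 (Fin n)) : ℝ) ≤ (n : ℝ) ^ 2 := by
  have : Fintype.card (Sym2 (Fin n)) ≤ n ^ 2 := by
    rw [Sym2.card, Fintype.card_fin, Nat.choose_two_right]
    apply Nat.div_le_of_le_mul
    simp only [Nat.add_sub_cancel]
    nlinarith
  exact_mod_cast this

lemma norm_exp_sub_exp (a b : ℝ) : ‖Complex.exp ((a + b : ℝ) * Complex.I) - Complex.exp ((a : ℝ) * Complex.I)‖ ≤ |b| := by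
  have : Complex.exp ((a + b : ℝ) * Complex.I) - Complex.exp ((a : ℝ) * Complex.I) =
      Complex.exp ((a : ℝ) * Complex.I) * (Complex.exp (Complex.I * (b : ℝ)) - 1) := by
    rw [mul_sub, ← Complex.exp_add, mul_one]; congr 2; push_cast; ring
  rw [this, norm_mul, Complex.norm_exp_ofReal_mul_I, one_mul]
  exact Real.norm_exp_I_mul_ofReal_sub_one_le

lemma exp_lip {a b : ℝ} (ha : 0 ≤ a) (hb : 0 ≤ b) : |Real.exp (-a) - Real.exp (-(a + b))| ≤ b := by
  have h1 : Real.exp (-(a + b)) = Real.exp (-a) * Real.exp (-b) := by rw [← Real.exp_add]; congr 1; ring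
  have h2 : Real.exp (-a) ≤ 1 := Real.exp_le_one_iff.mpr (by linarith)
  have h3 : Real.exp (-b) ≤ 1 := Real.exp_le_one_iff.mpr (by linarith)
  have h4 := Real.add_one_le_exp (-b)
  have h5 := Real.exp_pos (-a)
  rw [h1, _root_.abs_of_nonneg (by nlinarith)]
  nlinarith

set_option maxHeartbeats 1000000 in
lemma small_cf (H : SimpleGraph β) (hv : 1 ≤ Fintype.card β) : ∃ C : ℝ, 0 < C ∧ ∀ (n : ℕ) (p θ : ℝ), 0 ≤ p → p ≤ 1 → 1 ≤ n →
    ‖chi H n p θ - ((Real.exp (-(θ ^ 2 * vH H n p) / 2) : ℝ) : ℂ)‖ * √n ≤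
      C * (|θ| * (n : ℝ) ^ (Fintype.card β - 1) + (|θ| * (n : ℝ) ^ (Fintype.card β - 1)) ^ 2 + (|θ| * (n : ℝ) ^ (Fintype.card β - 1)) ^ 3) := by
  set v := Fintype.card β with hvd
  set K : ℝ := (v : ℝ) ^ v * 2 ^ (HE H).card * 2 ^ v with hK
  set V : ℝ := (v : ℝ) ^ v with hV
  have hK0 : 0 ≤ K := by positivity
  have hV0 : 0 ≤ V := by positivity
  refine ⟨K + 1 + 6 * V ^ 3, by positivity, fun n p θ h0 h1 hn => ?_⟩
  set N : ℝ := (n : ℝ) ^ (v - 1) with hN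
  have hn1 : (1 : ℝ) ≤ n := by exact_mod_cast hn
  have hn0 : (0 : ℝ) < n := by linarith
  have hN0 : 0 < N := by positivity
  have hnv : (n : ℝ) ^ v = n * N := by
    rw [hN, ← pow_succ']; congr 1; omega
  have hq := QQ_upper (H := H) (n := n) h0 h1 hv hn
  rw [← hvd, ← hV, ← hK, mul_comm 2 v, pow_mul, hnv] at hq
  set EQ := Ex p (fun x : Sym2 (Fin n) → Bool => QQ H n p x ^ 2) with hEQ
  have hEQ0 : 0 ≤ EQ := Ex_nonneg h0 h1 fun x => sq_nonneg _
  have hq' : EQ * n ≤ K * N ^ 2 := by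
    have : (EQ * n) * (n : ℝ) ^ 2 ≤ (K * N ^ 2) * (n : ℝ) ^ 2 := by
      calc _ = EQ * (n : ℝ) ^ 3 := by ring
        _ ≤ _ := hq
        _ = _ := by ring
    exact le_of_mul_le_mul_right this (by positivity)
  set τ := |θ| * N with hτ
  have hτ0 : 0 ≤ τ := by positivity
  have hq2 : θ ^ 2 * EQ * n ≤ K * τ ^ 2 := by
    calc θ ^ 2 * EQ * n = θ ^ 2 * (EQ * n) := by ring
      _ ≤ θ ^ 2 * (K * N ^ 2) := by gcongr
      _ = K * τ ^ 2 := by rw [hτ, mul_pow, sq_abs]; ring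
  have hsn : √(n : ℝ) ≤ n := by
    rw [Real.sqrt_le_left hn0.le]; nlinarith
  have hsn0 : 0 ≤ √(n : ℝ) := Real.sqrt_nonneg _
  -- linear part
  set SL : ℝ := ∑ e : Sym2 (Fin n), aS H p {e} ^ 2 * (p * (1 - p)) with hSL
  have hSL0 : 0 ≤ SL := Finset.sum_nonneg fun e _ => mul_nonneg (sq_nonneg _) (mul_nonneg h0 (by linarith))
  set phiL : ℂ := Ex p (fun x : Sym2 (Fin n) → Bool => Complex.exp ((θ * ∑ e, aS H p {e} * xi p (x e) : ℝ) * Complex.I)) with hphiL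
  have t2 : ‖phiL - ((Real.exp (-(θ ^ 2 * SL) / 2) : ℝ) : ℂ)‖ * √n ≤ 6 * V ^ 3 * τ ^ 3 := by
    have := linear_cf h0 h1 (fun e : Sym2 (Fin n) => aS H p {e}) θ
    have hb : ∀ e : Sym2 (Fin n), |θ * aS H p {e}| * n ≤ V * τ := by
      intro e
      have := ae_upper (H := H) h0 h1 hv hn e
      rw [← hvd, ← hV, hnv] at this
      have h : |aS H p {e}| * n ≤ V * N := by
        refine le_of_mul_le_mul_right (a := (n : ℝ)) ?_ hn0
        calc _ = |aS H p {e}| * (n : ℝ) ^ 2 := by ring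
          _ ≤ _ := this
          _ = _ := by ring
      rw [abs_mul]
      calc |θ| * |aS H p {e}| * n = |θ| * (|aS H p {e}| * n) := by ring
        _ ≤ |θ| * (V * N) := by gcongr
        _ = _ := by rw [hτ]; ring
    have hs : (∑ e : Sym2 (Fin n), 6 * |θ * aS H p {e}| ^ 3) * (n : ℝ) ^ 3 ≤ (6 * V ^ 3 * τ ^ 3) * (n : ℝ) ^ 2 := by
      rw [Finset.sum_mul]
      calc _ ≤ ∑ e : Sym2 (Fin n), 6 * (V * τ) ^ 3 := Finset.sum_le_sum fun e _ => by
              calc 6 * |θ * aS H p {e}| ^ 3 * (n : ℝ) ^ 3 = 6 * (|θ * aS H p {e}| * n) ^ 3 := by ring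
                _ ≤ _ := mul_le_mul_of_nonneg_left (pow_le_pow_left₀ (by positivity) (hb e) 3) (by norm_num)
        _ = Fintype.card (Sym2 (Fin n)) * (6 * (V * τ) ^ 3) := by simp
        _ ≤ (n : ℝ) ^ 2 * (6 * (V * τ) ^ 3) := by
              gcongr; exact card_sym2_le n hn
        _ = _ := by ring
    have hs2 : (∑ e : Sym2 (Fin n), 6 * |θ * aS H p {e}| ^ 3) * n ≤ 6 * V ^ 3 * τ ^ 3 := by
      refine le_of_mul_le_mul_right (a := (n : ℝ) ^ 2) ?_ (by positivity)
      calc _ = (∑ e : Sym2 (Fin n), 6 * |θ * aS H p {e}| ^ 3) * (n : ℝ) ^ 3 := by ring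
        _ ≤ _ := hs
    exact (mul_le_mul this hsn hsn0 (Finset.sum_nonneg fun e _ => by positivity)).trans hs2
  have t1 : ‖chi H n p θ - phiL‖ * √n ≤ (K + 1) * τ := by
    have e : chi H n p θ - phiL = Ex p (fun x : Sym2 (Fin n) → Bool =>
        Complex.exp ((θ * (XX H x - mH H n p) : ℝ) * Complex.I) - Complex.exp ((θ * ∑ e, aS H p {e} * xi p (x e) : ℝ) * Complex.I)) := by
      rw [Ex_sub]; rfl
    have hb : ‖chi H n p θ - phiL‖ ^ 2 ≤ θ ^ 2 * EQ := by
      rw [e]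
      refine (norm_Ex_sq_le h0 h1 _).trans ?_
      rw [hEQ, ← Ex_mul_left]
      refine Ex_mono h0 h1 fun x => ?_
      rw [XX_split, mul_add]
      have := norm_exp_sub_exp (θ * ∑ e, aS H p {e} * xi p (x e)) (θ * QQ H n p x)
      calc _ ≤ |θ * QQ H n p x| ^ 2 := pow_le_pow_left₀ (norm_nonneg _) this 2
        _ = _ := by rw [sq_abs]; ring
    refine abs_le_of_sq_le_sq' ?_ (by positivity) |>.2
    rw [mul_pow, Real.sq_sqrt hn0.le]
    calc _ ≤ θ ^ 2 * EQ * n := by gcongr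
      _ ≤ K * τ ^ 2 := hq2
      _ ≤ (K + 1) ^ 2 * τ ^ 2 := by gcongr; nlinarith
      _ = _ := by ring
  have t3 : ‖((Real.exp (-(θ ^ 2 * SL) / 2) : ℝ) : ℂ) - ((Real.exp (-(θ ^ 2 * vH H n p) / 2) : ℝ) : ℂ)‖ * √n ≤ K * τ ^ 2 := by
    rw [← Complex.ofReal_sub, Complex.norm_real, Real.norm_eq_abs, vH_split]
    have := exp_lip (a := θ ^ 2 * SL / 2) (b := θ ^ 2 * EQ / 2)
      (div_nonneg (mul_nonneg (sq_nonneg _) hSL0) (by norm_num)) (div_nonneg (mul_nonneg (sq_nonneg _) hEQ0) (by norm_num))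
    have e1 : -(θ ^ 2 * SL / 2) = -(θ ^ 2 * SL) / 2 := by ring
    have e2 : -(θ ^ 2 * SL / 2 + θ ^ 2 * EQ / 2) = -(θ ^ 2 * (SL + EQ)) / 2 := by ring
    rw [e1, e2] at this
    calc _ ≤ (θ ^ 2 * EQ / 2) * n := mul_le_mul this hsn hsn0 (by positivity)
      _ ≤ K * τ ^ 2 := by
        have : 0 ≤ K * τ ^ 2 := by positivity
        linarith
  have tri : ‖chi H n p θ - ((Real.exp (-(θ ^ 2 * vH H n p) / 2) : ℝ) : ℂ)‖ ≤ ‖chi H n p θ - phiL‖ +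
      ‖phiL - ((Real.exp (-(θ ^ 2 * SL) / 2) : ℝ) : ℂ)‖ + ‖((Real.exp (-(θ ^ 2 * SL) / 2) : ℝ) : ℂ) - ((Real.exp (-(θ ^ 2 * vH H n p) / 2) : ℝ) : ℂ)‖ := by
    refine (norm_sub_le_norm_sub_add_norm_sub _ (((Real.exp (-(θ ^ 2 * SL) / 2) : ℝ) : ℂ)) _).trans ?_
    gcongr
    exact norm_sub_le_norm_sub_add_norm_sub _ _ _
  have := mul_le_mul_of_nonneg_right tri hsn0
  have p2 : 0 ≤ τ ^ 2 := by positivity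
  have p3 : 0 ≤ τ ^ 3 := by positivity
  have p4 : 0 ≤ V ^ 3 := by positivity
  rw [add_mul, add_mul] at this
  have fin : (K + 1) * τ + 6 * V ^ 3 * τ ^ 3 + K * τ ^ 2 ≤ (K + 1 + 6 * V ^ 3) * (τ + τ ^ 2 + τ ^ 3) := by
    linarith [mul_nonneg p4 hτ0, mul_nonneg p4 p2, mul_nonneg hK0 p3]
  exact this.trans ((add_le_add (add_le_add t1 t2) t3).trans fin)
end PKs
end SCL

namespace SCL
open Finset
open scoped Classical

section PLs

lemma int_exp_int (m : ℤ) : ∫ θ in (-Real.pi)..Real.pi, Complex.exp ((θ * (m : ℝ) : ℝ) * Complex.I) =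
    if m = 0 then ((2 * Real.pi : ℝ) : ℂ) else 0 := by
  split_ifs with h
  · subst h; simp; ring
  · have hc : (m : ℂ) * Complex.I ≠ 0 := mul_ne_zero (by exact_mod_cast h) Complex.I_ne_zero
    have := integral_exp_mul_complex (a := -Real.pi) (b := Real.pi) hc
    have e : (fun θ : ℝ => Complex.exp ((θ * (m : ℝ) : ℝ) * Complex.I)) = fun θ : ℝ => Complex.exp ((m : ℂ) * Complex.I * θ) := by
      funext θ; congr 1; push_cast; ring
    rw [e, this, div_eq_zero_iff]
    left
    rw [sub_eq_zero, Complex.exp_eq_exp_iff_exists_int]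
    exact ⟨m, by push_cast; ring⟩

lemma gauss_inv {s : ℝ} (hs : 0 < s) (t : ℝ) :
    ∫ θ : ℝ, Complex.exp ((-(θ * t) : ℝ) * Complex.I) * ((Real.exp (-(θ ^ 2 * s ^ 2) / 2) : ℝ) : ℂ) =
      ((2 * Real.pi * (stdNormal (t / s) / s) : ℝ) : ℂ) := by
  have hb : 0 < ((s ^ 2 / 2 : ℝ) : ℂ).re := by rw [Complex.ofReal_re]; positivity
  have := fourierIntegral_gaussian hb (-t)
  have e : (fun θ : ℝ => Complex.exp ((-(θ * t) : ℝ) * Complex.I) * ((Real.exp (-(θ ^ 2 * s ^ 2) / 2) : ℝ) : ℂ)) =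
      fun θ : ℝ => Complex.exp (Complex.I * (-t) * θ) * Complex.exp (-((s ^ 2 / 2 : ℝ) : ℂ) * θ ^ 2) := by
    funext θ
    rw [Complex.ofReal_exp]
    congr 2
    · push_cast; ring
    · push_cast; ring
  rw [e, this]
  have e2 : ((Real.pi : ℂ) / ((s ^ 2 / 2 : ℝ) : ℂ)) ^ (1 / 2 : ℂ) = ((√(2 * Real.pi) / s : ℝ) : ℂ) := by
    rw [← Complex.ofReal_div]
    have h2 : (1 / 2 : ℂ) = ((1 / 2 : ℝ) : ℂ) := by push_cast; rfl
    rw [h2, ← Complex.ofReal_cpow (by positivity), ← Real.sqrt_eq_rpow]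
    congr 1
    rw [show Real.pi / (s ^ 2 / 2) = (2 * Real.pi) / s ^ 2 by field_simp, Real.sqrt_div (by positivity), Real.sqrt_sq hs.le]
  have e3 : Complex.exp (-(-(t : ℂ)) ^ 2 / (4 * ((s ^ 2 / 2 : ℝ) : ℂ))) = ((Real.exp (-((t / s) ^ 2) / 2) : ℝ) : ℂ) := by
    rw [Complex.ofReal_exp]
    congr 1
    have : (s : ℂ) ≠ 0 := by exact_mod_cast hs.ne'
    push_cast; field_simp; ring
  rw [e2, e3, ← Complex.ofReal_mul]
  congr 1
  unfold stdNormal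
  have hp : √(2 * Real.pi) * √(2 * Real.pi) = 2 * Real.pi := Real.mul_self_sqrt (by positivity)
  have hp0 : √(2 * Real.pi) ≠ 0 := by positivity
  field_simp
  rw [sq, hp]

lemma gauss_int {s : ℝ} (hs : 0 < s) (t : ℝ) :
    MeasureTheory.Integrable (fun θ : ℝ => Complex.exp ((-(θ * t) : ℝ) * Complex.I) * ((Real.exp (-(θ ^ 2 * s ^ 2) / 2) : ℝ) : ℂ)) := by
  have h := integrable_exp_neg_mul_sq (b := s ^ 2 / 2) (by positivity)
  refine h.mono' (by fun_prop) (Filter.Eventually.of_forall fun θ => ?_)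
  rw [norm_mul, Complex.norm_exp_ofReal_mul_I, one_mul, Complex.norm_real, Real.norm_of_nonneg (Real.exp_pos _).le]
  refine le_of_eq ?_
  congr 1; ring

lemma gauss_tail {s T : ℝ} (hs : 0 < s) (hT : 0 ≤ T) (t : ℝ) :
    ‖∫ θ in (Set.Ioc (-T) T)ᶜ, Complex.exp ((-(θ * t) : ℝ) * Complex.I) * ((Real.exp (-(θ ^ 2 * s ^ 2) / 2) : ℝ) : ℂ)‖ ≤
      Real.exp (-(s ^ 2 * T ^ 2) / 4) * (4 / s) := by
  have h := integrable_exp_neg_mul_sq (b := s ^ 2 / 4) (by positivity)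
  have hh := h.const_mul (Real.exp (-(s ^ 2 * T ^ 2) / 4))
  have h1 : ‖∫ θ in (Set.Ioc (-T) T)ᶜ, Complex.exp ((-(θ * t) : ℝ) * Complex.I) * ((Real.exp (-(θ ^ 2 * s ^ 2) / 2) : ℝ) : ℂ)‖ ≤
      ∫ θ in (Set.Ioc (-T) T)ᶜ, Real.exp (-(s ^ 2 * T ^ 2) / 4) * Real.exp (-(s ^ 2 / 4) * θ ^ 2) := by
    refine MeasureTheory.norm_integral_le_of_norm_le hh.integrableOn ?_
    refine (MeasureTheory.ae_restrict_iff' (measurableSet_Ioc.compl)).mpr (Filter.Eventually.of_forall fun θ hθ => ?_)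
    rw [norm_mul, Complex.norm_exp_ofReal_mul_I, one_mul, Complex.norm_real, Real.norm_of_nonneg (Real.exp_pos _).le,
      ← Real.exp_add]
    apply Real.exp_le_exp.mpr
    have : T ^ 2 ≤ θ ^ 2 := by
      rw [sq_le_sq, _root_.abs_of_nonneg hT]
      simp only [Set.mem_compl_iff, Set.mem_Ioc, not_and_or, not_lt, not_le] at hθ
      rcases hθ with h | h
      · rw [le_abs]; right; linarith
      · rw [le_abs]; left; linarith
    have := mul_le_mul_of_nonneg_left this (sq_nonneg s)
    linarith
  have h2 : ∫ θ in (Set.Ioc (-T) T)ᶜ, Real.exp (-(s ^ 2 * T ^ 2) / 4) * Real.exp (-(s ^ 2 / 4) * θ ^ 2) ≤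
      ∫ θ : ℝ, Real.exp (-(s ^ 2 * T ^ 2) / 4) * Real.exp (-(s ^ 2 / 4) * θ ^ 2) :=
    MeasureTheory.setIntegral_le_integral hh (Filter.Eventually.of_forall fun θ => by positivity)
  refine h1.trans (h2.trans ?_)
  rw [MeasureTheory.integral_const_mul, integral_gaussian]
  gcongr
  rw [show Real.pi / (s ^ 2 / 4) = (4 * Real.pi) / s ^ 2 by field_simp, Real.sqrt_div (by positivity), Real.sqrt_sq hs.le]
  gcongr
  rw [Real.sqrt_le_left (by norm_num)]
  linarith [Real.pi_le_four]

/-- abstract inversion -/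
lemma inversion {J : Type*} [Fintype J] [DecidableEq J] {p : ℝ} (h0 : 0 ≤ p) (h1 : p ≤ 1)
    (X : (J → Bool) → ℝ) (hX : ∀ x, ∃ m : ℤ, X x = m) (μ : ℝ) {s T A M : ℝ} (hs : 0 < s) (hT : 0 ≤ T) (hTpi : T ≤ Real.pi)
    (hA : ∀ θ : ℝ, |θ| ≤ T → ‖Ex p (fun x => Complex.exp ((θ * (X x - μ) : ℝ) * Complex.I)) - ((Real.exp (-(θ ^ 2 * s ^ 2) / 2) : ℝ) : ℂ)‖ ≤ A)
    (hM : ∀ θ : ℝ, T ≤ |θ| → |θ| ≤ Real.pi → ‖Ex p (fun x => Complex.exp ((θ * (X x - μ) : ℝ) * Complex.I))‖ ≤ M) (k : ℤ) :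
    |Ex p (fun x => if X x = k then (1 : ℝ) else 0) - stdNormal ((k - μ) / s) / s| ≤ T * A + M + Real.exp (-(s ^ 2 * T ^ 2) / 4) / s := by
  set φ : ℝ → ℂ := fun θ => Ex p (fun x => Complex.exp ((θ * (X x - μ) : ℝ) * Complex.I)) with hφ
  set G : ℝ → ℂ := fun θ => ((Real.exp (-(θ ^ 2 * s ^ 2) / 2) : ℝ) : ℂ) with hG
  set E : ℝ → ℂ := fun θ => Complex.exp ((-(θ * (k - μ)) : ℝ) * Complex.I) with hE
  have hE1 : ∀ θ, ‖E θ‖ = 1 := fun θ => Complex.norm_exp_ofReal_mul_I _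
  have cE : Continuous E := by rw [hE]; fun_prop
  have cG : Continuous G := by rw [hG]; fun_prop
  have cφ : Continuous φ := by rw [hφ]; unfold Ex; fun_prop
  have inv : ∫ θ in (-Real.pi)..Real.pi, E θ * φ θ = ((2 * Real.pi * Ex p (fun x => if X x = k then (1 : ℝ) else 0) : ℝ) : ℂ) := by
    have e : (fun θ => E θ * φ θ) = fun θ : ℝ => ∑ x, W p x • Complex.exp ((θ * (X x - k) : ℝ) * Complex.I) := by
      funext θ
      simp only [hφ, hE, Ex, Finset.mul_sum]
      refine Finset.sum_congr rfl fun x _ => ?_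
      rw [mul_smul_comm, ← Complex.exp_add]
      congr 2; push_cast; ring
    rw [e, intervalIntegral.integral_finsetSum (fun i _ => Continuous.intervalIntegrable (by fun_prop) _ _)]
    unfold Ex
    rw [Finset.mul_sum, Complex.ofReal_sum]
    refine Finset.sum_congr rfl fun x _ => ?_
    rw [intervalIntegral.integral_smul]
    obtain ⟨m, hm⟩ := hX x
    have e2 : X x - k = ((m - k : ℤ) : ℝ) := by rw [hm]; push_cast; ring
    rw [e2, int_exp_int]
    by_cases h : m = k
    · subst h; simp [hm]; ring
    · have : ¬ (m : ℝ) = k := by exact_mod_cast h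
      simp [sub_eq_zero, h, hm]
  have ginv : ∫ θ : ℝ, E θ * G θ = ((2 * Real.pi * (stdNormal ((k - μ) / s) / s) : ℝ) : ℂ) := gauss_inv hs _
  have iint : ∀ a b, IntervalIntegrable (fun θ => E θ * φ θ) MeasureTheory.volume a b := fun a b => (cE.mul cφ).intervalIntegrable _ _
  have iintG : ∀ a b, IntervalIntegrable (fun θ => E θ * G θ) MeasureTheory.volume a b := fun a b => (cE.mul cG).intervalIntegrable _ _
  have s1 : ∫ θ in (-Real.pi)..Real.pi, E θ * φ θ = (∫ θ in (-Real.pi)..(-T), E θ * φ θ) + (∫ θ in (-T)..T, E θ * φ θ) + ∫ θ in T..Real.pi, E θ * φ θ := by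
    rw [intervalIntegral.integral_add_adjacent_intervals (iint _ _) (iint _ _),
      intervalIntegral.integral_add_adjacent_intervals (iint _ _) (iint _ _)]
  have s2 : ∫ θ : ℝ, E θ * G θ = (∫ θ in (-T)..T, E θ * G θ) + ∫ θ in (Set.Ioc (-T) T)ᶜ, E θ * G θ := by
    rw [intervalIntegral.integral_of_le (by linarith)]
    exact (MeasureTheory.integral_add_compl measurableSet_Ioc (gauss_int hs _)).symm
  have s3 : (∫ θ in (-T)..T, E θ * φ θ) - (∫ θ in (-T)..T, E θ * G θ) = ∫ θ in (-T)..T, E θ * (φ θ - G θ) := by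
    rw [← intervalIntegral.integral_sub (iint _ _) (iintG _ _)]
    simp only [mul_sub]
  have b1 : ‖∫ θ in (-Real.pi)..(-T), E θ * φ θ‖ ≤ M * |(-T) - (-Real.pi)| := by
    refine intervalIntegral.norm_integral_le_of_norm_le_const fun θ hθ => ?_
    rw [Set.uIoc_of_le (by linarith)] at hθ
    rw [norm_mul, hE1, one_mul]
    have hab : |θ| = -θ := abs_of_nonpos (by linarith [hθ.2])
    exact hM θ (by rw [hab]; linarith [hθ.2]) (by rw [hab]; linarith [hθ.1])
  have b3 : ‖∫ θ in T..Real.pi, E θ * φ θ‖ ≤ M * |Real.pi - T| := by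
    refine intervalIntegral.norm_integral_le_of_norm_le_const fun θ hθ => ?_
    rw [Set.uIoc_of_le hTpi] at hθ
    rw [norm_mul, hE1, one_mul]
    have hab : |θ| = θ := _root_.abs_of_nonneg (by linarith [hθ.1])
    exact hM θ (by rw [hab]; linarith [hθ.1]) (by rw [hab]; linarith [hθ.2])
  have b2 : ‖∫ θ in (-T)..T, E θ * (φ θ - G θ)‖ ≤ A * |T - (-T)| := by
    refine intervalIntegral.norm_integral_le_of_norm_le_const fun θ hθ => ?_
    rw [Set.uIoc_of_le (by linarith)] at hθ
    rw [norm_mul, hE1, one_mul]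
    exact hA θ (abs_le.mpr ⟨hθ.1.le, hθ.2⟩)
  have b4 := gauss_tail hs hT (k - μ)
  have M0 : 0 ≤ M := (norm_nonneg _).trans (hM Real.pi (by rw [_root_.abs_of_nonneg Real.pi_pos.le]; exact hTpi) (by rw [_root_.abs_of_nonneg Real.pi_pos.le]))
  rw [_root_.abs_of_nonneg (by linarith)] at b1 b2 b3
  set P := Ex p (fun x => if X x = k then (1 : ℝ) else 0)
  set g := stdNormal ((k - μ) / s) / s
  have key : ((2 * Real.pi * (P - g) : ℝ) : ℂ) = (∫ θ in (-Real.pi)..(-T), E θ * φ θ) + (∫ θ in (-T)..T, E θ * (φ θ - G θ)) +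
      (∫ θ in T..Real.pi, E θ * φ θ) - ∫ θ in (Set.Ioc (-T) T)ᶜ, E θ * G θ := by
    rw [mul_sub, Complex.ofReal_sub, ← inv, ← ginv, s1, s2, ← s3]; ring
  have hn : |2 * Real.pi * (P - g)| ≤ M * (-T - -Real.pi) + A * (T - -T) + M * (Real.pi - T) + Real.exp (-(s ^ 2 * T ^ 2) / 4) * (4 / s) := by
    rw [← Real.norm_eq_abs, ← Complex.norm_real, key]
    refine (norm_sub_le _ _).trans (add_le_add ((norm_add_le _ _).trans (add_le_add ((norm_add_le _ _).trans (add_le_add b1 b2)) b3)) b4)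
  rw [abs_mul, _root_.abs_of_pos (by positivity : 0 < 2 * Real.pi)] at hn
  have hA0 : 0 ≤ A := (norm_nonneg _).trans (hA 0 (by simpa using hT))
  have hex : 0 ≤ Real.exp (-(s ^ 2 * T ^ 2) / 4) / s := by positivity
  have hTA : 0 ≤ T * A := by positivity
  have e4 : Real.exp (-(s ^ 2 * T ^ 2) / 4) * (4 / s) = 4 * (Real.exp (-(s ^ 2 * T ^ 2) / 4) / s) := by ring
  rw [e4] at hn
  have h3 := Real.pi_gt_three
  have hMT : 0 ≤ M * T := by positivity
  refine le_of_mul_le_mul_left (a := 2 * Real.pi) ?_ (by positivity)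
  refine hn.trans ?_
  have q1 := mul_le_mul_of_nonneg_right h3.le hex
  have q2 := mul_le_mul_of_nonneg_right h3.le hTA
  linarith
end PLs
end SCL

namespace SCL
open Finset
open scoped Classical

section PMs
variable {β : Type*} [Fintype β] {H : SimpleGraph β}

lemma exp_small {c : ℝ} (hc : 0 < c) (k : ℕ) {y : ℝ} (hy : 0 ≤ y) : Real.exp (-(c * y)) * y ^ k ≤ k.factorial / c ^ k := by
  have h := Real.pow_div_factorial_le_exp (c * y) (by positivity) k
  have hf : (0 : ℝ) < k.factorial := by positivity
  rw [div_le_iff₀ hf, mul_pow] at h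
  rw [le_div_iff₀ (by positivity), Real.exp_neg]
  have he := Real.exp_pos (c * y)
  calc _ = (c ^ k * y ^ k) / Real.exp (c * y) := by field_simp
    _ ≤ _ := by rw [div_le_iff₀ he]; linarith

lemma sigma_bounds {lam : ℝ} (hlam : 0 < lam) (hconn : H.Connected) (hv2 : 2 ≤ Fintype.card β) :
    ∃ K : ℝ, 1 ≤ K ∧ ∀ (n : ℕ) (p : ℝ), lam ≤ p → p ≤ 1 - lam → Fintype.card β ≤ n →
      √(vH H n p) ≤ K * (n : ℝ) ^ (Fintype.card β - 1) ∧ (n : ℝ) ^ (Fintype.card β - 1) ≤ K * √(vH H n p) := by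
  set v := Fintype.card β with hvd
  set K1 : ℝ := (v : ℝ) ^ v * 2 ^ (HE H).card * 2 ^ v with hK1
  set K2 : ℝ := 4 * (v : ℝ) ^ 2 * ((((v : ℝ) ^ v) ^ 4 / lam ^ (4 * (HE H).card)) * 2 ^ (HE H).card) with hK2
  have hK10 : 0 ≤ K1 := by positivity
  have hK20 : 0 ≤ K2 := by positivity
  refine ⟨K1 + K2 + 1, by linarith, fun n p hp hp1 hn => ?_⟩
  have h0 : 0 ≤ p := by linarith
  have h1 : p ≤ 1 := by linarith
  have hn' : 1 ≤ n := by omega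
  have hn1 : (1 : ℝ) ≤ n := by exact_mod_cast hn'
  set N : ℝ := (n : ℝ) ^ (v - 1) with hN
  have hN0 : 0 < N := by positivity
  have hnv : (n : ℝ) ^ v = n * N := by
    rw [hN, ← pow_succ']; congr 1; omega
  have u := vH_upper (H := H) (n := n) h0 h1 (by omega) hn'
  have l := vH_lower (H := H) (n := n) hlam hp hp1 hconn hv2 hn
  rw [← hvd, ← hK1, mul_comm 2 v, pow_mul, hnv] at u
  rw [← hvd, ← hK2, mul_comm 2 v, pow_mul, hnv] at l
  have u' : vH H n p ≤ K1 * N ^ 2 := by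
    refine le_of_mul_le_mul_right (a := (n : ℝ) ^ 2) ?_ (by positivity)
    linarith
  have l' : N ^ 2 ≤ K2 * vH H n p := by
    refine le_of_mul_le_mul_right (a := (n : ℝ) ^ 2) ?_ (by positivity)
    linarith
  have hv0 : 0 ≤ vH H n p := Ex_nonneg h0 h1 fun x => sq_nonneg _
  constructor
  · rw [Real.sqrt_le_left (by positivity), mul_pow]
    refine u'.trans ?_
    gcongr
    nlinarith
  · refine abs_le_of_sq_le_sq' ?_ (by positivity) |>.2
    rw [mul_pow, Real.sq_sqrt hv0]
    refine l'.trans ?_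
    gcongr
    nlinarith

lemma norm_chi (n : ℕ) (p θ : ℝ) : ‖chi H n p θ‖ = ‖Ex p (fun x : Sym2 (Fin n) → Bool => Complex.exp ((θ * XX H x : ℝ) * Complex.I))‖ := by
  have : chi H n p θ = Complex.exp ((-(θ * mH H n p) : ℝ) * Complex.I) * Ex p (fun x : Sym2 (Fin n) → Bool => Complex.exp ((θ * XX H x : ℝ) * Complex.I)) := by
    rw [← Ex_mul_left]
    unfold chi
    congr 1
    funext x
    rw [← Complex.exp_add]
    congr 1; push_cast; ring
  rw [this, norm_mul, Complex.norm_exp_ofReal_mul_I, one_mul]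

lemma XX_int {n : ℕ} (x : Sym2 (Fin n) → Bool) : ∃ m : ℤ, XX H x = m := by
  refine ⟨∑ E ∈ copies H n, ∏ e ∈ E, if x e then 1 else 0, ?_⟩
  unfold XX
  push_cast
  rfl

/-- point probability -/
noncomputable def PP (H : SimpleGraph β) (n : ℕ) (p : ℝ) (k : ℤ) : ℝ :=
  Ex p (fun x : Sym2 (Fin n) → Bool => if XX H x = k then (1 : ℝ) else 0)

noncomputable def gg (H : SimpleGraph β) (n : ℕ) (p : ℝ) (k : ℤ) : ℝ :=
  stdNormal (((k : ℝ) - mH H n p) / √(vH H n p)) / √(vH H n p)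

lemma local_bound {lam : ℝ} (hlam : 0 < lam) (hlam2 : lam < 1 / 2) (hconn : H.Connected) (hv2 : 2 ≤ Fintype.card β)
    (q : ℕ) (hq : Fintype.card β ≤ q) :
    ∃ C : ℝ, 0 < C ∧ ∀ (n : ℕ) (p u : ℝ), lam ≤ p → p ≤ 1 - lam → Fintype.card β ≤ n → 1 ≤ u → u ^ (3 * q) = n →
      ∀ k : ℤ, √(vH H n p) * |PP H n p k - gg H n p k| ≤ C * (u ^ 4 / √n) := by
  obtain ⟨K, hK1, hK⟩ := sigma_bounds (H := H) hlam hconn hv2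
  obtain ⟨C1, hC1, hsm⟩ := small_cf H (by omega)
  obtain ⟨C2, hC2, hmid⟩ := mid_range hlam hlam2 hconn hv2 q hq 1 one_pos
  set v := Fintype.card β with hvd
  set c : ℝ := 1 / (4 * K ^ 2) with hc
  have hc0 : 0 < c := by positivity
  set C3 : ℝ := (3 * q).factorial / c ^ (3 * q) with hC3
  have hC30 : 0 < C3 := by positivity
  refine ⟨3 * K * C1 + K * C2 + C3, by positivity, fun n p u hp hp1 hn hu hun k => ?_⟩
  obtain ⟨hs1, hs2⟩ := hK n p hp hp1 hn
  have h0 : 0 ≤ p := by linarith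
  have h1 : p ≤ 1 := by linarith
  have hn' : 1 ≤ n := by omega
  have hn1 : (1 : ℝ) ≤ n := by exact_mod_cast hn'
  have hn0 : (0 : ℝ) < n := by linarith
  set N : ℝ := (n : ℝ) ^ (v - 1) with hN
  have hN0 : 0 < N := by positivity
  have hnv : (n : ℝ) ^ v = n * N := by
    rw [hN, ← pow_succ']; congr 1; omega
  set s := √(vH H n p) with hs
  have hs0 : 0 < s := by
    by_contra h
    push Not at h
    have : K * s ≤ 0 := mul_nonpos_of_nonneg_of_nonpos (by linarith) h
    linarith
  have hssq : s ^ 2 = vH H n p := Real.sq_sqrt (Ex_nonneg h0 h1 fun x => sq_nonneg _)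
  have hu0 : 0 < u := by linarith
  set T := u / N with hT
  have hT0 : 0 ≤ T := by positivity
  have hsn0 : 0 < √(n : ℝ) := Real.sqrt_pos.mpr hn0
  have huN : u ≤ N := by
    calc u ≤ u ^ (3 * q) := le_self_pow₀ hu (by omega)
      _ = n := hun
      _ ≤ N := by rw [hN]; exact le_self_pow₀ hn1 (by omega)
  have hTpi : T ≤ Real.pi := by
    have : T ≤ 1 := by rw [hT, div_le_one hN0]; exact huN
    linarith [Real.pi_gt_three]
  have hA : ∀ θ : ℝ, |θ| ≤ T → ‖Ex p (fun x : Sym2 (Fin n) → Bool => Complex.exp ((θ * (XX H x - mH H n p) : ℝ) * Complex.I)) - ((Real.exp (-(θ ^ 2 * s ^ 2) / 2) : ℝ) : ℂ)‖ ≤ 3 * C1 * u ^ 3 / √n := by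
    intro θ hθ
    have := hsm n p θ h0 h1 hn'
    rw [hssq, le_div_iff₀ hsn0]
    refine this.trans ?_
    have ht : |θ| * N ≤ u := by rw [hT, le_div_iff₀ hN0] at hθ; exact hθ
    have ht0 : 0 ≤ |θ| * N := by positivity
    have a1 : |θ| * N ≤ u ^ 3 := ht.trans (le_self_pow₀ hu (by norm_num))
    have a2 : (|θ| * N) ^ 2 ≤ u ^ 3 := (pow_le_pow_left₀ ht0 ht 2).trans (pow_le_pow_right₀ hu (by norm_num))
    have a3 : (|θ| * N) ^ 3 ≤ u ^ 3 := pow_le_pow_left₀ ht0 ht 3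
    calc _ ≤ C1 * (u ^ 3 + u ^ 3 + u ^ 3) := mul_le_mul_of_nonneg_left (add_le_add (add_le_add a1 a2) a3) hC1.le
      _ = _ := by ring
  have hM : ∀ θ : ℝ, T ≤ |θ| → |θ| ≤ Real.pi → ‖Ex p (fun x : Sym2 (Fin n) → Bool => Complex.exp ((θ * (XX H x - mH H n p) : ℝ) * Complex.I))‖ ≤ C2 / (n * N) := by
    intro θ hθ hpi
    have e := norm_chi (H := H) n p θ
    unfold chi at e
    rw [e, le_div_iff₀ (by positivity), ← hnv]
    refine hmid n p θ hp hp1 hn hpi ?_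
    rw [one_mul]
    refine hun.symm.le.trans (pow_le_pow_left₀ hu0.le ?_ _)
    rw [hT, div_le_iff₀ hN0] at hθ
    exact hθ
  have main := inversion h0 h1 (fun x : Sym2 (Fin n) → Bool => XX H x) XX_int (mH H n p) hs0 hT0 hTpi hA hM k
  have main2 : |PP H n p k - gg H n p k| ≤ T * (3 * C1 * u ^ 3 / √n) + C2 / (n * N) + Real.exp (-(s ^ 2 * T ^ 2) / 4) / s := main
  have hsq : √(n : ℝ) * √n = n := Real.mul_self_sqrt hn0.le
  have hsn1 : 1 ≤ √(n : ℝ) := by rw [Real.one_le_sqrt]; exact hn1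
  have hu4 : 1 ≤ u ^ 4 := one_le_pow₀ hu
  have hinv : 1 / (n : ℝ) ≤ u ^ 4 / √n := by
    rw [div_le_div_iff₀ hn0 hsn0, one_mul]
    calc √(n : ℝ) ≤ √n * √n := le_mul_of_one_le_right hsn0.le hsn1
      _ = n := hsq
      _ ≤ u ^ 4 * n := le_mul_of_one_le_left hn0.le hu4
  have hsT : s * T ≤ K * u := by
    rw [hT, ← mul_div_assoc, div_le_iff₀ hN0]
    calc s * u ≤ (K * N) * u := by gcongr
      _ = _ := by ring
  have hsT2 : u ≤ K * (s * T) := by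
    rw [hT, ← mul_div_assoc, ← mul_div_assoc, le_div_iff₀ hN0]
    calc u * N ≤ u * (K * s) := by gcongr
      _ = _ := by ring
  have q1 : s * (T * (3 * C1 * u ^ 3 / √n)) ≤ 3 * K * C1 * (u ^ 4 / √n) := by
    calc _ = (s * T) * (3 * C1 * u ^ 3 / √n) := by ring
      _ ≤ (K * u) * (3 * C1 * u ^ 3 / √n) := by gcongr
      _ = _ := by ring
  have q2 : s * (C2 / (n * N)) ≤ K * C2 * (u ^ 4 / √n) := by
    calc _ ≤ (K * N) * (C2 / (n * N)) := by gcongr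
      _ = K * C2 * (1 / n) := by field_simp
      _ ≤ _ := by gcongr
  have q3 : s * (Real.exp (-(s ^ 2 * T ^ 2) / 4) / s) ≤ C3 * (u ^ 4 / √n) := by
    have e1 : s * (Real.exp (-(s ^ 2 * T ^ 2) / 4) / s) = Real.exp (-(s ^ 2 * T ^ 2) / 4) := by field_simp
    have e2 : Real.exp (-(s ^ 2 * T ^ 2) / 4) ≤ Real.exp (-(c * u ^ 2)) := by
      apply Real.exp_le_exp.mpr
      have : u ^ 2 ≤ K ^ 2 * (s * T) ^ 2 := by rw [← mul_pow]; gcongr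
      have : c * u ^ 2 ≤ (s * T) ^ 2 / 4 := by
        rw [hc, div_mul_eq_mul_div, one_mul, div_le_iff₀ (by positivity)]
        linarith
      rw [← mul_pow]; linarith
    have e3 := exp_small hc0 (3 * q) (sq_nonneg u)
    rw [← pow_mul, mul_comm 2 (3 * q), pow_mul, hun, ← hC3] at e3
    rw [e1]
    refine e2.trans ?_
    have e4 : Real.exp (-(c * u ^ 2)) ≤ C3 * (1 / n) := by
      rw [mul_one_div, le_div_iff₀ hn0]
      refine le_trans ?_ e3
      gcongr
      exact le_self_pow₀ hn1 (by norm_num)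
    exact e4.trans (by gcongr)
  calc s * |PP H n p k - gg H n p k| ≤ s * (T * (3 * C1 * u ^ 3 / √n) + C2 / (n * N) + Real.exp (-(s ^ 2 * T ^ 2) / 4) / s) := by gcongr
    _ = s * (T * (3 * C1 * u ^ 3 / √n)) + s * (C2 / (n * N)) + s * (Real.exp (-(s ^ 2 * T ^ 2) / 4) / s) := by ring
    _ ≤ _ := by
      rw [add_mul, add_mul]
      exact add_le_add (add_le_add q1 q2) q3
end PMs
end SCL

namespace SCL
open Finset
open scoped Classical

section PNs
variable {β : Type*} [Fintype β] {H : SimpleGraph β}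

lemma sum_cauchy : ∃ K : ℝ, 0 < K ∧ ∀ (μ : ℝ) (F : Finset ℤ), ∑ x ∈ F, 1 / (1 + ((x : ℝ) - μ) ^ 2) ≤ K := by
  have hsum : Summable (fun k : ℤ => 1 / (1 + (k : ℝ) ^ 2)) := by
    have h1 : Summable (fun k : ℤ => 1 / (k : ℝ) ^ 2 + if k = 0 then (1 : ℝ) else 0) := by
      refine (Real.summable_one_div_int_pow.mpr (by norm_num)).add ?_
      exact (hasSum_ite_eq (0 : ℤ) (1 : ℝ)).summable
    refine Summable.of_nonneg_of_le (fun k => by positivity) (fun k => ?_) h1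
    by_cases hk : k = 0
    · subst hk; simp
    · have : (0 : ℝ) < (k : ℝ) ^ 2 := by
        have : (k : ℝ) ≠ 0 := by exact_mod_cast hk
        positivity
      simp only [hk, if_false, add_zero]
      exact one_div_le_one_div_of_le this (by linarith)
  refine ⟨3 * ∑' k : ℤ, 1 / (1 + (k : ℝ) ^ 2), ?_, fun μ F => ?_⟩
  · have := hsum.tsum_pos (fun k => by positivity) 0 (by norm_num)
    linarith
  · have hshift : ∑ x ∈ F, 1 / (1 + ((x : ℝ) - μ) ^ 2) ≤ ∑ x ∈ F, 3 * (1 / (1 + ((x - ⌊μ⌋ : ℤ) : ℝ) ^ 2)) := by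
      refine Finset.sum_le_sum fun x _ => ?_
      have hf0 := Int.fract_nonneg μ
      have hf1 := Int.fract_lt_one μ
      have e : (x : ℝ) - μ = ((x - ⌊μ⌋ : ℤ) : ℝ) - Int.fract μ := by
        push_cast; linarith [Int.floor_add_fract μ]
      rw [e]
      set k : ℝ := ((x - ⌊μ⌋ : ℤ) : ℝ)
      set f := Int.fract μ
      rw [mul_one_div, div_le_div_iff₀ (by positivity) (by positivity)]
      nlinarith [sq_nonneg (2 * k - 3 * f), sq_nonneg f]
    refine hshift.trans ?_
    rw [← Finset.mul_sum]
    gcongr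
    rw [← Finset.sum_image (g := fun x : ℤ => x - ⌊μ⌋) (f := fun k : ℤ => 1 / (1 + (k : ℝ) ^ 2)) (by intro a _ b _ h; simpa using h)]
    exact hsum.sum_le_tsum _ (fun k _ => by positivity)

lemma card_int_window (μ r : ℝ) (hr : 0 ≤ r) (F : Finset ℤ) :
    ((F.filter (fun x : ℤ => |(x : ℝ) - μ| ≤ r)).card : ℝ) ≤ 2 * r + 1 := by
  have hsub : F.filter (fun x : ℤ => |(x : ℝ) - μ| ≤ r) ⊆ Finset.Icc ⌈μ - r⌉ ⌊μ + r⌋ := by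
    intro x hx
    have := abs_le.mp (Finset.mem_filter.mp hx).2
    rw [Finset.mem_Icc, Int.ceil_le, Int.le_floor]
    constructor <;> linarith [this.1, this.2]
  have h1 : ((F.filter (fun x : ℤ => |(x : ℝ) - μ| ≤ r)).card : ℝ) ≤ ((⌊μ + r⌋ + 1 - ⌈μ - r⌉).toNat : ℝ) := by
    rw [← Int.card_Icc]; exact_mod_cast Finset.card_le_card hsub
  refine h1.trans ?_
  by_cases h : 0 ≤ ⌊μ + r⌋ + 1 - ⌈μ - r⌉
  · have : ((⌊μ + r⌋ + 1 - ⌈μ - r⌉).toNat : ℝ) = (((⌊μ + r⌋ + 1 - ⌈μ - r⌉ : ℤ)) : ℝ) := by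
      rw [← Int.cast_natCast, Int.toNat_of_nonneg h]
    rw [this]; push_cast
    linarith [Int.floor_le (μ + r), Int.le_ceil (μ - r)]
  · rw [Int.toNat_of_nonpos (by omega)]; simp; linarith

lemma tail_moment {lam : ℝ} (hlam : 0 < lam) (hlam2 : lam < 1 / 2) (H : SimpleGraph β) (j : ℕ) :
    ∃ C : ℝ, 0 < C ∧ ∀ (n : ℕ) (p : ℝ), lam ≤ p → p ≤ 1 - lam →
      Ex p (fun x : Sym2 (Fin n) → Bool => (XX H x - mH H n p) ^ (2 ^ (j + 1))) ≤ C * vH H n p ^ (2 ^ j) := by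
  obtain ⟨C, hC, h⟩ := bonami_pow hlam hlam2 (HE H).card j
  refine ⟨C, hC, fun n p hp hp1 => ?_⟩
  have e : (fun x : Sym2 (Fin n) → Bool => XX H x - mH H n p) =
      fun x => ∑ S ∈ (Finset.univ.erase (∅ : Finset (Sym2 (Fin n)))).filter (fun S => NS H S ≠ 0), aS H p S * mono p S x := by
    funext x
    rw [XX_centered, Finset.sum_filter]
    refine Finset.sum_congr rfl fun S _ => ?_
    split_ifs with hS
    · rfl
    · rw [aS_zero H p S (by simpa using hS), zero_mul]
  have r := Rep.monoLC (p := p) (by linarith) (by linarith) (HE H).card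
    ((Finset.univ.erase (∅ : Finset (Sym2 (Fin n)))).filter (fun S => NS H S ≠ 0)) (aS H p) (fun S => S)
    (fun S hS => card_le_of_NS H S (Finset.mem_filter.mp hS).2)
  rw [← e] at r
  exact h (Sym2 (Fin n)) p hp hp1 _ _ r

lemma sum_PP_tail {lam : ℝ} (hlam : 0 < lam) (hlam2 : lam < 1 / 2) (H : SimpleGraph β) (j : ℕ) :
    ∃ C : ℝ, 0 < C ∧ ∀ (n : ℕ) (p u : ℝ) (F : Finset ℤ), lam ≤ p → p ≤ 1 - lam → 0 < vH H n p → 0 < u →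
      ∑ x ∈ F.filter (fun x : ℤ => ¬ |(x : ℝ) - mH H n p| ≤ √(vH H n p) * u), PP H n p x ≤ C / u ^ (2 ^ (j + 1)) := by
  obtain ⟨C, hC, h⟩ := tail_moment hlam hlam2 H j
  refine ⟨C, hC, fun n p u F hp hp1 hv hu => ?_⟩
  have h0 : 0 ≤ p := by linarith
  have h1 : p ≤ 1 := by linarith
  set s := √(vH H n p) with hs
  have hs0 : 0 < s := Real.sqrt_pos.mpr hv
  unfold PP
  rw [← Ex_sum]
  have hev : Even (2 ^ (j + 1)) := by rw [pow_succ]; exact ⟨2 ^ j, by ring⟩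
  have hpt : ∀ x : Sym2 (Fin n) → Bool, ∑ k ∈ F.filter (fun x : ℤ => ¬ |(x : ℝ) - mH H n p| ≤ s * u), (if XX H x = k then (1 : ℝ) else 0) ≤
      (1 / (s * u) ^ (2 ^ (j + 1))) * (XX H x - mH H n p) ^ (2 ^ (j + 1)) := by
    intro x
    have hnn : 0 ≤ (XX H x - mH H n p) ^ (2 ^ (j + 1)) := hev.pow_nonneg _
    obtain ⟨m, hm⟩ := XX_int (H := H) x
    have e : ∀ k : ℤ, (if XX H x = k then (1 : ℝ) else 0) = if m = k then 1 else 0 := by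
      intro k
      rw [hm]; simp
    simp only [e]
    rw [Finset.sum_ite_eq]
    split_ifs with hmem
    · have hb := (Finset.mem_filter.mp hmem).2
      push Not at hb
      rw [← hm] at hb
      rw [one_div, ← div_eq_inv_mul, le_div_iff₀ (by positivity), one_mul, ← hev.pow_abs (XX H x - mH H n p)]
      exact pow_le_pow_left₀ (by positivity) hb.le _
    · exact mul_nonneg (by positivity) hnn
  refine (Ex_mono h0 h1 hpt).trans ?_
  rw [Ex_mul_left]
  have hss : s ^ (2 ^ (j + 1)) = vH H n p ^ (2 ^ j) := by
    rw [pow_succ, mul_comm, pow_mul, hs, Real.sq_sqrt hv.le]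
  calc _ ≤ (1 / (s * u) ^ (2 ^ (j + 1))) * (C * vH H n p ^ (2 ^ j)) := mul_le_mul_of_nonneg_left (h n p hp hp1) (by positivity)
    _ = C / u ^ (2 ^ (j + 1)) := by
      rw [mul_pow, hss]; field_simp

lemma stdN_bound {u z : ℝ} (hu : 0 ≤ u) (hz : u ≤ |z|) : stdNormal z ≤ Real.exp (-(1 / 4 * u ^ 2)) * (4 / (1 + z ^ 2)) := by
  unfold stdNormal
  have h1 : (√(2 * Real.pi))⁻¹ ≤ 1 := by
    apply inv_le_one_of_one_le₀
    rw [Real.one_le_sqrt]; linarith [Real.pi_gt_three]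
  have hz2 : u ^ 2 ≤ z ^ 2 := by rw [← sq_abs z]; gcongr
  have h2 : Real.exp (-(z ^ 2) / 2) ≤ Real.exp (-(1 / 4 * u ^ 2)) * Real.exp (-(z ^ 2 / 4)) := by
    rw [← Real.exp_add]; apply Real.exp_le_exp.mpr; linarith
  have h3 : Real.exp (-(z ^ 2 / 4)) ≤ 4 / (1 + z ^ 2) := by
    rw [le_div_iff₀ (by positivity), Real.exp_neg, inv_mul_le_iff₀ (Real.exp_pos _)]
    linarith [Real.add_one_le_exp (z ^ 2 / 4)]
  calc _ ≤ 1 * Real.exp (-(z ^ 2) / 2) := by gcongr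
    _ ≤ 1 * (Real.exp (-(1 / 4 * u ^ 2)) * (4 / (1 + z ^ 2))) := by
        gcongr; exact h2.trans (by gcongr)
    _ = _ := one_mul _

lemma cauchy_cmp {s K N : ℝ} (d : ℝ) (hs0 : 0 < s) (hK : 0 < K) (hN1 : 1 ≤ N) (hs1 : s ≤ K * N) (hs2 : N ≤ K * s) :
    4 / (1 + (d / s) ^ 2) / s ≤ (4 * (K + K * N)) * (1 / (1 + d ^ 2)) := by
  have e : 4 / (1 + (d / s) ^ 2) / s = 4 * s / (s ^ 2 + d ^ 2) := by
    rw [div_pow]; field_simp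
  rw [e, mul_one_div, div_le_div_iff₀ (by positivity) (by positivity)]
  have a1 : 1 ≤ K * s := by linarith
  have a2 : s * 1 ≤ s * (K * s) := mul_le_mul_of_nonneg_left a1 hs0.le
  have a3 : s * d ^ 2 ≤ (K * N) * d ^ 2 := by gcongr
  have a4 : 0 ≤ K * d ^ 2 := by positivity
  have a5 : 0 ≤ K * N * s ^ 2 := by positivity
  linarith

set_option maxHeartbeats 1000000 in
lemma sum_bound {lam : ℝ} (hlam : 0 < lam) (hlam2 : lam < 1 / 2) (hconn : H.Connected) (hv2 : 2 ≤ Fintype.card β)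
    (q : ℕ) (hq : Fintype.card β ≤ q) :
    ∃ C : ℝ, 0 < C ∧ ∀ (n : ℕ) (p u : ℝ), lam ≤ p → p ≤ 1 - lam → Fintype.card β ≤ n → 1 ≤ u → u ^ (3 * q) = n →
      ∀ F : Finset ℤ, ∑ k ∈ F, |PP H n p k - gg H n p k| ≤ C * (u ^ 5 / √n) := by
  obtain ⟨K, hK1, hK⟩ := sigma_bounds (H := H) hlam hconn hv2
  obtain ⟨C1, hC1, hloc⟩ := local_bound hlam hlam2 hconn hv2 q hq
  obtain ⟨C2, hC2, htail⟩ := sum_PP_tail hlam hlam2 H (3 * q)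
  obtain ⟨S0, hS0, hcau⟩ := sum_cauchy
  set v := Fintype.card β with hvd
  set C3 : ℝ := (3 * q * v).factorial / (1 / 4) ^ (3 * q * v) with hC3
  have hC30 : 0 < C3 := by positivity
  refine ⟨C1 * (2 + K) + C2 + C3 * (4 * S0 * (K + K)), by positivity, fun n p u hp hp1 hn hu hun F => ?_⟩
  obtain ⟨hs1, hs2⟩ := hK n p hp hp1 hn
  have h0 : 0 ≤ p := by linarith
  have h1 : p ≤ 1 := by linarith
  have hn' : 1 ≤ n := by omega
  have hn1 : (1 : ℝ) ≤ n := by exact_mod_cast hn'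
  have hn0 : (0 : ℝ) < n := by linarith
  set N : ℝ := (n : ℝ) ^ (v - 1) with hN
  have hN1 : 1 ≤ N := one_le_pow₀ hn1
  have hnv : (n : ℝ) ^ v = n * N := by
    rw [hN, ← pow_succ']; congr 1; omega
  have hloc' := hloc n p u hp hp1 hn hu hun
  set s := √(vH H n p) with hs
  have hs0 : 0 < s := by
    by_contra h
    push Not at h
    have : K * s ≤ 0 := mul_nonpos_of_nonneg_of_nonpos (by linarith) h
    linarith
  have hvpos : 0 < vH H n p := Real.sqrt_pos.mp hs0
  have hu0 : 0 < u := by linarith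
  have hsn0 : 0 < √(n : ℝ) := Real.sqrt_pos.mpr hn0
  have hsq : √(n : ℝ) * √n = n := Real.mul_self_sqrt hn0.le
  have hsn1 : 1 ≤ √(n : ℝ) := by rw [Real.one_le_sqrt]; exact hn1
  have hu5 : 1 ≤ u ^ 5 := one_le_pow₀ hu
  have hinv : 1 / (n : ℝ) ≤ u ^ 5 / √n := by
    rw [div_le_div_iff₀ hn0 hsn0, one_mul]
    calc √(n : ℝ) ≤ √n * √n := le_mul_of_one_le_right hsn0.le hsn1
      _ = n := hsq
      _ ≤ u ^ 5 * n := le_mul_of_one_le_left hn0.le hu5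
  have hKs : 1 / s ≤ K := by
    rw [div_le_iff₀ hs0]; linarith
  set μ := mH H n p with hμ
  rw [← Finset.sum_filter_add_sum_filter_not F (fun x : ℤ => |(x : ℝ) - μ| ≤ s * u)]
  have A : ∑ k ∈ F.filter (fun x : ℤ => |(x : ℝ) - μ| ≤ s * u), |PP H n p k - gg H n p k| ≤ C1 * (2 + K) * (u ^ 5 / √n) := by
    have hp1 : ∀ k : ℤ, |PP H n p k - gg H n p k| ≤ C1 * (u ^ 4 / √n) / s := by
      intro k; rw [le_div_iff₀ hs0, mul_comm]; exact hloc' k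
    calc _ ≤ ∑ k ∈ F.filter (fun x : ℤ => |(x : ℝ) - μ| ≤ s * u), C1 * (u ^ 4 / √n) / s := Finset.sum_le_sum fun k _ => hp1 k
      _ = ((F.filter (fun x : ℤ => |(x : ℝ) - μ| ≤ s * u)).card : ℝ) * (C1 * (u ^ 4 / √n) / s) := by simp
      _ ≤ (2 * (s * u) + 1) * (C1 * (u ^ 4 / √n) / s) := by
          gcongr; exact card_int_window μ (s * u) (by positivity) F
      _ = (2 * u + 1 / s) * (C1 * (u ^ 4 / √n)) := by field_simp
      _ ≤ (2 * u + K * u) * (C1 * (u ^ 4 / √n)) := by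
          gcongr
          exact hKs.trans (le_mul_of_one_le_right (by linarith) hu)
      _ = _ := by ring
  have B : ∑ k ∈ F.filter (fun x : ℤ => ¬ |(x : ℝ) - μ| ≤ s * u), PP H n p k ≤ C2 * (u ^ 5 / √n) := by
    refine (htail n p u F hp hp1 hvpos hu0).trans ?_
    have : (n : ℝ) ≤ u ^ (2 ^ (3 * q + 1)) := by
      rw [← hun]
      exact pow_le_pow_right₀ hu ((Nat.lt_two_pow_self).le.trans (Nat.pow_le_pow_right (by norm_num) (by omega)))
    calc C2 / u ^ (2 ^ (3 * q + 1)) ≤ C2 / n := by gcongr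
      _ = C2 * (1 / n) := by ring
      _ ≤ _ := by gcongr
  have D : ∑ k ∈ F.filter (fun x : ℤ => ¬ |(x : ℝ) - μ| ≤ s * u), gg H n p k ≤ C3 * (4 * S0 * (K + K)) * (u ^ 5 / √n) := by
    set ex := Real.exp (-(1 / 4 * u ^ 2)) with hex
    have hex0 : 0 < ex := Real.exp_pos _
    have hexb : ex * (n * N) ≤ C3 := by
      have := exp_small (c := 1 / 4) (by norm_num) (3 * q * v) (sq_nonneg u)
      rw [← pow_mul, mul_comm 2, pow_mul, pow_mul, hun, hnv] at this
      refine le_trans ?_ this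
      gcongr
      exact le_self_pow₀ (by nlinarith) (by norm_num)
    have pt : ∀ k ∈ F.filter (fun x : ℤ => ¬ |(x : ℝ) - μ| ≤ s * u), gg H n p k ≤ (ex * (4 * (K + K * N))) * (1 / (1 + ((k : ℝ) - μ) ^ 2)) := by
      intro k hk
      have hb := (Finset.mem_filter.mp hk).2
      push Not at hb
      have hz : u ≤ |((k : ℝ) - μ) / s| := by
        rw [abs_div, _root_.abs_of_pos hs0, le_div_iff₀ hs0]; linarith
      have := stdN_bound hu0.le hz
      have hle := cauchy_cmp ((k : ℝ) - μ) hs0 (by linarith) (by linarith) hs1 hs2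
      calc gg H n p k = stdNormal (((k : ℝ) - μ) / s) / s := rfl
        _ ≤ ex * (4 / (1 + (((k : ℝ) - μ) / s) ^ 2)) / s := by gcongr
        _ = ex * (4 / (1 + (((k : ℝ) - μ) / s) ^ 2) / s) := by ring
        _ ≤ ex * ((4 * (K + K * N)) * (1 / (1 + ((k : ℝ) - μ) ^ 2))) := by gcongr
        _ = _ := by ring
    refine (Finset.sum_le_sum pt).trans ?_
    rw [← Finset.mul_sum]
    have hK0 : 0 < K := by linarith
    calc _ ≤ (ex * (4 * (K + K * N))) * S0 := by gcongr; exact hcau μ _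
      _ ≤ (ex * (4 * (K * N + K * N))) * S0 := by
          gcongr; exact le_mul_of_one_le_right hK0.le hN1
      _ = (ex * (n * N)) * (4 * S0 * (K + K)) * (1 / n) := by field_simp
      _ ≤ C3 * (4 * S0 * (K + K)) * (u ^ 5 / √n) := by gcongr
  have E : ∑ k ∈ F.filter (fun x : ℤ => ¬ |(x : ℝ) - μ| ≤ s * u), |PP H n p k - gg H n p k| ≤
      ∑ k ∈ F.filter (fun x : ℤ => ¬ |(x : ℝ) - μ| ≤ s * u), PP H n p k + ∑ k ∈ F.filter (fun x : ℤ => ¬ |(x : ℝ) - μ| ≤ s * u), gg H n p k := by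
    rw [← Finset.sum_add_distrib]
    refine Finset.sum_le_sum fun k _ => ?_
    have a : 0 ≤ PP H n p k := Ex_nonneg h0 h1 fun x => by split_ifs <;> norm_num
    have b : 0 ≤ gg H n p k := by unfold gg stdNormal; positivity
    rw [abs_le]; constructor <;> linarith
  rw [add_mul, add_mul]
  linarith
end PNs
end SCL

namespace SCL
open Finset
open scoped Classical

section POs
variable {β : Type*} [Fintype β] {H : SimpleGraph β}

lemma integral_bern {J : Type*} [Fintype J] [DecidableEq J] {p : ℝ} (h0 : 0 ≤ p) (h1 : p ≤ 1) (f : (J → Bool) → ℝ) :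
    ∫ ω, f ω ∂(bernoulliPi J p) = Ex p f := by
  unfold bernoulliPi
  have hc : ∀ x : J → Bool, (∏ i, ENNReal.ofReal (if x i then p else 1 - p)) ≠ ⊤ := fun x =>
    ENNReal.prod_ne_top fun i _ => ENNReal.ofReal_ne_top
  rw [MeasureTheory.integral_finsetSum_measure]
  · unfold Ex
    refine Finset.sum_congr rfl fun x _ => ?_
    rw [MeasureTheory.integral_smul_measure, MeasureTheory.integral_dirac, ENNReal.toReal_prod]
    congr 1
    unfold W
    refine Finset.prod_congr rfl fun i _ => ?_
    have := wt_nonneg h0 h1 (x i)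
    exact ENNReal.toReal_ofReal this
  · intro x _
    exact MeasureTheory.Integrable.smul_measure (MeasureTheory.Integrable.of_finite) (hc x)

lemma prob_bern {J : Type*} [Fintype J] [DecidableEq J] {p : ℝ} (h0 : 0 ≤ p) (h1 : p ≤ 1) (X : (J → Bool) → ℝ) (k : ℝ) :
    (bernoulliPi J p {ω | X ω = k}).toReal = Ex p (fun x => if X x = k then (1 : ℝ) else 0) := by
  rw [← integral_bern h0 h1]
  have hm : MeasurableSet {ω | X ω = k} := (Set.toFinite _).measurableSet
  have := MeasureTheory.integral_indicator_one (μ := bernoulliPi J p) hm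
  rw [MeasureTheory.measureReal_def] at this
  rw [← this]
  congr 1

lemma count_eq {n : ℕ} (ω : Sym2 (Fin n) → Bool) : (subgraphCount H (graphOfFn ω) : ℝ) = XX H ω := by
  have h1 : subgraphCount H (graphOfFn ω) = ((copies H n).filter (fun E => ∀ e ∈ E, ω e = true)).card := by
    unfold subgraphCount
    rw [Nat.card_eq_fintype_card, Fintype.card_subtype]
    congr 1
    ext E
    simp only [mem_filter, mem_univ, true_and, copies, mem_image]
    have hcp : ∀ f : β ↪ Fin n, (↑(cp H f) : Set (Sym2 (Fin n))) = Sym2.map f '' H.edgeSet := by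
      intro f
      unfold cp HE
      rw [Finset.coe_image]
      congr 1
      ext e; simp
    constructor
    · rintro ⟨hs, f, hf⟩
      refine ⟨⟨f, ?_⟩, ?_⟩
      · apply Finset.coe_injective; rw [hcp, hf]
      · intro e he
        have := hs he
        induction e using Sym2.ind with
        | _ a b =>
          simp only [graphOfFn, SimpleGraph.mem_edgeSet, SimpleGraph.fromRel_adj] at this
          rcases this.2 with h | h
          · exact h
          · rw [Sym2.eq_swap]; exact h
    · rintro ⟨⟨f, rfl⟩, hω⟩
      refine ⟨?_, f, hcp f⟩
      intro e he
      have hw := hω e he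
      rw [hcp] at he
      obtain ⟨g, hg, rfl⟩ := he
      have hnd : ¬ (Sym2.map f g).IsDiag := by
        rw [Sym2.isDiag_map f.injective]; exact H.not_isDiag_of_mem_edgeSet hg
      generalize Sym2.map f g = e at hw hnd
      induction e using Sym2.ind with
      | _ a b =>
        simp only [graphOfFn, SimpleGraph.mem_edgeSet, SimpleGraph.fromRel_adj]
        exact ⟨by simpa using hnd, Or.inl hw⟩
  rw [h1]
  unfold XX
  simp only [Finset.prod_boole]
  rw [Finset.card_filter]
  push_cast
  refine Finset.sum_congr rfl fun x _ => ?_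
  congr

end POs
end SCL


theorem subgraph_count_local_clt_gnp
    {β : Type*} [Fintype β] (H : SimpleGraph β)
    (hconn : H.Connected) (hedge : H.edgeSet.Nonempty)
    (lam ε : ℝ) (hlam : lam ∈ Set.Ioo (0 : ℝ) (1 / 2)) (hε : 0 < ε) :
    ∃ C : ℝ, 0 < C ∧ ∀ n : ℕ, Fintype.card β ≤ n → ∀ p ∈ Set.Ioo lam (1 - lam),
      let μ := gnp n p
      let X : (Sym2 (Fin n) → Bool) → ℝ := fun ω => (subgraphCount H (graphOfFn ω) : ℝ)
      let μH := ∫ ω, X ω ∂μ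
      let σH := Real.sqrt (∫ ω, (X ω - μH) ^ 2 ∂μ)
      (∀ x : ℤ, |σH * (μ {ω | X ω = (x : ℝ)}).toReal - stdNormal (((x : ℝ) - μH) / σH)|
          ≤ C * (n : ℝ) ^ (ε - 1 / 2)) ∧
      (∑' x : ℤ, |(μ {ω | X ω = (x : ℝ)}).toReal - stdNormal (((x : ℝ) - μH) / σH) / σH|)
          ≤ C * (n : ℝ) ^ (ε - 1 / 2) := by
  have hlam0 := hlam.1
  have hlam2 := hlam.2
  have hv2 : 2 ≤ Fintype.card β := by
    obtain ⟨e, he⟩ := hedge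
    induction e using Sym2.ind with
    | _ a b =>
      have hab : a ≠ b := (SimpleGraph.mem_edgeSet H |>.mp he).ne
      exact Fintype.one_lt_card_iff.mpr ⟨a, b, hab⟩
  obtain ⟨m, hm⟩ := exists_nat_gt (5 / ε)
  set q := max (Fintype.card β) m with hqd
  have hq : Fintype.card β ≤ q := le_max_left _ _
  have hqm : (m : ℝ) ≤ q := by exact_mod_cast le_max_right _ _
  have hq0 : (0 : ℝ) < q := lt_of_lt_of_le (by positivity) (hm.le.trans hqm)
  obtain ⟨C1, hC1, hloc⟩ := SCL.local_bound hlam0 hlam2 hconn hv2 q hq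
  obtain ⟨C2, hC2, hsum⟩ := SCL.sum_bound hlam0 hlam2 hconn hv2 q hq
  obtain ⟨K, hK1, hK⟩ := SCL.sigma_bounds (H := H) hlam0 hconn hv2
  refine ⟨C1 + C2, by positivity, fun n hn p hp => ?_⟩
  have hp0 : lam ≤ p := hp.1.le
  have hp1 : p ≤ 1 - lam := hp.2.le
  have h0 : 0 ≤ p := by linarith
  have h1 : p ≤ 1 := by linarith
  intro μ X μH σH
  have hX : X = fun ω => SCL.XX H ω := funext fun ω => SCL.count_eq ω
  have hμH : μH = SCL.mH H n p := by
    show ∫ ω, X ω ∂(bernoulliPi _ p) = _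
    rw [SCL.integral_bern h0 h1, hX]; rfl
  have hσH : σH = √(SCL.vH H n p) := by
    show √(∫ ω, (X ω - μH) ^ 2 ∂(bernoulliPi _ p)) = _
    rw [SCL.integral_bern h0 h1, hX, hμH]; rfl
  have hP : ∀ x : ℤ, (μ {ω | X ω = (x : ℝ)}).toReal = SCL.PP H n p x := by
    intro x
    show (bernoulliPi _ p {ω | X ω = (x : ℝ)}).toReal = _
    rw [SCL.prob_bern h0 h1, hX]
    unfold SCL.PP
    congr 1
  have hn' : 1 ≤ n := by omega
  have hn1 : (1 : ℝ) ≤ n := by exact_mod_cast hn'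
  have hn0 : (0 : ℝ) < n := by linarith
  set u : ℝ := (n : ℝ) ^ (1 / (3 * q : ℝ)) with hu
  have hu1 : 1 ≤ u := Real.one_le_rpow hn1 (by positivity)
  have hun : u ^ (3 * q) = n := by
    rw [hu, ← Real.rpow_natCast, ← Real.rpow_mul hn0.le]
    push_cast
    rw [one_div_mul_cancel (by positivity), Real.rpow_one]
  have hu5 : u ^ 5 / √n ≤ (n : ℝ) ^ (ε - 1 / 2) := by
    rw [hu, ← Real.rpow_natCast, ← Real.rpow_mul hn0.le, Real.sqrt_eq_rpow, ← Real.rpow_sub hn0]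
    apply Real.rpow_le_rpow_of_exponent_le hn1
    have h5 : 5 / ε < q := lt_of_lt_of_le hm hqm
    rw [div_lt_iff₀ hε] at h5
    have : 1 / (3 * q : ℝ) * (5 : ℕ) ≤ ε := by
      push_cast
      rw [div_mul_eq_mul_div, div_le_iff₀ (by positivity)]
      nlinarith
    linarith
  have hu4 : u ^ 4 / √n ≤ (n : ℝ) ^ (ε - 1 / 2) := by
    refine le_trans ?_ hu5
    gcongr
    norm_num
  have hr0 : 0 ≤ (n : ℝ) ^ (ε - 1 / 2) := by positivity
  have hv0 : 0 < √(SCL.vH H n p) := by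
    obtain ⟨-, h⟩ := hK n p hp0 hp1 hn
    have hN : (0 : ℝ) < (n : ℝ) ^ (Fintype.card β - 1) := by positivity
    by_contra hc
    push Not at hc
    have : K * √(SCL.vH H n p) ≤ 0 := mul_nonpos_of_nonneg_of_nonpos (by linarith) hc
    linarith
  constructor
  · intro x
    rw [hP, hσH, hμH]
    have := hloc n p u hp0 hp1 hn hu1 hun x
    have e : √(SCL.vH H n p) * SCL.PP H n p x - stdNormal (((x : ℝ) - SCL.mH H n p) / √(SCL.vH H n p)) =
        √(SCL.vH H n p) * (SCL.PP H n p x - SCL.gg H n p x) := by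
      unfold SCL.gg
      field_simp
    rw [e, abs_mul, abs_of_pos hv0]
    refine this.trans ?_
    calc C1 * (u ^ 4 / √n) ≤ C1 * (n : ℝ) ^ (ε - 1 / 2) := by gcongr
      _ ≤ _ := by gcongr; linarith
  · refine Real.tsum_le_of_sum_le (fun x => abs_nonneg _) fun F => ?_
    have := hsum n p u hp0 hp1 hn hu1 hun F
    simp only [hP, hσH, hμH]
    refine le_trans (le_of_eq ?_) (this.trans ?_)
    · rfl
    calc C2 * (u ^ 5 / √n) ≤ C2 * (n : ℝ) ^ (ε - 1 / 2) := by gcongr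
      _ ≤ _ := by gcongr; linarith
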